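/- arXiv:1508.04651 — 3 statements merged into one kernel-verified Lean document; each statement's English description precedes it below -/
import Mathlib

section
/- Let (A,B,C) be a bipartite LR triple on V of diameter d ≥ 4, with tridiagonal space 𝒳 and J as defined. Then 𝒳 has dimension 8; moreover J, AJ, BJ, ACBJ form a basis of the vector space 𝒳J = {XJ : X ∈ 𝒳}, and I−J, A(I−J), B(I−J), ABC(I−J) form a basis of the vector space 𝒳(I−J) = {X(I−J) : X ∈ 𝒳} (products denote composition). -/
/-- A decomposition of `V` of diameter `d`: a sequence of one-dimensional subspaces
`sub 0, …, sub d` whose (direct) sum is `V`; by convention `sub i = ⊥` for `i > d`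
(encoding `V_{-1} = 0` and `V_{d+1} = 0`). -/
structure LRDecomp (F : Type*) [Field F] (V : Type*) [AddCommGroup V] [Module F V]
    (d : ℕ) where
  sub : ℕ → Submodule F V
  finrank_eq_one : ∀ i ≤ d, Module.finrank F (sub i) = 1
  eq_bot_of_gt : ∀ i, d < i → sub i = ⊥
  isInternal : DirectSum.IsInternal fun i : Fin (d + 1) => sub i.val

variable {F : Type*} [Field F] {V : Type*} [AddCommGroup V] [Module F V]

/-- `A` lowers the decomposition: `A V_i = V_{i-1}` for `0 ≤ i ≤ d` (with `V_{-1} = 0`). -/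
def Lowers {d : ℕ} (A : Module.End F V) (D : LRDecomp F V d) : Prop :=
  Submodule.map A (D.sub 0) = ⊥ ∧ ∀ i < d, Submodule.map A (D.sub (i + 1)) = D.sub i

/-- `B` raises the decomposition: `B V_i = V_{i+1}` for `0 ≤ i ≤ d` (with `V_{d+1} = 0`). -/
def Raises {d : ℕ} (B : Module.End F V) (D : LRDecomp F V d) : Prop :=
  ∀ i ≤ d, Submodule.map B (D.sub i) = D.sub (i + 1)

/-- `D` is the (A,B)-decomposition: it is lowered by `A` and raised by `B`. -/
def IsLRPairWith {d : ℕ} (A B : Module.End F V) (D : LRDecomp F V d) : Prop :=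
  Lowers A D ∧ Raises B D

/-- `(A,B,C)` is an LR triple of diameter `d`. -/
def IsLRTriple (d : ℕ) (A B C : Module.End F V) : Prop :=
  (∃ D : LRDecomp F V d, IsLRPairWith A B D) ∧
  (∃ D : LRDecomp F V d, IsLRPairWith B C D) ∧
  (∃ D : LRDecomp F V d, IsLRPairWith C A D)

/-- `X` is tridiagonal with respect to the decomposition `D`:
`X V_i ⊆ V_{i-1} + V_i + V_{i+1}` (note `V_{0-1} ⊔ V_0 = V_0` makes `ℕ`-subtraction correct). -/
def IsTridiagonal {d : ℕ} (X : Module.End F V) (D : LRDecomp F V d) : Prop :=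
  ∀ i, ∀ v ∈ D.sub i, X v ∈ D.sub (i - 1) ⊔ D.sub i ⊔ D.sub (i + 1)

/-- The tridiagonal space of the LR triple with decompositions `D₁, D₂, D₃`. -/
def tridiagSpace {d : ℕ} (D₁ D₂ D₃ : LRDecomp F V d) : Submodule F (Module.End F V) where
  carrier := {X | IsTridiagonal X D₁ ∧ IsTridiagonal X D₂ ∧ IsTridiagonal X D₃}
  add_mem' := by
    rintro X Y ⟨hX1, hX2, hX3⟩ ⟨hY1, hY2, hY3⟩
    exact ⟨fun i v hv => by simpa using add_mem (hX1 i v hv) (hY1 i v hv),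
           fun i v hv => by simpa using add_mem (hX2 i v hv) (hY2 i v hv),
           fun i v hv => by simpa using add_mem (hX3 i v hv) (hY3 i v hv)⟩
  zero_mem' :=
    ⟨fun i v _ => by simp,
     fun i v _ => by simp,
     fun i v _ => by simp⟩
  smul_mem' := by
    rintro c X ⟨hX1, hX2, hX3⟩
    exact ⟨fun i v hv => by simpa using Submodule.smul_mem _ c (hX1 i v hv),
           fun i v hv => by simpa using Submodule.smul_mem _ c (hX2 i v hv),
           fun i v hv => by simpa using Submodule.smul_mem _ c (hX3 i v hv)⟩

/-- `E` is the idempotent sequence of the decomposition `D`: each `E i` acts as the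
identity on `sub i` and as zero on `sub j` for `j ≠ i`. -/
def IsIdemSeq {d : ℕ} (D : LRDecomp F V d) (E : ℕ → Module.End F V) : Prop :=
  ∀ i, (∀ v ∈ D.sub i, E i v = v) ∧ ∀ j, j ≠ i → ∀ v ∈ D.sub j, E i v = 0

/-- Bipartite: all trace data `a_i = tr(C E_i)`, `a'_i = tr(A E'_i)`, `a''_i = tr(B E''_i)`
vanish, where `E, E', E''` are the idempotent data of the triple `(A,B,C)`. -/
def IsBipartite (d : ℕ) (A B C : Module.End F V)
    (E E' E'' : ℕ → Module.End F V) : Prop :=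
  ∀ i ≤ d, LinearMap.trace F V (C * E i) = 0 ∧
    LinearMap.trace F V (A * E' i) = 0 ∧ LinearMap.trace F V (B * E'' i) = 0

/-- An LR pair `(A,B)` has `q`-Weyl type. -/
def IsQWeylPair (q : F) (A B : Module.End F V) : Prop :=
  q ≠ 0 ∧ q ^ 2 ≠ 1 ∧ q • (A * B) - q⁻¹ • (B * A) = (q - q⁻¹) • (1 : Module.End F V)

/-- An LR triple `(A,B,C)` has `q`-Weyl type. -/
def IsQWeylTriple (q : F) (A B C : Module.End F V) : Prop :=
  IsQWeylPair q A B ∧ IsQWeylPair q B C ∧ IsQWeylPair q C A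

/-- `v` is an `(A,B)`-basis, relative to the `(A,B)`-decomposition `D`:
`v i ∈ sub i` is nonzero and `A v_i = v_{i-1}`. -/
def IsLRBasisFor {d : ℕ} (A : Module.End F V) (D : LRDecomp F V d) (v : ℕ → V) : Prop :=
  (∀ i ≤ d, v i ∈ D.sub i ∧ v i ≠ 0) ∧ ∀ i, 1 ≤ i → i ≤ d → A (v i) = v (i - 1)

/-- `v` is a `(B,A)`-style basis relative to the `(A,B)`-decomposition `D` of the
reversed pair: `v i ∈ sub (d-i)` is nonzero and the lowering map sends `v i ↦ v (i-1)`.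
(Used for `(C,B)`-bases relative to the `(B,C)`-decomposition, etc.) -/
def IsLRBasisRev {d : ℕ} (A : Module.End F V) (D : LRDecomp F V d) (v : ℕ → V) : Prop :=
  (∀ i ≤ d, v i ∈ D.sub (d - i) ∧ v i ≠ 0) ∧ ∀ i, 1 ≤ i → i ≤ d → A (v i) = v (i - 1)

/-- The transition matrix from the basis `u` to the basis `w` is upper triangular
Toeplitz with parameters `α`: `w j = ∑_{i ≤ j} α_{j-i} u_i`. -/
def IsToeplitzTransition (d : ℕ) (u w : ℕ → V) (α : ℕ → F) : Prop :=
  ∀ j ≤ d, w j = ∑ i ∈ Finset.range (j + 1), α (j - i) • u i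

/-- `φ` is the parameter sequence of the LR pair `(A,B)` with `(A,B)`-decomposition `D`:
`BA` acts on `V_i` as `φ i` for `1 ≤ i ≤ d`, with conventions `φ 0 = 0 = φ (d+1)`. -/
def IsParamSeq {d : ℕ} (A B : Module.End F V) (D : LRDecomp F V d) (φ : ℕ → F) : Prop :=
  φ 0 = 0 ∧ φ (d + 1) = 0 ∧ ∀ i, 1 ≤ i → i ≤ d → ∀ v ∈ D.sub i, B (A v) = φ i • v



/-- Coordinates adapted to an LR pair `(A, B)`: a spanning vector `v i` of each `D.sub i`
normalized by `A (v (i + 1)) = v i`, the dual functionals `f i`, and the scalars `φ i` with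
`B (v i) = φ i • v (i + 1)`. Everything is extended by zero beyond index `d`. -/
structure LRCoords (A B : Module.End F V) {d : ℕ} (D : LRDecomp F V d) where
  v : ℕ → V
  f : ℕ → V →ₗ[F] F
  φ : ℕ → F
  sub_eq : ∀ i, D.sub i = Submodule.span F {v i}
  v_gt : ∀ i, d < i → v i = 0
  f_gt : ∀ i, d < i → f i = 0
  f_self : ∀ i ≤ d, f i (v i) = 1
  f_ne : ∀ i j, i ≠ j → f i (v j) = 0
  ext : ∀ u w, (∀ i, f i u = f i w) → u = w
  f_lower : ∀ i u, f i (A u) = f (i + 1) u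
  f_raise_zero : ∀ u, f 0 (B u) = 0
  f_raise : ∀ i u, f (i + 1) (B u) = φ i * f i u
  φ_ne : ∀ i < d, φ i ≠ 0

theorem LRDecomp.sub_ne_bot {d : ℕ} (D : LRDecomp F V d) {i : ℕ} (hi : i ≤ d) :
    D.sub i ≠ ⊥ := by
  intro h
  have := D.finrank_eq_one i hi
  rw [h, finrank_bot] at this
  exact zero_ne_one this

theorem LRDecomp.exists_lowered_vectors {d : ℕ} {A : Module.End F V} {D : LRDecomp F V d}
    (h : Lowers A D) :
    ∃ v : ℕ → V, (∀ i, D.sub i = Submodule.span F {v i}) ∧ (∀ i, d < i → v i = 0) ∧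
      A (v 0) = 0 ∧ ∀ i < d, A (v (i + 1)) = v i := by
  obtain ⟨x, hx⟩ : ∃ x : V, D.sub d = Submodule.span F {x} := by
    obtain ⟨x, -, hx⟩ := finrank_eq_one_iff'.1 (D.finrank_eq_one d le_rfl)
    refine ⟨x, le_antisymm (fun y hy => ?_) ?_⟩
    · obtain ⟨c, hc⟩ := hx ⟨y, hy⟩
      exact Submodule.mem_span_singleton.2 ⟨c, congrArg Subtype.val hc⟩
    · exact (Submodule.span_singleton_le_iff_mem _ _).2 x.2
  have key : ∀ k ≤ d, D.sub (d - k) = Submodule.span F {(A ^ k) x} := by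
    intro k
    induction k with
    | zero => intro _; simpa using hx
    | succ k ih =>
      intro hk
      have h1 := h.2 (d - (k + 1)) (by omega)
      rw [show d - (k + 1) + 1 = d - k by omega, ih (by omega), Submodule.map_span,
        Set.image_singleton] at h1
      rw [← h1, pow_succ', Module.End.mul_apply]
  refine ⟨fun i => if i ≤ d then (A ^ (d - i)) x else 0, fun i => ?_, fun i hi => ?_, ?_,
    fun i hi => ?_⟩
  · by_cases hi : i ≤ d
    · simp only [hi, if_true]
      rw [← key (d - i) (by omega), show d - (d - i) = i by omega]
    · simp [hi, D.eq_bot_of_gt i (by omega)]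
  · simp [not_le.2 hi]
  · have h0 := h.1
    have h1 := key d le_rfl
    rw [Nat.sub_self] at h1
    rw [h1, Submodule.map_span, Set.image_singleton, Submodule.span_singleton_eq_bot] at h0
    simpa using h0
  · simp only [show i + 1 ≤ d from hi, show i ≤ d by omega, if_true]
    rw [← Module.End.mul_apply, ← pow_succ', show d - (i + 1) + 1 = d - i by omega]

theorem LRCoords.nonempty [FiniteDimensional F V] {d : ℕ} (hdim : Module.finrank F V = d + 1)
    {A B : Module.End F V} {D : LRDecomp F V d} (h : IsLRPairWith A B D) :
    Nonempty (LRCoords A B D) := by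
  obtain ⟨v, hv, hvgt, hA0, hA⟩ := LRDecomp.exists_lowered_vectors h.1
  have hne : ∀ i ≤ d, v i ≠ 0 := by
    intro i hi h0
    exact D.sub_ne_bot hi (by rw [hv, h0]; simp)
  have hB : ∀ i, ∃ c : F, (i ≤ d → B (v i) = c • v (i + 1)) ∧ (i < d → c ≠ 0) ∧
      (d ≤ i → c = 0) := by
    intro i
    by_cases hi : i < d
    · have h1 := h.2 i hi.le
      rw [hv, hv, Submodule.map_span, Set.image_singleton] at h1
      have h2 : B (v i) ∈ Submodule.span F {v (i + 1)} :=
        h1 ▸ Submodule.mem_span_singleton_self _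
      obtain ⟨c, hc⟩ := Submodule.mem_span_singleton.1 h2
      refine ⟨c, fun _ => hc.symm, fun _ h0 => ?_, fun _ => by omega⟩
      rw [← hc, h0, zero_smul] at h1
      refine hne (i + 1) hi (Submodule.span_singleton_eq_bot.1 (h1.symm.trans ?_))
      simp
    · refine ⟨0, fun hi' => ?_, fun _ => by omega, fun _ => rfl⟩
      have h1 := h.2 i hi'
      rw [D.eq_bot_of_gt (i + 1) (by omega), hv, Submodule.map_span, Set.image_singleton,
        Submodule.span_singleton_eq_bot] at h1
      rw [h1, zero_smul]
  choose φ hφ hφne hφd using hB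
  have hli : LinearIndependent F fun i : Fin (d + 1) => v i :=
    D.isInternal.submodule_iSupIndep.linearIndependent _
      (fun i => by rw [hv]; exact Submodule.mem_span_singleton_self _)
      (fun i => hne i (Nat.lt_succ_iff.1 i.2))
  let b : Module.Basis (Fin (d + 1)) F V :=
    basisOfLinearIndependentOfCardEqFinrank hli (by simp [hdim])
  have hb : ∀ i : Fin (d + 1), b i = v i := fun i => by
    simp [b]
  let f : ℕ → V →ₗ[F] F := fun i => if hi : i < d + 1 then b.coord ⟨i, hi⟩ else 0
  have hfgt : ∀ i, d < i → f i = 0 := fun i hi => by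
    simp only [f]; rw [dif_neg (by omega)]
  have hfself : ∀ i ≤ d, f i (v i) = 1 := fun i hi => by
    simp only [f]
    rw [dif_pos (by omega), ← hb ⟨i, by omega⟩]
    simp
  have hfne : ∀ i j, i ≠ j → f i (v j) = 0 := fun i j hij => by
    by_cases hj : j ≤ d
    · by_cases hi : i ≤ d
      · simp only [f]
        rw [dif_pos (by omega), ← hb ⟨j, by omega⟩]
        simp [hij.symm]
      · rw [hfgt i (by omega)]; rfl
    · rw [hvgt j (by omega), map_zero]
  have hext : ∀ X Y : V →ₗ[F] F, (∀ j ≤ d, X (v j) = Y (v j)) → X = Y := fun X Y hXY =>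
    b.ext fun j => by rw [hb]; exact hXY j (Nat.lt_succ_iff.1 j.2)
  refine ⟨⟨v, f, φ, hv, hvgt, hfgt, hfself, hfne, fun u w huw => ?_, fun i u => ?_, fun u => ?_,
    fun i u => ?_, hφne⟩⟩
  · refine b.ext_elem fun i => ?_
    have := huw i
    simp only [f] at this
    rw [dif_pos i.2] at this
    simpa using this
  · refine LinearMap.congr_fun (hext (f i ∘ₗ A) (f (i + 1)) fun j hj => ?_) u
    rw [LinearMap.comp_apply]
    rcases j with _ | j
    · rw [hA0, map_zero, hfne _ _ (by omega)]
    · rw [hA j (by omega)]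
      by_cases hij : i = j
      · rw [hij, hfself _ (by omega), hfself _ (by omega)]
      · rw [hfne _ _ hij, hfne _ _ (by omega)]
  · refine LinearMap.congr_fun (hext (f 0 ∘ₗ B) 0 fun j hj => ?_) u
    rw [LinearMap.comp_apply, hφ j hj, map_smul, hfne _ _ (by omega), smul_zero]; rfl
  · refine LinearMap.congr_fun (hext (f (i + 1) ∘ₗ B) (φ i • f i) fun j hj => ?_) u
    rw [LinearMap.comp_apply, hφ j hj, map_smul, LinearMap.smul_apply, smul_eq_mul, smul_eq_mul]
    by_cases hij : i = j
    · subst hij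
      rw [hfself i hj]
      by_cases hi : i < d
      · rw [hfself _ (by omega)]
      · rw [hφd i (by omega)]; simp
    · rw [hfne _ _ hij, hfne _ _ (by omega)]; simp

namespace LRCoords

variable {d : ℕ} {A B C : Module.End F V} {D D' : LRDecomp F V d}

theorem v_ne_zero (c : LRCoords A B D) {i : ℕ} (hi : i ≤ d) : c.v i ≠ 0 := fun h => by
  simpa [h] using c.f_self i hi

theorem sum_eq (c : LRCoords A B D) (u : V) :
    ∑ j ∈ Finset.range (d + 1), c.f j u • c.v j = u := by
  refine c.ext _ _ fun i => ?_
  rw [map_sum]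
  by_cases hi : i ≤ d
  · rw [Finset.sum_eq_single i]
    · simp [c.f_self i hi]
    · intro j _ hj
      simp [c.f_ne i j hj.symm]
    · intro h
      simp at h; omega
  · simp [c.f_gt i (by omega)]

theorem hom_ext (c : LRCoords A B D) {X Y : Module.End F V}
    (h : ∀ j ≤ d, X (c.v j) = Y (c.v j)) : X = Y := by
  ext u
  rw [← c.sum_eq u, map_sum, map_sum]
  refine Finset.sum_congr rfl fun j hj => ?_
  rw [map_smul, map_smul, h j (by simp at hj; omega)]

theorem lower_zero (c : LRCoords A B D) : A (c.v 0) = 0 :=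
  c.ext _ _ fun i => by rw [c.f_lower, c.f_ne _ _ (by omega), map_zero]

theorem lower_succ (c : LRCoords A B D) {i : ℕ} (hi : i < d) : A (c.v (i + 1)) = c.v i :=
  c.ext _ _ fun k => by
    rw [c.f_lower]
    by_cases hk : k = i
    · rw [hk, c.f_self _ (by omega), c.f_self _ (by omega)]
    · rw [c.f_ne _ _ hk, c.f_ne _ _ (by omega)]

theorem raise (c : LRCoords A B D) (i : ℕ) : B (c.v i) = c.φ i • c.v (i + 1) :=
  c.ext _ _ fun k => by
    rw [map_smul, smul_eq_mul]
    rcases k with _ | k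
    · rw [c.f_raise_zero, c.f_ne _ _ (by omega), mul_zero]
    · rw [c.f_raise]
      by_cases hk : k = i
      · subst hk
        by_cases hd : k < d
        · rw [c.f_self _ (by omega), c.f_self _ (by omega)]
        · have h1 := c.f_raise k (c.v k)
          rw [c.f_gt (k + 1) (by omega)] at h1 ⊢
          rw [← h1]; simp
      · rw [c.f_ne _ _ hk, c.f_ne _ _ (by omega), mul_zero, mul_zero]

theorem raise_last (c : LRCoords A B D) : B (c.v d) = 0 := by
  rw [c.raise, c.v_gt _ (by omega), smul_zero]

theorem f_lower_pow (c : LRCoords A B D) (i j : ℕ) (u : V) :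
    c.f j ((A ^ i) u) = c.f (j + i) u := by
  induction i generalizing u with
  | zero => simp
  | succ i ih => rw [pow_succ, Module.End.mul_apply, ih, c.f_lower, Nat.add_assoc]

theorem lower_pow_eq_zero_iff (c : LRCoords A B D) (i : ℕ) (u : V) :
    (A ^ i) u = 0 ↔ ∀ j, i ≤ j → c.f j u = 0 := by
  constructor
  · intro h j hj
    have := c.f_lower_pow i (j - i) u
    rwa [h, map_zero, Nat.sub_add_cancel hj, eq_comm] at this
  · intro h
    refine c.ext _ _ fun j => ?_
    rw [c.f_lower_pow, map_zero, h _ (by omega)]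

theorem raise_pow_eq_zero_iff (c : LRCoords A B D) (i : ℕ) (u : V) :
    (B ^ i) u = 0 ↔ ∀ j, j + i ≤ d → c.f j u = 0 := by
  induction i generalizing u with
  | zero =>
    refine ⟨fun h j _ => ?_, fun h => c.ext _ _ fun j => ?_⟩
    · rw [show u = 0 by simpa using h, map_zero]
    · rw [pow_zero, Module.End.one_apply, map_zero]
      by_cases hj : j ≤ d
      · exact h j hj
      · rw [c.f_gt j (by omega)]; rfl
  | succ i ih =>
    rw [pow_succ, Module.End.mul_apply, ih]
    refine ⟨fun h j hj => ?_, fun h j hj => ?_⟩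
    · have := h (j + 1) (by omega)
      rw [c.f_raise] at this
      exact (mul_eq_zero.1 this).resolve_left (c.φ_ne j (by omega))
    · rcases j with _ | j
      · exact c.f_raise_zero u
      · rw [c.f_raise, h j (by omega), mul_zero]

/-- The flag of kernels of powers of `A`, seen in the coordinates of an LR pair lowered by `A`
and of an LR pair raised by `A`. -/
theorem flag_iff (c : LRCoords A B D) (c' : LRCoords C A D') (i : ℕ) (u : V) :
    (∀ j, i ≤ j → c.f j u = 0) ↔ ∀ j, j + i ≤ d → c'.f j u = 0 := by
  rw [← c.lower_pow_eq_zero_iff, c'.raise_pow_eq_zero_iff]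

end LRCoords

namespace LRCoords

variable {d : ℕ} {A B C J X : Module.End F V} {D D₁ D₂ D₃ : LRDecomp F V d}

/-- The matrix of `X` in the basis `c.v` is tridiagonal. -/
def Tri (c : LRCoords A B D) (X : Module.End F V) : Prop :=
  ∀ k j, k + 2 ≤ j ∨ j + 2 ≤ k → c.f k (X (c.v j)) = 0

/-- The matrix of `X` in the basis `c.v` is tridiagonal with zero diagonal. -/
def OddTri (c : LRCoords A B D) (X : Module.End F V) : Prop :=
  ∀ k j, k + 1 ≠ j → j + 1 ≠ k → c.f k (X (c.v j)) = 0

/-- `J` is the projection onto the span of the even-indexed basis vectors along the span of the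
odd-indexed ones. -/
def IsEvenProj (c : LRCoords A B D) (J : Module.End F V) : Prop :=
  ∀ i, J (c.v i) = if Even i then c.v i else 0

theorem OddTri.tri {c : LRCoords A B D} (h : c.OddTri X) : c.Tri X :=
  fun k j hkj => h k j (by omega) (by omega)

theorem isTridiagonal_iff (c : LRCoords A B D) : IsTridiagonal X D ↔ c.Tri X := by
  constructor
  · intro h k j hkj
    have h1 := h j (c.v j) (by rw [c.sub_eq]; exact Submodule.mem_span_singleton_self _)
    have h2 : D.sub (j - 1) ⊔ D.sub j ⊔ D.sub (j + 1) ≤ LinearMap.ker (c.f k) := by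
      simp only [c.sub_eq, sup_le_iff, Submodule.span_singleton_le_iff_mem, LinearMap.mem_ker]
      exact ⟨⟨c.f_ne _ _ (by omega), c.f_ne _ _ (by omega)⟩, c.f_ne _ _ (by omega)⟩
    exact h2 h1
  · intro h i u hu
    rw [c.sub_eq] at hu
    obtain ⟨t, rfl⟩ := Submodule.mem_span_singleton.1 hu
    rw [map_smul]
    refine Submodule.smul_mem _ _ ?_
    rw [← c.sum_eq (X (c.v i))]
    refine Submodule.sum_mem _ fun k _ => ?_
    have hk : c.v k ∈ D.sub k := by
      rw [c.sub_eq]; exact Submodule.mem_span_singleton_self _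
    by_cases hki : k + 2 ≤ i ∨ i + 2 ≤ k
    · rw [h k i hki, zero_smul]; exact Submodule.zero_mem _
    · refine Submodule.smul_mem _ _ ?_
      obtain h1 | h1 | h1 : k = i - 1 ∨ k = i ∨ k = i + 1 := by omega
      · exact Submodule.mem_sup_left (Submodule.mem_sup_left (h1 ▸ hk))
      · exact Submodule.mem_sup_left (Submodule.mem_sup_right (h1 ▸ hk))
      · exact Submodule.mem_sup_right (h1 ▸ hk)

theorem f_apply (c : LRCoords A B D) (X : Module.End F V) (k : ℕ) (u : V) (s : Finset ℕ)
    (hs : ∀ j ∉ s, c.f k (X (c.v j)) = 0) :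
    c.f k (X u) = ∑ j ∈ s, c.f j u * c.f k (X (c.v j)) := by
  conv_lhs => rw [← c.sum_eq u]
  simp only [map_sum, map_smul, smul_eq_mul]
  refine (Finset.sum_subset (Finset.subset_union_left (s₂ := s)) fun j _ hj => ?_).trans
    (Finset.sum_subset Finset.subset_union_right fun j _ hj => ?_).symm
  · rw [c.f_gt j (by simpa using hj), LinearMap.zero_apply, zero_mul]
  · rw [hs j hj, mul_zero]

theorem Tri.f_zero {c : LRCoords A B D} (h : c.Tri X) (u : V) :
    c.f 0 (X u) = c.f 0 u * c.f 0 (X (c.v 0)) + c.f 1 u * c.f 0 (X (c.v 1)) := by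
  rw [c.f_apply X 0 u {0, 1} fun j hj => h _ _ (by simp at hj; omega),
    Finset.sum_pair (by omega)]

theorem Tri.f_succ {c : LRCoords A B D} (h : c.Tri X) (k : ℕ) (u : V) :
    c.f (k + 1) (X u) = c.f k u * c.f (k + 1) (X (c.v k)) +
      c.f (k + 1) u * c.f (k + 1) (X (c.v (k + 1))) +
      c.f (k + 2) u * c.f (k + 1) (X (c.v (k + 2))) := by
  rw [c.f_apply X (k + 1) u {k, k + 1, k + 2} fun j hj => h _ _ (by simp at hj; omega),
    Finset.sum_insert (by simp), Finset.sum_pair (by omega), add_assoc]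

theorem OddTri.f_succ {c : LRCoords A B D} (h : c.OddTri X) (k : ℕ) (u : V) :
    c.f (k + 1) (X u) = c.f k u * c.f (k + 1) (X (c.v k)) +
      c.f (k + 2) u * c.f (k + 1) (X (c.v (k + 2))) := by
  rw [h.tri.f_succ, h (k + 1) (k + 1) (by omega) (by omega), mul_zero, add_zero]

theorem tri_third (c₁ : LRCoords A B D₁) (c₂ : LRCoords B C D₂) (c₃ : LRCoords C A D₃) : c₁.Tri C := by
  intro k j hkj
  obtain hkj | hkj := hkj
  · by_cases hjd : j ≤ d
    · have h1 : ∀ i, d - j + 1 ≤ i → c₂.f i (c₁.v j) = 0 :=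
        (c₂.flag_iff c₁ _ _).2 fun i hi => c₁.f_ne _ _ (by omega)
      refine (c₂.flag_iff c₁ (d - j + 2) _).1 (fun i hi => ?_) k (by omega)
      obtain ⟨i, rfl⟩ : ∃ i', i = i' + 1 := ⟨i - 1, by omega⟩
      rw [c₂.f_raise, h1 i (by omega), mul_zero]
    · rw [c₁.v_gt j (by omega), map_zero, map_zero]
  · have h1 : ∀ i, i + (j + 1) ≤ d → c₃.f i (c₁.v j) = 0 :=
      (c₁.flag_iff c₃ _ _).1 fun i hi => c₁.f_ne _ _ (by omega)
    refine (c₁.flag_iff c₃ (j + 2) _).2 (fun i hi => ?_) k (by omega)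
    rw [c₃.f_lower, h1 _ (by omega)]

theorem third_up_ne (c₁ : LRCoords A B D₁) (c₂ : LRCoords B C D₂) (c₃ : LRCoords C A D₃) {i : ℕ} (hi : i < d) :
    c₁.f (i + 1) (C (c₁.v i)) ≠ 0 := by
  intro h0
  have h1 : ∀ j, j + (i + 1) ≤ d → c₃.f j (C (c₁.v i)) = 0 :=
    (c₁.flag_iff c₃ _ _).1 fun j hj => by
      obtain rfl | hj : j = i + 1 ∨ i + 2 ≤ j := by omega
      · exact h0
      · exact tri_third c₁ c₂ c₃ _ _ (Or.inr hj)
  have h2 : ∀ j, j + (i + 1) ≤ d → c₃.f j (c₁.v i) = 0 :=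
    (c₁.flag_iff c₃ _ _).1 fun j hj => c₁.f_ne _ _ (by omega)
  have h3 := (c₁.flag_iff c₃ i (c₁.v i)).2 (fun j hj => by
    rcases j with _ | j
    · exact h2 0 (by omega)
    · rw [← c₃.f_lower]
      exact h1 j (by omega)) i le_rfl
  rw [c₁.f_self i hi.le] at h3
  exact one_ne_zero h3

theorem third_down_ne (c₁ : LRCoords A B D₁) (c₂ : LRCoords B C D₂) (c₃ : LRCoords C A D₃) {i : ℕ} (hi : i < d) :
    c₁.f i (C (c₁.v (i + 1))) ≠ 0 := by
  intro h0
  have h1 : ∀ j, d - i ≤ j → c₂.f j (C (c₁.v (i + 1))) = 0 :=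
    (c₂.flag_iff c₁ _ _).2 fun j hj => by
      obtain rfl | hj : j = i ∨ j + 2 ≤ i + 1 := by omega
      · exact h0
      · exact tri_third c₁ c₂ c₃ _ _ (Or.inl hj)
  have h2 : ∀ j, d - i ≤ j → c₂.f j (c₁.v (i + 1)) = 0 :=
    (c₂.flag_iff c₁ _ _).2 fun j hj => c₁.f_ne _ _ (by omega)
  have h3 := (c₂.flag_iff c₁ (d - i - 1) (c₁.v (i + 1))).1 (fun j hj => by
    obtain rfl | hj : j = d - i - 1 ∨ d - i ≤ j := by omega
    · have h4 := h1 (d - i - 1 + 1) (by omega)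
      rw [c₂.f_raise] at h4
      exact (mul_eq_zero.1 h4).resolve_left (c₂.φ_ne _ (by omega))
    · exact h2 j hj) (i + 1) (by omega)
  rw [c₁.f_self _ (by omega)] at h3
  exact one_ne_zero h3

theorem idem_apply (c : LRCoords A B D) {E : ℕ → Module.End F V} (hE : IsIdemSeq D E) (i j : ℕ) :
    E i (c.v j) = if j = i then c.v j else 0 := by
  have hj : c.v j ∈ D.sub j := by rw [c.sub_eq]; exact Submodule.mem_span_singleton_self _
  split_ifs with h
  · subst h; exact (hE j).1 _ hj
  · exact (hE i).2 j h _ hj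

theorem trace_mul_idem [FiniteDimensional F V] (c : LRCoords A B D) {E : ℕ → Module.End F V}
    (hE : IsIdemSeq D E) {i : ℕ} (hi : i ≤ d) :
    LinearMap.trace F V (X * E i) = c.f i (X (c.v i)) := by
  have : X * E i = (c.f i).smulRight (X (c.v i)) := c.hom_ext fun j _ => by
    rw [Module.End.mul_apply, c.idem_apply hE, LinearMap.smulRight_apply]
    split_ifs with h
    · subst h; rw [c.f_self j hi, one_smul]
    · rw [c.f_ne _ _ (Ne.symm h), map_zero, zero_smul]
  rw [this, LinearMap.trace_smulRight]

theorem Tri.oddTri {c : LRCoords A B D} (h : c.Tri X) (h0 : ∀ i ≤ d, c.f i (X (c.v i)) = 0) :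
    c.OddTri X := fun k j h1 h2 => by
  by_cases hkj : k = j
  · subst hkj
    by_cases hk : k ≤ d
    · exact h0 k hk
    · rw [c.f_gt k (by omega), LinearMap.zero_apply]
  · exact h k j (by omega)

theorem isEvenProj_sum (c : LRCoords A B D) {E : ℕ → Module.End F V} (hE : IsIdemSeq D E) :
    c.IsEvenProj (∑ j ∈ Finset.range (d / 2 + 1), E (2 * j)) := fun i => by
  rw [LinearMap.sum_apply]
  simp only [c.idem_apply hE]
  by_cases hid : i ≤ d
  · split_ifs with h
    · obtain ⟨m, hm⟩ := h
      rw [Finset.sum_eq_single m]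
      · rw [if_pos (by omega)]
      · intro j _ hj
        rw [if_neg (by omega)]
      · intro hm'
        simp at hm'
        omega
    · refine Finset.sum_eq_zero fun j _ => if_neg fun hij => h ⟨j, by omega⟩
  · simp [c.v_gt i (by omega)]

theorem IsEvenProj.f_apply {c : LRCoords A B D} (h : c.IsEvenProj J) (i : ℕ) (u : V) :
    c.f i (J u) = if Even i then c.f i u else 0 := by
  rw [c.f_apply J i u {i} fun j hj => ?_, Finset.sum_singleton, h]
  · by_cases hid : i ≤ d
    · split_ifs <;> simp [c.f_self i hid]
    · simp [c.f_gt i (by omega)]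
  · rw [h]
    split_ifs
    · exact c.f_ne _ _ (by simpa [eq_comm] using hj)
    · exact map_zero _

theorem IsEvenProj.comm {c : LRCoords A B D} (h : c.IsEvenProj J) (hX : c.OddTri X) (u : V) :
    J (X u) = X u - X (J u) := by
  have : J * X = X - X * J := c.hom_ext fun j _ => c.ext _ _ fun k => by
    rw [LinearMap.sub_apply, Module.End.mul_apply, Module.End.mul_apply, map_sub, h.f_apply, h]
    by_cases hkj : k + 1 = j ∨ j + 1 = k
    · have : Even k ↔ ¬ Even j := by
        rcases hkj with rfl | rfl <;> simp [Nat.even_add_one]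
      by_cases hj : Even j <;> simp [this, hj]
    · have := hX k j (by omega) (by omega)
      split_ifs <;> simp [this]
  exact LinearMap.congr_fun this u

theorem oddTri_lower (c : LRCoords A B D) : c.OddTri A := fun k j h1 _ => by
  rw [c.f_lower, c.f_ne _ _ h1]

theorem oddTri_raise (c : LRCoords A B D) : c.OddTri B := fun k j _ h2 => by
  rw [c.raise, map_smul, c.f_ne _ _ (Ne.symm h2), smul_zero]

theorem IsEvenProj.transfer_third {c₁ : LRCoords A B D₁} (c₃ : LRCoords C A D₃)
    (h : c₁.IsEvenProj J) (hC : c₁.OddTri C) {i j : ℕ} (hij : i + j = d) :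
    J (c₃.v i) = if Even j then c₃.v i else 0 := by
  induction j generalizing i with
  | zero =>
    obtain rfl : i = d := by omega
    refine c₁.ext _ _ fun k => ?_
    rw [h.f_apply]
    rcases k with _ | k
    · simp
    · rw [← c₁.f_lower, c₃.raise_last, map_zero]
      simp [← c₁.f_lower, c₃.raise_last]
  | succ j ih =>
    rw [← c₃.lower_succ (show i < d by omega), h.comm hC, ih (by omega)]
    by_cases hj : Even j <;> simp [hj, Nat.even_add_one]

theorem IsEvenProj.transfer_second {c₁ : LRCoords A B D₁} (c₂ : LRCoords B C D₂)
    (h : c₁.IsEvenProj J) (hC : c₁.OddTri C) {i : ℕ} (hi : i ≤ d) :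
    J (c₂.v i) = if Even (d + i) then c₂.v i else 0 := by
  induction i with
  | zero =>
    refine c₁.ext _ _ fun k => ?_
    rw [h.f_apply]
    by_cases hk : k < d
    · have h1 := c₁.f_raise k (c₂.v 0)
      rw [c₂.lower_zero, map_zero, eq_comm, mul_eq_zero] at h1
      have h2 := h1.resolve_left (c₁.φ_ne k hk)
      split_ifs <;> simp [h2]
    · obtain rfl | hk : k = d ∨ d < k := by omega
      · simp only [add_zero]
        split_ifs <;> simp
      · simp [c₁.f_gt k hk]
  | succ i ih =>
    have h1 : c₂.v (i + 1) = (c₂.φ i)⁻¹ • C (c₂.v i) := by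
      rw [c₂.raise, smul_smul, inv_mul_cancel₀ (c₂.φ_ne i (by omega)), one_smul]
    rw [h1, map_smul, h.comm hC, ih (by omega)]
    by_cases hj : Even (d + i) <;> simp [hj, ← add_assoc, Nat.even_add_one]

theorem even_diameter (c₁ : LRCoords A B D₁) (c₂ : LRCoords B C D₂) (c₃ : LRCoords C A D₃)
    (h : c₁.IsEvenProj J) (hC : c₁.OddTri C) : Even d := by
  by_contra hd
  have h1 : c₂.v d = c₃.f 0 (c₂.v d) • c₃.v 0 := c₃.ext _ _ fun k => by
    rcases k with _ | k
    · simp [c₃.f_self 0 (by omega)]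
    · rw [← c₃.f_lower, c₂.raise_last, map_smul, c₃.f_ne _ _ (by omega), map_zero, smul_zero]
  have h2 := h.transfer_second c₂ hC le_rfl
  rw [if_pos ⟨d, rfl⟩] at h2
  have h3 := h.transfer_third c₃ hC (zero_add d)
  rw [if_neg hd] at h3
  rw [h1, map_smul, h3, smul_zero, ← h1] at h2
  exact c₂.v_ne_zero le_rfl h2.symm

end LRCoords

namespace LRCoords

variable {d : ℕ} {A B J X : Module.End F V} {D : LRDecomp F V d}

theorem tri_one (c : LRCoords A B D) : c.Tri 1 := fun k j hkj => c.f_ne k j (by omega)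

theorem Tri.mul_evenProj {c : LRCoords A B D} (hX : c.Tri X) (hJ : c.IsEvenProj J) :
    c.Tri (X * J) := fun k j hkj => by
  rw [Module.End.mul_apply, hJ]
  split_ifs
  · exact hX k j hkj
  · simp

theorem lower_eq (c : LRCoords A B D) (j : ℕ) : A (c.v j) = 0 ∨ ∃ i, j = i + 1 ∧ i < d ∧
    A (c.v j) = c.v i := by
  rcases j with _ | j
  · exact Or.inl c.lower_zero
  · by_cases hj : j < d
    · exact Or.inr ⟨j, rfl, hj, c.lower_succ hj⟩
    · exact Or.inl (by rw [c.v_gt _ (by omega), map_zero])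

theorem oddTri_lower_mul_raise {c : LRCoords A B D} (hX : c.OddTri X) :
    c.OddTri (A * X * B) := fun k j h1 h2 => by
  rw [Module.End.mul_apply, Module.End.mul_apply, c.f_lower, c.raise, map_smul, map_smul,
    hX (k + 1) (j + 1) (by omega) (by omega), smul_zero]

theorem oddTri_lower_raise_mul {c : LRCoords A B D} (hX : c.OddTri X) :
    c.OddTri (A * B * X) := fun k j h1 h2 => by
  rw [Module.End.mul_apply, Module.End.mul_apply, c.f_lower, c.f_raise, hX k j h1 h2, mul_zero]

theorem oddTri_mul_lower_raise {c : LRCoords A B D} (hX : c.OddTri X) :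
    c.OddTri (X * A * B) := fun k j h1 h2 => by
  rw [Module.End.mul_apply, Module.End.mul_apply, c.raise, map_smul, map_smul, map_smul]
  by_cases hj : j < d
  · rw [c.lower_succ hj, hX k j h1 h2, smul_zero]
  · rw [c.v_gt (j + 1) (by omega), map_zero, map_zero, map_zero, smul_zero]

theorem oddTri_mul_raise_lower {c : LRCoords A B D} (hX : c.OddTri X) :
    c.OddTri (X * B * A) := fun k j h1 h2 => by
  rw [Module.End.mul_apply, Module.End.mul_apply]
  obtain h0 | ⟨i, rfl, -, h0⟩ := c.lower_eq j
  · rw [h0, map_zero, map_zero, map_zero]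
  · rw [h0, c.raise, map_smul, map_smul, hX k (i + 1) h1 h2, smul_zero]

theorem oddTri_raise_lower_mul {c : LRCoords A B D} (hX : c.OddTri X) :
    c.OddTri (B * A * X) := fun k j h1 h2 => by
  rw [Module.End.mul_apply, Module.End.mul_apply]
  rcases k with _ | k
  · exact c.f_raise_zero _
  · rw [c.f_raise, c.f_lower, hX (k + 1) j h1 h2, mul_zero]

theorem oddTri_raise_mul_lower {c : LRCoords A B D} (hX : c.OddTri X) :
    c.OddTri (B * X * A) := fun k j h1 h2 => by
  rw [Module.End.mul_apply, Module.End.mul_apply]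
  obtain h0 | ⟨i, rfl, -, h0⟩ := c.lower_eq j
  · rw [h0, map_zero, map_zero, map_zero]
  · rw [h0]
    rcases k with _ | k
    · exact c.f_raise_zero _
    · rw [c.f_raise, hX k i (by omega) (by omega), mul_zero]

end LRCoords

/-- Coordinates for the three LR pairs of a bipartite LR triple `(A, B, C)`, together with the
common projection `J` onto the even part. -/
structure BipartiteCoords (A B C J : Module.End F V) {d : ℕ} (D₁ D₂ D₃ : LRDecomp F V d) where
  c₁ : LRCoords A B D₁
  c₂ : LRCoords B C D₂
  c₃ : LRCoords C A D₃
  odd₁ : c₁.OddTri C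
  odd₂ : c₂.OddTri A
  odd₃ : c₃.OddTri B
  even₁ : c₁.IsEvenProj J
  even₃ : c₃.IsEvenProj J
  even_d : Even d

theorem span_range_eq_of_injOn {M : Type*} [AddCommGroup M] [Module F M] [FiniteDimensional F M]
    {n : ℕ} {S : Submodule F M} {b : Fin n → M} (hb : LinearIndependent F b)
    (hbS : ∀ i, b i ∈ S) (Φ : M →ₗ[F] Fin n → F) (hΦ : ∀ x ∈ S, Φ x = 0 → x = 0) :
    Submodule.span F (Set.range b) = S := by
  refine Submodule.eq_of_le_of_finrank_le (Submodule.span_le.2 ?_) ?_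
  · rintro _ ⟨i, rfl⟩
    exact hbS i
  · have hinj : Function.Injective (Φ.domRestrict S) := by
      rw [← LinearMap.ker_eq_bot, LinearMap.ker_eq_bot']
      exact fun x hx => Subtype.ext (hΦ x x.2 hx)
    have := LinearMap.finrank_le_finrank_of_injective hinj
    rwa [finrank_span_eq_card hb, Fintype.card_fin, ← Module.finrank_fin_fun F (n := n)]

theorem eq_zero_of_det_ne_zero {a b c e x y : F} (hdet : a * e - b * c ≠ 0)
    (h1 : a * x + b * y = 0) (h2 : c * x + e * y = 0) : x = 0 ∧ y = 0 :=
  ⟨(mul_eq_zero.1 (show (a * e - b * c) * x = 0 by linear_combination e * h1 - b * h2)).resolve_left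
    hdet,
  (mul_eq_zero.1 (show (a * e - b * c) * y = 0 by linear_combination a * h2 - c * h1)).resolve_left
    hdet⟩

namespace BipartiteCoords

variable {d : ℕ} {A B C J X : Module.End F V} {D₁ D₂ D₃ : LRDecomp F V d}

theorem nonempty [FiniteDimensional F V] (hdim : Module.finrank F V = d + 1)
    (h₁ : IsLRPairWith A B D₁) (h₂ : IsLRPairWith B C D₂) (h₃ : IsLRPairWith C A D₃)
    {E E' E'' : ℕ → Module.End F V} (hE : IsIdemSeq D₁ E) (hE' : IsIdemSeq D₂ E')
    (hE'' : IsIdemSeq D₃ E'') (hbip : IsBipartite d A B C E E' E'')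
    (hJ : J = ∑ j ∈ Finset.range (d / 2 + 1), E (2 * j)) :
    Nonempty (BipartiteCoords A B C J D₁ D₂ D₃) := by
  obtain ⟨c₁⟩ := LRCoords.nonempty hdim h₁
  obtain ⟨c₂⟩ := LRCoords.nonempty hdim h₂
  obtain ⟨c₃⟩ := LRCoords.nonempty hdim h₃
  have odd₁ := (c₁.tri_third c₂ c₃).oddTri fun i hi => by
    rw [← c₁.trace_mul_idem hE hi]; exact (hbip i hi).1
  have odd₂ := (c₂.tri_third c₃ c₁).oddTri fun i hi => by
    rw [← c₂.trace_mul_idem hE' hi]; exact (hbip i hi).2.1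
  have odd₃ := (c₃.tri_third c₁ c₂).oddTri fun i hi => by
    rw [← c₃.trace_mul_idem hE'' hi]; exact (hbip i hi).2.2
  have even₁ : c₁.IsEvenProj J := hJ ▸ c₁.isEvenProj_sum hE
  have even_d := c₁.even_diameter c₂ c₃ even₁ odd₁
  refine ⟨⟨c₁, c₂, c₃, odd₁, odd₂, odd₃, even₁, fun i => ?_, even_d⟩⟩
  by_cases hi : i ≤ d
  · rw [even₁.transfer_third c₃ odd₁ (show i + (d - i) = d by omega)]
    simp [Nat.even_sub hi, even_d]
  · simp [c₃.v_gt i (by omega)]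

variable (h : BipartiteCoords A B C J D₁ D₂ D₃)
include h

theorem f_eq_zero {k i : ℕ} (hki : ¬(Even k ↔ Even i)) : h.c₁.f k (h.c₃.v i) = 0 := by
  have h1 := h.even₁.f_apply k (h.c₃.v i)
  rw [h.even₃] at h1
  by_cases hi : Even i
  · rw [if_pos hi, if_neg (by tauto)] at h1
    exact h1
  · rw [if_neg hi, if_pos (by tauto), map_zero] at h1
    exact h1.symm

theorem f_zero_ne {k : ℕ} (hk : Even k) (hkd : k ≤ d) : h.c₁.f k (h.c₃.v 0) ≠ 0 := by
  have step : ∀ k, k + 2 ≤ d → (h.c₁.f (k + 2) (h.c₃.v 0) = 0 ↔ h.c₁.f k (h.c₃.v 0) = 0) := by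
    intro k hk
    have h1 := h.odd₁.f_succ k (h.c₃.v 0)
    rw [h.c₃.lower_zero, map_zero] at h1
    have hs := h.c₁.third_up_ne h.c₂ h.c₃ (show k < d by omega)
    have hr := h.c₁.third_down_ne h.c₂ h.c₃ (show k + 1 < d by omega)
    constructor <;> intro h0 <;> rw [h0] at h1 <;> simpa [hs, hr] using h1
  have all : ∀ m, 2 * m ≤ d → (h.c₁.f (2 * m) (h.c₃.v 0) = 0 ↔ h.c₁.f 0 (h.c₃.v 0) = 0) := by
    intro m
    induction m with
    | zero => intro _; rfl
    | succ m ih => exact fun hm => (step (2 * m) hm).trans (ih (by omega))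
  intro h0
  obtain ⟨m, rfl⟩ := even_iff_exists_two_mul.1 hk
  refine h.c₃.v_ne_zero (Nat.zero_le d) (h.c₁.ext _ _ fun i => ?_)
  rw [map_zero]
  by_cases hi : Even i
  · obtain ⟨n, rfl⟩ := even_iff_exists_two_mul.1 hi
    by_cases hn : 2 * n ≤ d
    · exact (all n hn).2 ((all m hkd).1 h0)
    · rw [h.c₁.f_gt _ (by omega), LinearMap.zero_apply]
  · exact h.f_eq_zero (by simpa using hi)

theorem f_succ (k i : ℕ) :
    h.c₁.f (k + 1) (h.c₃.v i) = h.c₃.φ i * h.c₁.f k (h.c₃.v (i + 1)) := by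
  rw [← h.c₁.f_lower, h.c₃.raise, map_smul, smul_eq_mul]

theorem f_one_ne {k : ℕ} (hk : ¬ Even k) (hkd : k < d) : h.c₁.f k (h.c₃.v 1) ≠ 0 := by
  have h1 := h.f_zero_ne (Nat.even_add_one.2 hk) (Nat.succ_le_of_lt hkd)
  rw [h.f_succ] at h1
  exact right_ne_zero_of_mul h1

theorem f_zero_two_ne (hd : 2 ≤ d) : h.c₁.f 0 (h.c₃.v 2) ≠ 0 := by
  have h1 := h.f_one_ne (k := 1) (by decide) (by omega)
  rw [h.f_succ] at h1
  exact right_ne_zero_of_mul h1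

theorem det_even_ne {k : ℕ} (hk : Even k) (hkd : k + 2 ≤ d) :
    h.c₁.f k (h.c₃.v 0) * h.c₁.f (k + 2) (h.c₃.v 2) -
      h.c₁.f (k + 2) (h.c₃.v 0) * h.c₁.f k (h.c₃.v 2) ≠ 0 := by
  have h0 := h.odd₁.f_succ k (h.c₃.v 0)
  have h2 := h.odd₁.f_succ k (h.c₃.v 2)
  rw [h.c₃.lower_zero, map_zero] at h0
  rw [h.c₃.lower_succ (by omega)] at h2
  have h3 := mul_ne_zero (h.f_zero_ne hk (by omega))
    (h.f_one_ne (k := k + 1) (by simpa [Nat.even_add_one] using hk) (by omega))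
  intro hdet
  apply h3
  linear_combination h.c₁.f k (h.c₃.v 0) * h2 - h.c₁.f k (h.c₃.v 2) * h0 +
    h.c₁.f (k + 1) (C (h.c₁.v (k + 2))) * hdet

theorem det_odd_ne {k : ℕ} (hk : ¬ Even k) (hkd : k + 2 ≤ d) :
    h.c₁.f k (h.c₃.v 1) * h.c₁.f (k + 2) (h.c₃.v 3) -
      h.c₁.f (k + 2) (h.c₃.v 1) * h.c₁.f k (h.c₃.v 3) ≠ 0 := by
  have hkd' : k + 2 ≠ d := fun hd => hk (by simpa [← hd, Nat.even_add] using h.even_d)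
  have h1 := h.det_even_ne (Nat.even_add_one.2 hk) (by omega)
  rw [show k + 1 + 2 = k + 2 + 1 by omega, h.f_succ k 0, h.f_succ (k + 2) 2,
    h.f_succ (k + 2) 0, h.f_succ k 2] at h1
  intro hdet
  apply h1
  linear_combination h.c₃.φ 0 * h.c₃.φ 2 * hdet

theorem eq_zero_of_even (hX : h.c₁.Tri X) (hXJ : X * J = X) (h0 : X (h.c₃.v 0) = 0)
    (h2 : ∀ k, ¬ Even k → h.c₁.f k (X (h.c₃.v 2)) = 0) : X = 0 := by
  refine h.c₁.hom_ext fun j hj => ?_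
  rw [LinearMap.zero_apply]
  by_cases hje : Even j
  swap
  · rw [← hXJ, Module.End.mul_apply, h.even₁, if_neg hje, map_zero]
  have diag : h.c₁.f j (X (h.c₁.v j)) = 0 := by
    refine (mul_eq_zero.1 (?_ : h.c₁.f j (h.c₃.v 0) * _ = 0)).resolve_left
      (h.f_zero_ne hje hj)
    rcases j with _ | j
    · have h3 := hX.f_zero (h.c₃.v 0)
      rw [h0, map_zero, h.f_eq_zero (k := 1) (by simp), zero_mul, add_zero] at h3
      exact h3.symm
    · have hj' : ¬ Even j := Nat.even_add_one.1 hje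
      have h3 := hX.f_succ j (h.c₃.v 0)
      rw [h0, map_zero, h.f_eq_zero (k := j) (by simpa using hj'),
        h.f_eq_zero (k := j + 2) (by simpa [Nat.even_add] using hj')] at h3
      simpa using h3.symm
  have off : ∀ k, Even k → k + 2 ≤ d →
      h.c₁.f (k + 1) (X (h.c₁.v k)) = 0 ∧ h.c₁.f (k + 1) (X (h.c₁.v (k + 2))) = 0 := by
    intro k hk hkd
    have hk' : ¬ Even (k + 1) := by simpa [Nat.even_add_one] using hk
    have h3 := hX.f_succ k (h.c₃.v 0)
    have h4 := hX.f_succ k (h.c₃.v 2)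
    rw [h0, map_zero, h.f_eq_zero (k := k + 1) (by simpa using hk')] at h3
    rw [h2 _ hk', h.f_eq_zero (k := k + 1) (by simpa using hk')] at h4
    exact eq_zero_of_det_ne_zero (h.det_even_ne hk hkd) (by linear_combination -h3)
      (by linear_combination -h4)
  refine h.c₁.ext _ _ fun k => ?_
  rw [map_zero]
  by_cases hkj : k + 2 ≤ j ∨ j + 2 ≤ k
  · exact hX k j hkj
  obtain rfl | rfl | rfl : k = j ∨ k = j + 1 ∨ j = k + 1 := by omega
  · exact diag
  · by_cases hjd : j + 1 ≤ d
    · have : j + 1 ≠ d := fun hd => by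
        have := h.even_d
        rw [← hd, Nat.even_add_one] at this
        exact this hje
      exact (off j hje (by omega)).1
    · rw [h.c₁.f_gt _ (by omega), LinearMap.zero_apply]
  · rcases k with _ | k
    · simp at hje
    · exact (off k (by simpa [Nat.even_add] using hje) hj).2

theorem eq_zero_of_odd (hX : h.c₁.Tri X) (hXJ : X * J = 0) (h1 : X (h.c₃.v 1) = 0)
    (h3 : ∀ k, Even k → h.c₁.f k (X (h.c₃.v 3)) = 0) : X = 0 := by
  refine h.c₁.hom_ext fun j hj => ?_
  rw [LinearMap.zero_apply]
  by_cases hje : Even j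
  · have h5 := LinearMap.congr_fun hXJ (h.c₁.v j)
    rwa [Module.End.mul_apply, h.even₁, if_pos hje] at h5
  have hjd : j < d := lt_of_le_of_ne hj fun hjd => hje (hjd ▸ h.even_d)
  obtain ⟨i, rfl⟩ : ∃ i, j = i + 1 := by
    rcases j with _ | i
    · simp at hje
    · exact ⟨i, rfl⟩
  have hi : Even i := by simpa [Nat.even_add_one] using hje
  have off : ∀ k, ¬ Even k → k + 2 ≤ d →
      h.c₁.f (k + 1) (X (h.c₁.v k)) = 0 ∧ h.c₁.f (k + 1) (X (h.c₁.v (k + 2))) = 0 := by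
    intro k hk hkd
    have hk' : Even (k + 1) := Nat.even_add_one.2 hk
    have h5 := hX.f_succ k (h.c₃.v 1)
    have h6 := hX.f_succ k (h.c₃.v 3)
    rw [h1, map_zero, h.f_eq_zero (k := k + 1) (by simpa using hk')] at h5
    rw [h3 _ hk', h.f_eq_zero (k := k + 1) (by simp [hk']; decide)] at h6
    exact eq_zero_of_det_ne_zero (h.det_odd_ne hk hkd) (by linear_combination -h5)
      (by linear_combination -h6)
  refine h.c₁.ext _ _ fun k => ?_
  rw [map_zero]
  by_cases hkj : k + 2 ≤ i + 1 ∨ i + 1 + 2 ≤ k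
  · exact hX k _ hkj
  obtain rfl | rfl | rfl : k = i + 1 ∨ k = i + 2 ∨ k = i := by omega
  · refine (mul_eq_zero.1 (?_ : h.c₁.f (i + 1) (h.c₃.v 1) * _ = 0)).resolve_left
      (h.f_one_ne hje hjd)
    have h5 := hX.f_succ i (h.c₃.v 1)
    rw [h1, map_zero, h.f_eq_zero (k := i) (by simpa using hi),
      h.f_eq_zero (k := i + 2) (by simpa [Nat.even_add] using hi)] at h5
    simpa using h5.symm
  · by_cases hid : i + 3 ≤ d
    · exact (off (i + 1) hje hid).1
    · have h5 := hX.f_succ (i + 1) (h.c₃.v 1)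
      rw [h1, map_zero, h.f_eq_zero (k := i + 1 + 1) (by simpa [Nat.even_add_one] using hi),
        h.c₁.f_gt (i + 1 + 2) (by omega)] at h5
      refine (mul_eq_zero.1 (?_ : h.c₁.f (i + 1) (h.c₃.v 1) * _ = 0)).resolve_left
        (h.f_one_ne hje hjd)
      simpa using h5.symm
  · rcases k with _ | k
    · have h5 := hX.f_zero (h.c₃.v 1)
      rw [h1, map_zero, h.f_eq_zero (k := 0) (by simp)] at h5
      refine (mul_eq_zero.1 (?_ : h.c₁.f 1 (h.c₃.v 1) * _ = 0)).resolve_left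
        (h.f_one_ne hje hjd)
      simpa using h5.symm
    · exact (off k (Nat.even_add_one.1 hi) (by omega)).2

theorem mem_tridiagSpace_iff :
    X ∈ tridiagSpace D₁ D₂ D₃ ↔ h.c₁.Tri X ∧ h.c₂.Tri X ∧ h.c₃.Tri X :=
  and_congr h.c₁.isTridiagonal_iff (and_congr h.c₂.isTridiagonal_iff h.c₃.isTridiagonal_iff)

theorem even₂ : h.c₂.IsEvenProj J := fun i => by
  by_cases hi : i ≤ d
  · rw [h.even₁.transfer_second h.c₂ h.odd₁ hi]
    simp [Nat.even_add, h.even_d]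
  · simp [h.c₂.v_gt i (by omega)]

theorem mul_self : J * J = J := h.c₁.hom_ext fun j _ => by
  rw [Module.End.mul_apply, h.even₁]
  split_ifs with hj
  · rw [h.even₁, if_pos hj]
  · exact map_zero _

theorem mul_mem (hX : X ∈ tridiagSpace D₁ D₂ D₃) : X * J ∈ tridiagSpace D₁ D₂ D₃ := by
  rw [h.mem_tridiagSpace_iff] at hX ⊢
  exact ⟨hX.1.mul_evenProj h.even₁, hX.2.1.mul_evenProj h.even₂, hX.2.2.mul_evenProj h.even₃⟩

theorem mul_one_sub_mem (hX : X ∈ tridiagSpace D₁ D₂ D₃) :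
    X * (1 - J) ∈ tridiagSpace D₁ D₂ D₃ := by
  rw [mul_sub, mul_one]
  exact sub_mem hX (h.mul_mem hX)

theorem sup_eq : Submodule.map (LinearMap.mulRight F J) (tridiagSpace D₁ D₂ D₃) ⊔
    Submodule.map (LinearMap.mulRight F (1 - J)) (tridiagSpace D₁ D₂ D₃) =
      tridiagSpace D₁ D₂ D₃ := by
  refine le_antisymm (sup_le ?_ ?_) fun X hX => ?_
  · rintro _ ⟨X, hX, rfl⟩
    exact h.mul_mem hX
  · rintro _ ⟨X, hX, rfl⟩
    exact h.mul_one_sub_mem hX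
  · refine Submodule.mem_sup.2 ⟨X * J, ⟨X, hX, rfl⟩, X * (1 - J), ⟨X, hX, rfl⟩, ?_⟩
    rw [← mul_add, add_sub_cancel, mul_one]

theorem inf_eq : Submodule.map (LinearMap.mulRight F J) (tridiagSpace D₁ D₂ D₃) ⊓
    Submodule.map (LinearMap.mulRight F (1 - J)) (tridiagSpace D₁ D₂ D₃) = ⊥ := by
  refine (Submodule.eq_bot_iff _).2 ?_
  rintro _ ⟨⟨X, -, rfl⟩, ⟨Y, -, hXY⟩⟩
  rw [LinearMap.mulRight_apply, LinearMap.mulRight_apply] at hXY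
  rw [LinearMap.mulRight_apply, ← h.mul_self, ← mul_assoc, ← hXY, mul_assoc, sub_mul, one_mul,
    h.mul_self, sub_self, mul_zero]

theorem one_mem : (1 : Module.End F V) ∈ tridiagSpace D₁ D₂ D₃ :=
  h.mem_tridiagSpace_iff.2 ⟨h.c₁.tri_one, h.c₂.tri_one, h.c₃.tri_one⟩

theorem lower_mem : A ∈ tridiagSpace D₁ D₂ D₃ :=
  h.mem_tridiagSpace_iff.2 ⟨h.c₁.oddTri_lower.tri, h.odd₂.tri, h.c₃.oddTri_raise.tri⟩

theorem raise_mem : B ∈ tridiagSpace D₁ D₂ D₃ :=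
  h.mem_tridiagSpace_iff.2 ⟨h.c₁.oddTri_raise.tri, h.c₂.oddTri_lower.tri, h.odd₃.tri⟩

theorem mul_third_mul_mem : A * C * B ∈ tridiagSpace D₁ D₂ D₃ :=
  h.mem_tridiagSpace_iff.2 ⟨(h.c₁.oddTri_lower_mul_raise h.odd₁).tri,
    (h.c₂.oddTri_mul_raise_lower h.odd₂).tri, (h.c₃.oddTri_raise_lower_mul h.odd₃).tri⟩

theorem mul_mul_third_mem : A * B * C ∈ tridiagSpace D₁ D₂ D₃ :=
  h.mem_tridiagSpace_iff.2 ⟨(h.c₁.oddTri_lower_raise_mul h.odd₁).tri,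
    (h.c₂.oddTri_mul_lower_raise h.odd₂).tri, (h.c₃.oddTri_raise_mul_lower h.odd₃).tri⟩

theorem linearIndependent_even (hd : 4 ≤ d) :
    LinearIndependent F ![J, A * J, B * J, A * C * B * J] := by
  rw [Fintype.linearIndependent_iff]
  intro t ht
  have key : ∀ k j, Even j → t 0 * h.c₁.f k (h.c₁.v j) + t 1 * h.c₁.f (k + 1) (h.c₁.v j) +
      t 2 * (h.c₁.φ j * h.c₁.f k (h.c₁.v (j + 1))) +
      t 3 * (h.c₁.φ j * h.c₁.f (k + 1) (C (h.c₁.v (j + 1)))) = 0 := by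
    intro k j hj
    have h1 := congrArg (h.c₁.f k) (LinearMap.congr_fun ht (h.c₁.v j))
    simpa [Fin.sum_univ_four, h.even₁ j, hj, h.c₁.f_lower, h.c₁.raise] using h1
  have t0 : t 0 = 0 := by
    have h1 := key 0 0 (by simp)
    rw [h.c₁.f_self 0 (by omega), h.c₁.f_ne (0 + 1) 0 (by omega), h.c₁.f_ne 0 (0 + 1) (by omega),
      h.odd₁ (0 + 1) (0 + 1) (by omega) (by omega)] at h1
    simpa using h1
  have t1 : t 1 = 0 := by
    have h1 := key (d - 1) d h.even_d
    rw [show d - 1 + 1 = d by omega, h.c₁.f_self d le_rfl, h.c₁.v_gt (d + 1) (by omega)] at h1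
    simpa [t0] using h1
  have t3 : t 3 = 0 := by
    have h1 := key 1 2 (by simp)
    rw [h.c₁.f_ne 1 (2 + 1) (by omega)] at h1
    simpa [t0, t1, h.c₁.φ_ne 2 (by omega),
      h.c₁.third_down_ne h.c₂ h.c₃ (i := 2) (by omega)] using h1
  have t2 : t 2 = 0 := by
    have h1 := key 1 0 (by simp)
    rw [h.c₁.f_self (0 + 1) (by omega)] at h1
    simpa [t0, t1, t3, h.c₁.φ_ne 0 (by omega)] using h1
  intro i
  fin_cases i
  exacts [t0, t1, t2, t3]

theorem linearIndependent_odd (hd : 4 ≤ d) :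
    LinearIndependent F ![1 - J, A * (1 - J), B * (1 - J), A * B * C * (1 - J)] := by
  rw [Fintype.linearIndependent_iff]
  intro t ht
  have key : ∀ k j, ¬ Even j → t 0 * h.c₁.f k (h.c₁.v j) + t 1 * h.c₁.f (k + 1) (h.c₁.v j) +
      t 2 * (h.c₁.φ j * h.c₁.f k (h.c₁.v (j + 1))) +
      t 3 * (h.c₁.φ k * h.c₁.f k (C (h.c₁.v j))) = 0 := by
    intro k j hj
    have h1 := congrArg (h.c₁.f k) (LinearMap.congr_fun ht (h.c₁.v j))
    simpa [Fin.sum_univ_four, h.even₁ j, hj, h.c₁.f_lower, h.c₁.f_raise, h.c₁.raise] using h1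
  have t0 : t 0 = 0 := by
    have h1 := key 1 1 (by simp)
    rw [h.c₁.f_self 1 (by omega), h.c₁.f_ne (1 + 1) 1 (by omega), h.c₁.f_ne 1 (1 + 1) (by omega),
      h.odd₁ 1 1 (by omega) (by omega)] at h1
    simpa using h1
  have hφd : h.c₁.φ d = 0 := by
    have h1 := h.c₁.f_raise d (h.c₁.v d)
    rwa [h.c₁.f_gt _ (by omega), h.c₁.f_self d le_rfl, mul_one, eq_comm] at h1
  have t2 : t 2 = 0 := by
    have h1 := key d (d - 1) (by
      have := h.even_d
      rwa [show d = d - 1 + 1 by omega, Nat.even_add_one] at this)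
    rw [show d - 1 + 1 = d by omega, h.c₁.f_self d le_rfl, h.c₁.f_gt (d + 1) (by omega),
      hφd] at h1
    simpa [t0, h.c₁.φ_ne (d - 1) (by omega)] using h1
  have t3 : t 3 = 0 := by
    have h1 := key 2 1 (by simp)
    rw [h.c₁.f_ne (2 + 1) 1 (by omega)] at h1
    simpa [t0, t2, h.c₁.φ_ne 2 (by omega),
      h.c₁.third_up_ne h.c₂ h.c₃ (i := 1) (by omega)] using h1
  have t1 : t 1 = 0 := by
    have h1 := key 0 1 (by simp)
    rw [h.c₁.f_self (0 + 1) (by omega)] at h1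
    simpa [t0, t2, t3] using h1
  intro i
  fin_cases i
  exacts [t0, t1, t2, t3]

theorem span_even [FiniteDimensional F V] (hd : 4 ≤ d) :
    Submodule.span F (Set.range ![J, A * J, B * J, A * C * B * J]) =
      Submodule.map (LinearMap.mulRight F J) (tridiagSpace D₁ D₂ D₃) := by
  refine span_range_eq_of_injOn (h.linearIndependent_even hd) (fun i => ?_)
    (LinearMap.pi ![h.c₃.f 0 ∘ₗ LinearMap.applyₗ (h.c₃.v 0), h.c₃.f 1 ∘ₗ LinearMap.applyₗ (h.c₃.v 0),
      h.c₃.f 1 ∘ₗ LinearMap.applyₗ (h.c₃.v 2), h.c₃.f 3 ∘ₗ LinearMap.applyₗ (h.c₃.v 2)]) ?_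
  · fin_cases i
    exacts [⟨1, h.one_mem, one_mul J⟩, ⟨A, h.lower_mem, rfl⟩, ⟨B, h.raise_mem, rfl⟩,
      ⟨A * C * B, h.mul_third_mul_mem, rfl⟩]
  · rintro _ ⟨X, hX, rfl⟩ hΦ
    rw [LinearMap.mulRight_apply] at hΦ ⊢
    have hY := h.mem_tridiagSpace_iff.1 (h.mul_mem hX)
    have hYJ : X * J * J = X * J := by rw [mul_assoc, h.mul_self]
    generalize X * J = Y at hΦ hY hYJ ⊢
    have e0 : h.c₃.f 0 (Y (h.c₃.v 0)) = 0 := congrFun hΦ 0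
    have e1 : h.c₃.f 1 (Y (h.c₃.v 0)) = 0 := congrFun hΦ 1
    have e2 : h.c₃.f 1 (Y (h.c₃.v 2)) = 0 := congrFun hΦ 2
    have e3 : h.c₃.f 3 (Y (h.c₃.v 2)) = 0 := congrFun hΦ 3
    refine h.eq_zero_of_even hY.1 hYJ (h.c₃.ext _ _ fun k => ?_) fun k hk => ?_
    · rw [map_zero]
      obtain rfl | rfl | hk : k = 0 ∨ k = 1 ∨ 2 ≤ k := by omega
      exacts [e0, e1, hY.2.2 _ _ (by omega)]
    · have h1 : Y (h.c₃.v 2) = h.c₃.f 2 (Y (h.c₃.v 2)) • h.c₃.v 2 := h.c₃.ext _ _ fun k => by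
        rw [map_smul, smul_eq_mul]
        by_cases hk2 : k = 2
        · rw [hk2, h.c₃.f_self 2 (by omega), mul_one]
        · rw [h.c₃.f_ne k 2 hk2, mul_zero]
          obtain rfl | rfl | hk : k = 1 ∨ k = 3 ∨ k + 2 ≤ 2 ∨ 2 + 2 ≤ k := by omega
          exacts [e2, e3, hY.2.2 _ _ hk]
      rw [h1, map_smul, h.f_eq_zero (by simpa using hk), smul_zero]

theorem span_odd [FiniteDimensional F V] (hd : 4 ≤ d) :
    Submodule.span F (Set.range ![1 - J, A * (1 - J), B * (1 - J), A * B * C * (1 - J)]) =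
      Submodule.map (LinearMap.mulRight F (1 - J)) (tridiagSpace D₁ D₂ D₃) := by
  refine span_range_eq_of_injOn (h.linearIndependent_odd hd) (fun i => ?_)
    (LinearMap.pi ![h.c₃.f 0 ∘ₗ LinearMap.applyₗ (h.c₃.v 1), h.c₃.f 1 ∘ₗ LinearMap.applyₗ (h.c₃.v 1),
      h.c₃.f 2 ∘ₗ LinearMap.applyₗ (h.c₃.v 1), h.c₃.f 4 ∘ₗ LinearMap.applyₗ (h.c₃.v 3)]) ?_
  · fin_cases i
    exacts [⟨1, h.one_mem, one_mul (1 - J)⟩, ⟨A, h.lower_mem, rfl⟩, ⟨B, h.raise_mem, rfl⟩,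
      ⟨A * B * C, h.mul_mul_third_mem, rfl⟩]
  · rintro _ ⟨X, hX, rfl⟩ hΦ
    rw [LinearMap.mulRight_apply] at hΦ ⊢
    have hY := h.mem_tridiagSpace_iff.1 (h.mul_one_sub_mem hX)
    have hYJ : X * (1 - J) * J = 0 := by
      rw [mul_assoc, sub_mul, one_mul, h.mul_self, sub_self, mul_zero]
    generalize X * (1 - J) = Y at hΦ hY hYJ ⊢
    have e0 : h.c₃.f 0 (Y (h.c₃.v 1)) = 0 := congrFun hΦ 0
    have e1 : h.c₃.f 1 (Y (h.c₃.v 1)) = 0 := congrFun hΦ 1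
    have e2 : h.c₃.f 2 (Y (h.c₃.v 1)) = 0 := congrFun hΦ 2
    have e3 : h.c₃.f 4 (Y (h.c₃.v 3)) = 0 := congrFun hΦ 3
    have hY1 : Y (h.c₃.v 1) = 0 := h.c₃.ext _ _ fun k => by
      rw [map_zero]
      obtain rfl | rfl | rfl | hk : k = 0 ∨ k = 1 ∨ k = 2 ∨ 3 ≤ k := by omega
      exacts [e0, e1, e2, hY.2.2 _ _ (by omega)]
    have hY3 : Y (h.c₃.v 3) = h.c₃.f 2 (Y (h.c₃.v 3)) • h.c₃.v 2 +
        h.c₃.f 3 (Y (h.c₃.v 3)) • h.c₃.v 3 := h.c₃.ext _ _ fun k => by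
      rw [map_add, map_smul, map_smul, smul_eq_mul, smul_eq_mul]
      by_cases hk2 : k = 2
      · rw [hk2, h.c₃.f_self 2 (by omega), h.c₃.f_ne 2 3 (by omega), mul_one, mul_zero, add_zero]
      by_cases hk3 : k = 3
      · rw [hk3, h.c₃.f_self 3 (by omega), h.c₃.f_ne 3 2 (by omega), mul_one, mul_zero, zero_add]
      rw [h.c₃.f_ne k 2 hk2, h.c₃.f_ne k 3 hk3, mul_zero, mul_zero, add_zero]
      obtain rfl | hk : k = 4 ∨ k + 2 ≤ 3 ∨ 3 + 2 ≤ k := by omega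
      exacts [e3, hY.2.2 _ _ hk]
    have corner : h.c₁.f 0 (Y (h.c₁.v 1)) = 0 := by
      have h1 := hY.1.f_zero (h.c₃.v 1)
      rw [hY1, map_zero, h.f_eq_zero (k := 0) (by simp), zero_mul, zero_add] at h1
      exact (mul_eq_zero.1 h1.symm).resolve_left (h.f_one_ne (by simp) (by omega))
    have e4 : h.c₃.f 2 (Y (h.c₃.v 3)) = 0 := by
      have h1 := hY.1.f_zero (h.c₃.v 3)
      rw [corner, h.f_eq_zero (k := 0) (i := 3) (by decide), zero_mul, mul_zero, add_zero, hY3,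
        map_add, map_smul, map_smul, h.f_eq_zero (k := 0) (i := 3) (by decide), smul_zero,
        add_zero, smul_eq_mul] at h1
      exact (mul_eq_zero.1 h1).resolve_right (h.f_zero_two_ne (by omega))
    refine h.eq_zero_of_odd hY.1 hYJ hY1 fun k hk => ?_
    rw [hY3, e4, zero_smul, zero_add, map_smul, h.f_eq_zero (by simp [hk]; decide), smul_zero]

end BipartiteCoords

theorem stmt4
    {F : Type*} [Field F] {V : Type*} [AddCommGroup V] [Module F V]
    [FiniteDimensional F V] {d : ℕ} (hdim : Module.finrank F V = d + 1)
    (A B C : Module.End F V) (DAB DBC DCA : LRDecomp F V d)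
    (hAB : IsLRPairWith A B DAB) (hBC : IsLRPairWith B C DBC) (hCA : IsLRPairWith C A DCA)
    (hd : 4 ≤ d)
    (E E' E'' : ℕ → Module.End F V)
    (hE : IsIdemSeq DAB E) (hE' : IsIdemSeq DBC E') (hE'' : IsIdemSeq DCA E'')
    (hbip : IsBipartite d A B C E E' E'')
    (J : Module.End F V) (hJ : J = ∑ j ∈ Finset.range (d / 2 + 1), E (2 * j)) :
    Module.finrank F (tridiagSpace DAB DBC DCA) = 8 ∧
    LinearIndependent F ![J, A * J, B * J, A * C * B * J] ∧
    Submodule.span F ({J, A * J, B * J, A * C * B * J} : Set (Module.End F V)) = Submodule.map (LinearMap.mulRight F J) (tridiagSpace DAB DBC DCA) ∧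
    LinearIndependent F ![1 - J, A * (1 - J), B * (1 - J), A * B * C * (1 - J)] ∧
    Submodule.span F ({1 - J, A * (1 - J), B * (1 - J), A * B * C * (1 - J)} :
      Set (Module.End F V)) = Submodule.map (LinearMap.mulRight F (1 - J)) (tridiagSpace DAB DBC DCA) := by
  obtain ⟨h⟩ := BipartiteCoords.nonempty hdim hAB hBC hCA hE hE' hE'' hbip hJ
  have heven := h.span_even hd
  have hodd := h.span_odd hd
  have hli := h.linearIndependent_even hd
  have hli' := h.linearIndependent_odd hd
  have hrange : ∀ a b c e : Module.End F V,
      Set.range ![a, b, c, e] = ({a, b, c, e} : Set (Module.End F V)) := fun a b c e => by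
    ext x
    simp only [Matrix.range_cons, Matrix.range_empty, Set.mem_union, Set.mem_insert_iff,
      Set.mem_singleton_iff, Set.mem_empty_iff_false]
    tauto
  refine ⟨?_, hli, hrange _ _ _ _ ▸ heven, hli', hrange _ _ _ _ ▸ hodd⟩
  rw [← h.sup_eq, ← add_zero (Module.finrank F _), ← finrank_bot F (Module.End F V), ← h.inf_eq,
    Submodule.finrank_sup_add_finrank_inf_eq, ← heven, ← hodd, finrank_span_eq_card hli,
    finrank_span_eq_card hli']
  rfl
end

section
/- Let (A,B,C) be a nonbipartite normalized LR triple on V of diameter d ≥ 2 that does not have q-Weyl type for any q. Then the tridiagonal space 𝒳 of (A,B,C) has dimension at most 7. -/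
variable {F : Type*} [Field F] {V : Type*} [AddCommGroup V] [Module F V]

/-- The pairing of `(n₁, n₂, n₃)` with the window `(g (i+2), g (i+1), g i)` of a sequence. -/
def windowDot {F : Type*} [Field F] (g : ℕ → F) (n₁ n₂ n₃ : F) (i : ℕ) : F :=
  n₁ * g (i + 2) + n₂ * g (i + 1) + n₃ * g i

/-- The determinant of three consecutive windows of a sequence. -/
def windowDet {F : Type*} [Field F] (g : ℕ → F) (i : ℕ) : F :=
  g (i + 2) * (g (i + 2) * g (i + 2) - g (i + 1) * g (i + 3))
    - g (i + 1) * (g (i + 3) * g (i + 2) - g (i + 1) * g (i + 4))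
    + g i * (g (i + 3) * g (i + 3) - g (i + 2) * g (i + 4))

/-- The relations between the Toeplitz parameters `g (n+2) = β n` and the parameter sequence `φ`
that a normalized LR triple satisfies. -/
structure ToeplitzData {F : Type*} [Field F] (d : ℕ) (g φ ε : ℕ → F) : Prop where
  two_le : 2 ≤ d
  g_zero : g 0 = 0
  g_one : g 1 = 0
  g_two : g 2 = 1
  g_three : g 3 = 1
  phi_zero : φ 0 = 0
  phi_last : φ (d + 1) = 0
  phi_ne : ∀ i, 1 ≤ i → i ≤ d → φ i ≠ 0
  rel : ∀ k j, k ≤ d → k + j ≤ d + 1 →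
    (φ (k + j) - φ k) * g (j + 2) = (φ (k + 1) - φ k) * g (j + 1) + ε k * g j
  g_last : g (d + 2) ≠ 0
  det_last : windowDet g (d - 2) ≠ 0

section Window

variable {F : Type*} [Field F]

theorem windowDot_eq_zero_of_windowDet_ne_zero {g : ℕ → F} {i : ℕ} {n₁ n₂ n₃ : F}
    (hD : windowDet g i ≠ 0) (h0 : windowDot g n₁ n₂ n₃ i = 0)
    (h1 : windowDot g n₁ n₂ n₃ (i + 1) = 0) (h2 : windowDot g n₁ n₂ n₃ (i + 2) = 0) :
    n₁ = 0 ∧ n₂ = 0 ∧ n₃ = 0 := by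
  unfold windowDot at h0 h1 h2
  simp only [add_assoc, Nat.reduceAdd] at h0 h1 h2
  refine ⟨?_, ?_, ?_⟩ <;> refine (mul_eq_zero.mp ?_).resolve_left hD <;> unfold windowDet
  · linear_combination (g (i + 2) * g (i + 2) - g (i + 1) * g (i + 3)) * h0
      + (g i * g (i + 3) - g (i + 1) * g (i + 2)) * h1
      + (g (i + 1) * g (i + 1) - g i * g (i + 2)) * h2
  · linear_combination (g (i + 4) * g (i + 1) - g (i + 3) * g (i + 2)) * h0
      + (g (i + 2) * g (i + 2) - g i * g (i + 4)) * h1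
      + (g i * g (i + 3) - g (i + 2) * g (i + 1)) * h2
  · linear_combination (g (i + 3) * g (i + 3) - g (i + 2) * g (i + 4)) * h0
      + (g (i + 1) * g (i + 4) - g (i + 2) * g (i + 3)) * h1
      + (g (i + 2) * g (i + 2) - g (i + 1) * g (i + 3)) * h2

theorem windowDet_ne_zero_of_forall {g : ℕ → F} {i : ℕ}
    (h : ∀ n₁ n₂ n₃ : F, windowDot g n₁ n₂ n₃ i = 0 → windowDot g n₁ n₂ n₃ (i + 1) = 0 →
      windowDot g n₁ n₂ n₃ (i + 2) = 0 → n₁ = 0 ∧ n₂ = 0 ∧ n₃ = 0) :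
    windowDet g i ≠ 0 := by
  intro hD
  let M : Matrix (Fin 3) (Fin 3) F :=
    !![g (i + 2), g (i + 1), g i; g (i + 3), g (i + 2), g (i + 1); g (i + 4), g (i + 3), g (i + 2)]
  have hM : M.det = 0 := by
    rw [← hD, Matrix.det_fin_three]
    simp [M, windowDet]
    ring
  obtain ⟨v, hv, hMv⟩ := Matrix.exists_mulVec_eq_zero_iff.mpr hM
  have e0 := congrFun hMv 0
  have e1 := congrFun hMv 1
  have e2 := congrFun hMv 2
  simp [M, Matrix.mulVec, dotProduct, Fin.sum_univ_three] at e0 e1 e2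
  obtain ⟨a, b, c⟩ := h (v 0) (v 1) (v 2)
    (by unfold windowDot; linear_combination e0) (by unfold windowDot; linear_combination e1)
    (by unfold windowDot; linear_combination e2)
  exact hv (by ext k; fin_cases k <;> simp [a, b, c])

end Window

namespace ToeplitzData

variable {F : Type*} [Field F] {d : ℕ} {g φ ε : ℕ → F}

theorem rec_zero (h : ToeplitzData d g φ ε) {n : ℕ} (hn : n ≤ d + 1) :
    φ n * g (n + 2) = φ 1 * g (n + 1) + ε 0 * g n := by
  have := h.rel 0 n (by omega) (by omega)
  simpa [h.phi_zero] using this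

theorem phi_one_ne (h : ToeplitzData d g φ ε) : φ 1 ≠ 0 :=
  h.phi_ne 1 le_rfl (by have := h.two_le; omega)

theorem eps_zero_mul (h : ToeplitzData d g φ ε) : ε 0 * g (d + 1) = -(φ 1 * g (d + 2)) := by
  have := h.rec_zero le_rfl
  rw [h.phi_last] at this
  linear_combination -this

theorem eps_zero_ne (h : ToeplitzData d g φ ε) : ε 0 ≠ 0 := by
  intro h0
  have := h.eps_zero_mul
  rw [h0] at this
  exact mul_ne_zero h.phi_one_ne h.g_last (by linear_combination this)

theorem g_pred_last_ne (h : ToeplitzData d g φ ε) : g (d + 1) ≠ 0 := by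
  intro h0
  have := h.eps_zero_mul
  rw [h0] at this
  exact mul_ne_zero h.phi_one_ne h.g_last (by linear_combination this)

theorem g_ne_zero_succ (h : ToeplitzData d g φ ε) {n : ℕ} (hn : 1 ≤ n) (hnd : n ≤ d + 1)
    (h0 : g n = 0) : g (n + 1) ≠ 0 := by
  intro h1
  obtain ⟨m, hm⟩ : ∃ m, n + 1 + m = d + 2 := ⟨d + 1 - n, by omega⟩
  have key : ∀ m, n + 1 + m ≤ d + 2 → g (n + m) = 0 ∧ g (n + m + 1) = 0 := by
    intro m
    induction m with
    | zero => exact fun _ => ⟨h0, h1⟩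
    | succ m ih =>
      intro hm
      obtain ⟨i0, i1⟩ := ih (by omega)
      refine ⟨i1, ?_⟩
      have := h.rec_zero (n := n + m) (by omega)
      rw [i0, i1] at this
      refine (mul_eq_zero.mp ?_).resolve_left (h.phi_ne (n + m) (by omega) (by omega))
      rw [show n + (m + 1) + 1 = n + m + 2 by ring]
      linear_combination this
  have := (key m hm.le).2
  rw [show n + m + 1 = d + 2 by omega] at this
  exact h.g_last this

theorem eps_eq (h : ToeplitzData d g φ ε) {k : ℕ} (hk : k + 2 ≤ d + 1) :
    ε k = (φ (k + 2) - φ k) * g 4 - (φ (k + 1) - φ k) := by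
  have := h.rel k 2 (by omega) hk
  simp only [Nat.reduceAdd, h.g_two, h.g_three] at this
  linear_combination -this

theorem rel_three (h : ToeplitzData d g φ ε) {k : ℕ} (hk : k + 3 ≤ d + 1) :
    (φ (k + 3) - φ k) * g 5 = (2 * φ (k + 1) - 2 * φ k + φ (k + 2) - φ (k + 1)) * g 4
      - (φ (k + 1) - φ k) := by
  have := h.rel k 3 (by omega) hk
  simp only [Nat.reduceAdd, h.g_three, h.eps_eq (show k + 2 ≤ d + 1 by omega)] at this
  linear_combination this

end ToeplitzData

/-- The obstruction to the differences of `φ` being in geometric progression. -/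
def stepDet {F : Type*} [Field F] (φ : ℕ → F) (k : ℕ) : F :=
  (φ (k + 1) - φ k) * (φ (k + 3) - φ (k + 2)) - (φ (k + 2) - φ (k + 1)) ^ 2

namespace ToeplitzData

variable {F : Type*} [Field F] {d : ℕ} {g φ ε : ℕ → F}

theorem stepDet_zero_eq_zero_of_g_four (h : ToeplitzData d g φ ε) (hd : 4 ≤ d) (h4 : g 4 = 0) :
    stepDet φ 0 = 0 := by
  have h5 : g 5 ≠ 0 := h.g_ne_zero_succ (n := 4) (by omega) (by omega) h4
  have h6 : g 6 ≠ 0 := by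
    intro h6
    have := h.rec_zero (n := 4) (by omega)
    simp only [Nat.reduceAdd, h6, h4] at this
    exact mul_ne_zero h.phi_one_ne h5 (by linear_combination -this)
  have key : ∀ k, k ≤ 1 → (φ (k + 2) - φ (k + 1)) * g 6 =
      (φ (k + 1) - φ k) * (g 5 * (g 6 - g 5)) := by
    intro k hk
    have b := h.rel_three (k := k + 1) (by omega)
    have c := h.rel k 4 (by omega) (by omega)
    simp only [Nat.reduceAdd, h4, add_assoc] at b c
    linear_combination g 6 * b - g 5 * c
  have k0 := key 0 (by omega)
  have k1 := key 1 (by omega)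
  simp only [Nat.reduceAdd, zero_add] at k0 k1
  refine (mul_eq_zero.mp ?_).resolve_right h6
  unfold stepDet
  simp only [zero_add]
  linear_combination (φ 1 - φ 0) * k1 - (φ 2 - φ 1) * k0

theorem g_ne_zero_of_stepDet (h : ToeplitzData d g φ ε) (hd : 4 ≤ d) (hH : stepDet φ 0 ≠ 0)
    {n : ℕ} (hn : 2 ≤ n) (hnd : n ≤ d + 2) : g n ≠ 0 := by
  have h4 : g 4 ≠ 0 := fun h4 => hH (h.stepDet_zero_eq_zero_of_g_four hd h4)
  rcases Nat.lt_or_ge n 4 with h' | h'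
  · interval_cases n
    · simp [h.g_two]
    · simp [h.g_three]
  intro h0
  obtain ⟨m, rfl⟩ : ∃ m, n = m + 2 := ⟨n - 2, by omega⟩
  rcases Nat.lt_or_ge d m with h'' | h''
  · omega
  rcases h''.eq_or_lt with rfl | h''
  · exact h.g_last h0
  have a := h.rel 0 m (by omega) (by omega)
  have b := h.rel 1 m (by omega) (by omega)
  rw [h0] at a b
  have e0 := h.eps_eq (k := 0) (by omega)
  have e1 := h.eps_eq (k := 1) (by omega)
  simp only [Nat.reduceAdd, zero_add] at a b e0 e1
  have hdet : stepDet φ 0 = (φ 1 - φ 0) * (φ 3 - φ 2) - (φ 2 - φ 1) ^ 2 := rfl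
  have z1 : g m = 0 := by
    refine (mul_eq_zero.mp ?_).resolve_left (mul_ne_zero h4 hH)
    rw [hdet]
    rw [e0] at a
    rw [e1] at b
    linear_combination (φ 2 - φ 1) * a - (φ 1 - φ 0) * b
  have z2 : g (m + 1) = 0 := by
    refine (mul_eq_zero.mp ?_).resolve_left (mul_ne_zero h4 hH)
    rw [hdet]
    rw [e0] at a
    rw [e1] at b
    linear_combination ((φ 2 - φ 0) * g 4 - (φ 1 - φ 0)) * b
      - ((φ 3 - φ 1) * g 4 - (φ 2 - φ 1)) * a
  exact h.g_ne_zero_succ (by omega) (by omega) z1 z2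

theorem windowDet_mul (h : ToeplitzData d g φ ε) (hd : 4 ≤ d) {i : ℕ} (hi : i + 2 ≤ d) :
    g 4 * stepDet φ 0 * windowDet g i = g (i + 2) * g (i + 3) * g (i + 4) * stepDet φ i := by
  have e0 := h.eps_eq (k := 0) (by omega)
  have e1 := h.eps_eq (k := 1) (by omega)
  have a0 := h.rel 0 i (by omega) (by omega)
  have a1 := h.rel 0 (i + 1) (by omega) (by omega)
  have a2 := h.rel 0 (i + 2) (by omega) (by omega)
  have b0 := h.rel 1 i (by omega) (by omega)
  have b1 := h.rel 1 (i + 1) (by omega) (by omega)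
  have b2 := h.rel 1 (i + 2) (by omega) (by omega)
  rw [show 1 + i = i + 1 by ring] at b0
  rw [show 1 + (i + 1) = i + 2 by ring] at b1
  rw [show 1 + (i + 2) = i + 3 by ring] at b2
  simp only [Nat.reduceAdd, zero_add, add_assoc] at a0 a1 a2 b0 b1 b2 e0 e1
  have hM : g 4 * stepDet φ 0 = (φ 1 - φ 0) * ε 1 - (φ 2 - φ 1) * ε 0 := by
    rw [e0, e1, stepDet]
    ring
  rw [hM]
  let det (x y : ℕ → F) : F := g (i + 2) * (x 1 * y 2 - x 2 * y 1)
    - g (i + 3) * (x 0 * y 2 - x 2 * y 0) + g (i + 4) * (x 0 * y 1 - x 1 * y 0)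
  trans det (fun k => (φ 1 - φ 0) * g (i + k + 1) + ε 0 * g (i + k))
    (fun k => (φ 2 - φ 1) * g (i + k + 1) + ε 1 * g (i + k))
  · simp only [det, windowDet, add_assoc, Nat.reduceAdd, add_zero, zero_add]
    ring
  · simp only [det, add_assoc, Nat.reduceAdd, add_zero, zero_add, ← a0, ← a1, ← a2, ← b0, ← b1,
      ← b2, stepDet]
    ring

theorem windowDet_ne_zero_of_stepDet (h : ToeplitzData d g φ ε) (hd : 4 ≤ d)
    (hH : stepDet φ 0 ≠ 0) {i : ℕ} (hi : i ≤ d - 2) : windowDet g i ≠ 0 := by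
  have hg := fun n => h.g_ne_zero_of_stepDet hd hH (n := n)
  have hlast : stepDet φ (d - 2) ≠ 0 := by
    intro h0
    have := h.windowDet_mul hd (i := d - 2) (by omega)
    rw [h0, mul_zero] at this
    exact mul_ne_zero (mul_ne_zero (hg 4 (by omega) (by omega)) hH) h.det_last this
  have hall : stepDet φ i ≠ 0 := by
    induction hi using Nat.decreasingInduction with
    | self => exact hlast
    | of_succ k hk ih =>
      intro h0
      apply ih
      have a := h.rel_three (k := k) (by omega)
      have b := h.rel_three (k := k + 1) (by omega)
      refine (mul_eq_zero.mp ?_).resolve_left (hg 5 (by omega) (by omega))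
      unfold stepDet at h0 ⊢
      simp only [add_assoc, Nat.reduceAdd] at a b h0 ⊢
      linear_combination (φ (k + 2) - φ (k + 1)) * b - (φ (k + 3) - φ (k + 2)) * a
        + (g 5 - 2 * g 4 + 1) * h0
  intro h0
  have := h.windowDet_mul hd (i := i) (by omega)
  rw [h0, mul_zero] at this
  exact mul_ne_zero (mul_ne_zero (mul_ne_zero (hg _ (by omega) (by omega))
    (hg _ (by omega) (by omega))) (hg _ (by omega) (by omega))) hall this.symm

end ToeplitzData

theorem quadratic_coeff_eq_zero {F : Type*} [Field F] {A B C x y z : F} (hxy : x ≠ y)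
    (hxz : x ≠ z) (hyz : y ≠ z) (hx : A * x ^ 2 + B * x + C = 0)
    (hy : A * y ^ 2 + B * y + C = 0) (hz : A * z ^ 2 + B * z + C = 0) :
    A = 0 ∧ B = 0 ∧ C = 0 := by
  have h1 : A * (x + y) + B = 0 := (mul_eq_zero.mp (by linear_combination hx - hy :
    (x - y) * (A * (x + y) + B) = 0)).resolve_left (sub_ne_zero.mpr hxy)
  have h2 : A * (x + z) + B = 0 := (mul_eq_zero.mp (by linear_combination hx - hz :
    (x - z) * (A * (x + z) + B) = 0)).resolve_left (sub_ne_zero.mpr hxz)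
  have hA : A = 0 := (mul_eq_zero.mp (by linear_combination h1 - h2 :
    (y - z) * A = 0)).resolve_left (sub_ne_zero.mpr hyz)
  have hB : B = 0 := by simpa [hA] using h1
  exact ⟨hA, hB, by simpa [hA, hB] using hx⟩

namespace ToeplitzData

variable {F : Type*} [Field F] {d : ℕ} {g φ ε : ℕ → F}

theorem exists_ratio (h : ToeplitzData d g φ ε) (hd : 4 ≤ d) (hH : stepDet φ 0 = 0) :
    ∃ r : F, r ≠ 0 ∧ ∀ n ≤ d, φ (n + 1) = φ 1 + r * φ n := by
  have h1 := h.phi_one_ne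
  obtain ⟨w, hw⟩ : ∃ w : ℕ → F, ∀ k, w k = φ (k + 1) - φ k := ⟨_, fun _ => rfl⟩
  have hw0 : w 0 = φ 1 := by simp [hw, h.phi_zero]
  have hw0' : w 0 ≠ 0 := hw0 ▸ h1
  obtain ⟨r, hr⟩ : ∃ r, w 1 = r * w 0 := ⟨w 1 / w 0, by field_simp⟩
  have hr2 : w 2 = r * w 1 := by
    have hH' : w 0 * w 2 - w 1 ^ 2 = 0 := by simp only [hw]; exact hH
    refine mul_left_cancel₀ hw0' ?_
    rw [hr] at hH' ⊢
    linear_combination hH'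
  have hrec : ∀ k, k + 3 ≤ d + 1 →
      g 5 * w (k + 2) + (g 5 - g 4) * w (k + 1) + (g 5 - 2 * g 4 + 1) * w k = 0 := by
    intro k hk
    have := h.rel_three hk
    simp only [hw, add_assoc, Nat.reduceAdd]
    linear_combination this
  have hgeom : ∀ k, k + 1 ≤ d → w (k + 1) = r * w k := by
    have r0 := hrec 0 (by omega)
    simp only [zero_add, hr2, hr] at r0
    have r0' : g 5 * r ^ 2 + (g 5 - g 4) * r + (g 5 - 2 * g 4 + 1) = 0 :=
      (mul_eq_zero.mp (by linear_combination r0 :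
        (g 5 * r ^ 2 + (g 5 - g 4) * r + (g 5 - 2 * g 4 + 1)) * w 0 = 0)).resolve_right hw0'
    by_cases h5 : g 5 = 0
    · have h4 : g 4 ≠ 0 := fun h4 => h.g_ne_zero_succ (n := 4) (by omega) (by omega) h4 h5
      have h6 : g 6 ≠ 0 := h.g_ne_zero_succ (n := 5) (by omega) (by omega) h5
      have hlow : ∀ k, k + 2 ≤ d → w (k + 1) = r * w k := by
        intro k hk
        have := hrec k (by omega)
        refine mul_left_cancel₀ h4 ?_
        rw [h5] at this r0'
        linear_combination w k * r0' - this
      have hrec4 : ∀ k, k + 4 ≤ d + 1 → (w k + w (k + 1) + w (k + 2) + w (k + 3)) * g 6 =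
          g 4 * ((w k + w (k + 1)) * g 4 - w k) := by
        intro k hk
        have := h.rel k 4 (by omega) hk
        simp only [Nat.reduceAdd, h5, h.eps_eq (show k + 2 ≤ d + 1 by omega)] at this
        simp only [hw, add_assoc, Nat.reduceAdd]
        linear_combination this
      have q0 := hrec4 0 (by omega)
      have q0' : (1 + r + r ^ 2 + r ^ 3) * g 6 = g 4 * ((1 + r) * g 4 - 1) := by
        refine mul_right_cancel₀ hw0' ?_
        simp only [zero_add, hlow 2 (by omega), hr2, hr] at q0
        linear_combination q0
      intro k hk
      rcases hk.eq_or_lt with hk' | hk'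
      · obtain ⟨m, rfl⟩ : ∃ m, k = m + 3 := ⟨k - 3, by omega⟩
        have q1 := hrec4 (m + 1) (by omega)
        have a := hlow (m + 1) (by omega)
        have b := hlow (m + 2) (by omega)
        simp only [add_assoc, Nat.reduceAdd] at q1 a b ⊢
        refine mul_left_cancel₀ h6 ?_
        rw [b, a] at q1 ⊢
        linear_combination q1 - w (m + 1) * q0'
      · exact hlow k (by omega)
    · intro k
      induction k with
      | zero => exact fun _ => hr
      | succ k ih =>
        intro hk
        refine mul_left_cancel₀ h5 ?_
        have := hrec k (by omega)
        rw [ih (by omega)] at this ⊢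
        linear_combination this - w k * r0'
  have hstep : ∀ n ≤ d, φ (n + 1) = φ 1 + r * φ n := by
    intro n
    induction n with
    | zero => simp [h.phi_zero]
    | succ n ih =>
      intro hn
      have a := hgeom n (by omega)
      rw [hw, hw] at a
      linear_combination a + ih (by omega)
  refine ⟨r, ?_, hstep⟩
  rintro rfl
  have := hstep d le_rfl
  rw [h.phi_last] at this
  exact h1 (by linear_combination -this)

theorem phi_ne_of_lt (h : ToeplitzData d g φ ε) {r : F} (hr : r ≠ 0)
    (hφ : ∀ n ≤ d, φ (n + 1) = φ 1 + r * φ n) {i j : ℕ} (hij : i < j) (hj : j ≤ d) :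
    φ i ≠ φ j := by
  induction i generalizing j with
  | zero =>
    rw [h.phi_zero]
    exact (h.phi_ne j (by omega) hj).symm
  | succ i ih =>
    obtain ⟨m, rfl⟩ : ∃ m, j = m + 1 := ⟨j - 1, by omega⟩
    intro he
    rw [hφ i (by omega), hφ m (by omega)] at he
    exact ih (by omega) (by omega) (mul_left_cancel₀ hr (add_left_cancel he))

/-- A functional annihilating two adjacent windows satisfies a quadratic relation at `φ i`. -/
theorem quadratic_of_windowDot (h : ToeplitzData d g φ ε) {r : F}
    (hφ : ∀ n ≤ d, φ (n + 1) = φ 1 + r * φ n) {n₁ n₂ n₃ : F} {i : ℕ} (hi : i + 1 ≤ d)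
    (h0 : windowDot g n₁ n₂ n₃ i = 0) (h1 : windowDot g n₁ n₂ n₃ (i + 1) = 0) :
    (n₃ * φ i + ε 0 * n₁) * (n₁ * ε 0 + n₃ * (φ 1 + r * φ i)) +
      (n₁ * φ 1 + n₂ * (φ 1 + r * φ i)) * (n₃ * φ 1 - ε 0 * n₂) = 0 := by
  have a := h.rec_zero (n := i) (by omega)
  have b := h.rec_zero (n := i + 1) (by omega)
  rw [hφ i (by omega)] at b
  unfold windowDot at h0 h1
  simp only [add_assoc, Nat.reduceAdd] at a b h0 h1
  have e1 : (n₃ * φ i + ε 0 * n₁) * g (i + 2) = (n₃ * φ 1 - ε 0 * n₂) * g (i + 1) := by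
    linear_combination n₃ * a + ε 0 * h0
  have e2 : (n₁ * φ 1 + n₂ * (φ 1 + r * φ i)) * g (i + 2) =
      -((n₁ * ε 0 + n₃ * (φ 1 + r * φ i)) * g (i + 1)) := by
    linear_combination (φ 1 + r * φ i) * h1 - n₁ * b
  have hne : g (i + 1) ≠ 0 ∨ g (i + 2) ≠ 0 := by
    by_cases h' : g (i + 1) = 0
    · exact Or.inr (h.g_ne_zero_succ (by omega) (by omega) h')
    · exact Or.inl h'
  rcases hne with h' | h'
  · refine (mul_eq_zero.mp ?_).resolve_right h'
    linear_combination (n₁ * φ 1 + n₂ * (φ 1 + r * φ i)) * (-e1) + (n₃ * φ i + ε 0 * n₁) * e2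
  · refine (mul_eq_zero.mp ?_).resolve_right h'
    linear_combination (n₁ * ε 0 + n₃ * (φ 1 + r * φ i)) * e1 + (n₃ * φ 1 - ε 0 * n₂) * e2

/-- No nonzero functional annihilates three pairs of adjacent windows. -/
theorem eq_zero_of_three_pairs (h : ToeplitzData d g φ ε) {r : F} (hr : r ≠ 0)
    (hφ : ∀ n ≤ d, φ (n + 1) = φ 1 + r * φ n) {n₁ n₂ n₃ : F} {i j k : ℕ} (hij : i < j)
    (hjk : j < k) (hk : k + 1 ≤ d)
    (hi0 : windowDot g n₁ n₂ n₃ i = 0) (hi1 : windowDot g n₁ n₂ n₃ (i + 1) = 0)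
    (hj0 : windowDot g n₁ n₂ n₃ j = 0) (hj1 : windowDot g n₁ n₂ n₃ (j + 1) = 0)
    (hk0 : windowDot g n₁ n₂ n₃ k = 0) (hk1 : windowDot g n₁ n₂ n₃ (k + 1) = 0) :
    n₁ = 0 ∧ n₂ = 0 ∧ n₃ = 0 := by
  have qi := h.quadratic_of_windowDot hφ (by omega) hi0 hi1
  have qj := h.quadratic_of_windowDot hφ (by omega) hj0 hj1
  have qk := h.quadratic_of_windowDot hφ (by omega) hk0 hk1
  obtain ⟨hA, hB, hC⟩ := quadratic_coeff_eq_zero (A := n₃ ^ 2 * r)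
    (B := n₃ * (n₁ * ε 0 + n₃ * φ 1) + ε 0 * n₁ * n₃ * r + n₂ * r * (n₃ * φ 1 - ε 0 * n₂))
    (C := ε 0 * n₁ * (n₁ * ε 0 + n₃ * φ 1) + (n₁ * φ 1 + n₂ * φ 1) * (n₃ * φ 1 - ε 0 * n₂))
    (h.phi_ne_of_lt hr hφ hij (by omega)) (h.phi_ne_of_lt hr hφ (hij.trans hjk) (by omega))
    (h.phi_ne_of_lt hr hφ hjk (by omega))
    (by linear_combination qi) (by linear_combination qj) (by linear_combination qk)
  have ht := h.eps_zero_ne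
  have h3 : n₃ = 0 := by simpa [hr] using hA
  subst h3
  have h2 : n₂ = 0 := by simpa [hr, ht] using hB
  subst h2
  have h1 : n₁ = 0 := by simpa [ht] using hC
  exact ⟨h1, rfl, rfl⟩

end ToeplitzData

theorem windowDot_add_two_of_windowDet {F : Type*} [Field F] {g : ℕ → F} {i : ℕ} {n₁ n₂ n₃ : F}
    (hD : windowDet g i = 0)
    (hne : ¬ (g (i + 1) ^ 2 = g i * g (i + 2) ∧ g i * g (i + 3) = g (i + 1) * g (i + 2) ∧
      g (i + 2) ^ 2 = g (i + 1) * g (i + 3)))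
    (h0 : windowDot g n₁ n₂ n₃ i = 0) (h1 : windowDot g n₁ n₂ n₃ (i + 1) = 0) :
    windowDot g n₁ n₂ n₃ (i + 2) = 0 := by
  by_contra hc
  apply hne
  unfold windowDet at hD
  unfold windowDot at h0 h1 hc
  simp only [add_assoc, Nat.reduceAdd] at h0 h1 hc
  refine ⟨?_, ?_, ?_⟩ <;> refine sub_eq_zero.mp ((mul_eq_zero.mp ?_).resolve_left hc)
  · linear_combination n₁ * hD
      - (g (i + 2) * g (i + 2) - g (i + 1) * g (i + 3)) * h0
      - (g i * g (i + 3) - g (i + 1) * g (i + 2)) * h1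
  · linear_combination n₂ * hD - (g (i + 4) * g (i + 1) - g (i + 3) * g (i + 2)) * h0
      - (g (i + 2) * g (i + 2) - g i * g (i + 4)) * h1
  · linear_combination n₃ * hD - (g (i + 3) * g (i + 3) - g (i + 2) * g (i + 4)) * h0
      - (g (i + 1) * g (i + 4) - g (i + 2) * g (i + 3)) * h1

theorem windowDot_add_one_of_windowDet {F : Type*} [Field F] {g : ℕ → F} {i : ℕ} {n₁ n₂ n₃ : F}
    (hD : windowDet g i = 0)
    (hne : ¬ (g i * g (i + 3) = g (i + 1) * g (i + 2) ∧ g (i + 2) ^ 2 = g i * g (i + 4) ∧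
      g (i + 1) * g (i + 4) = g (i + 2) * g (i + 3)))
    (h0 : windowDot g n₁ n₂ n₃ i = 0) (h2 : windowDot g n₁ n₂ n₃ (i + 2) = 0) :
    windowDot g n₁ n₂ n₃ (i + 1) = 0 := by
  by_contra hc
  apply hne
  unfold windowDet at hD
  unfold windowDot at h0 h2 hc
  simp only [add_assoc, Nat.reduceAdd] at h0 h2 hc
  refine ⟨?_, ?_, ?_⟩ <;> refine sub_eq_zero.mp ((mul_eq_zero.mp ?_).resolve_left hc)
  · linear_combination n₁ * hD - (g (i + 2) * g (i + 2) - g (i + 1) * g (i + 3)) * h0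
      - (g (i + 1) * g (i + 1) - g i * g (i + 2)) * h2
  · linear_combination n₂ * hD - (g (i + 4) * g (i + 1) - g (i + 3) * g (i + 2)) * h0
      - (g i * g (i + 3) - g (i + 2) * g (i + 1)) * h2
  · linear_combination n₃ * hD - (g (i + 3) * g (i + 3) - g (i + 2) * g (i + 4)) * h0
      - (g (i + 2) * g (i + 2) - g (i + 1) * g (i + 3)) * h2

namespace ToeplitzData

variable {F : Type*} [Field F] {d : ℕ} {g φ ε : ℕ → F}

theorem windowDot_add_two (h : ToeplitzData d g φ ε) {r : F} (hr : r ≠ 0)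
    (hφ : ∀ n ≤ d, φ (n + 1) = φ 1 + r * φ n) {n₁ n₂ n₃ : F} {i : ℕ} (hi : i + 1 ≤ d)
    (hD : windowDet g i = 0) (h0 : windowDot g n₁ n₂ n₃ i = 0)
    (h1 : windowDot g n₁ n₂ n₃ (i + 1) = 0) : windowDot g n₁ n₂ n₃ (i + 2) = 0 := by
  refine windowDot_add_two_of_windowDet hD ?_ h0 h1
  rintro ⟨x, y, z⟩
  have a := h.rec_zero (n := i) (by omega)
  have b := h.rec_zero (n := i + 1) (by omega)
  simp only [add_assoc, Nat.reduceAdd] at a b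
  have h2 : g (i + 2) = 0 := by
    have : (φ i - φ (i + 1)) * g (i + 2) ^ 2 = 0 := by
      linear_combination g (i + 2) * a - g (i + 1) * b - ε 0 * x - φ (i + 1) * z
    exact pow_eq_zero_iff two_ne_zero |>.mp ((mul_eq_zero.mp this).resolve_left
      (sub_ne_zero.mpr (h.phi_ne_of_lt hr hφ (Nat.lt_succ_self i) hi)))
  have h1 : g (i + 1) = 0 := by simpa [h2] using x
  exact h.g_ne_zero_succ (by omega) (by omega) h1 h2

theorem windowDot_add_one (h : ToeplitzData d g φ ε) {r : F} (hr : r ≠ 0)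
    (hφ : ∀ n ≤ d, φ (n + 1) = φ 1 + r * φ n) {n₁ n₂ n₃ : F} {i : ℕ} (hi : i + 2 ≤ d)
    (hD : windowDet g i = 0) (h0 : windowDot g n₁ n₂ n₃ i = 0)
    (h2 : windowDot g n₁ n₂ n₃ (i + 2) = 0) : windowDot g n₁ n₂ n₃ (i + 1) = 0 := by
  refine windowDot_add_one_of_windowDet hD ?_ h0 h2
  rintro ⟨x, y, z⟩
  have a := h.rec_zero (n := i) (by omega)
  have b := h.rec_zero (n := i + 2) (by omega)
  simp only [add_assoc, Nat.reduceAdd] at a b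
  have h2 : g (i + 2) = 0 := by
    have : (φ (i + 2) - φ i) * g (i + 2) ^ 2 = 0 := by
      linear_combination g i * b - g (i + 2) * a + φ (i + 2) * y + φ 1 * x
    exact pow_eq_zero_iff two_ne_zero |>.mp ((mul_eq_zero.mp this).resolve_left
      (sub_ne_zero.mpr (h.phi_ne_of_lt hr hφ (by omega) hi).symm))
  have h1 : g (i + 1) ≠ 0 := fun h1 => h.g_ne_zero_succ (by omega) (by omega) h1 h2
  have h3 : g (i + 3) ≠ 0 := h.g_ne_zero_succ (n := i + 2) (by omega) (by omega) h2
  have h0 : g i = 0 := by simpa [h2, h3] using x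
  rw [h2, h0] at a
  exact mul_ne_zero h.phi_one_ne h1 (by linear_combination -a)

theorem windowDet_succ_ne_zero (h : ToeplitzData d g φ ε) {r : F} (hr : r ≠ 0)
    (hφ : ∀ n ≤ d, φ (n + 1) = φ 1 + r * φ n) {i : ℕ} (hi : i + 3 ≤ d)
    (h0 : windowDet g i = 0) : windowDet g (i + 1) ≠ 0 := by
  intro h1
  refine windowDet_ne_zero_of_forall (g := g) (i := i) (fun n₁ n₂ n₃ a b c => ?_) h0
  have e := h.windowDot_add_two hr hφ (by omega) h1 b c
  exact h.eq_zero_of_three_pairs hr hφ (i := i) (j := i + 1) (k := i + 2) (by omega) (by omega)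
    (by omega) a b b c c e

theorem eq_zero_of_windowDot (h : ToeplitzData d g φ ε) {r : F} (hr : r ≠ 0)
    (hφ : ∀ n ≤ d, φ (n + 1) = φ 1 + r * φ n) {n₁ n₂ n₃ : F}
    (hn : ∀ j, j + 2 ≤ d → (windowDet g (j + 1) ≠ 0 ∨ j + 2 = d) → windowDot g n₁ n₂ n₃ j = 0)
    (hlow : d = 4 ∨ d = 5 → windowDet g 1 ≠ 0) {i : ℕ} (hi : i + 3 ≤ d)
    (hD : windowDet g (i + 1) = 0) : n₁ = 0 ∧ n₂ = 0 ∧ n₃ = 0 := by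
  have hlt : ∀ j, j + 3 ≤ d → windowDet g (j + 1) = 0 → j + 4 ≤ d := by
    intro j hj h0
    by_contra hc
    have := h.det_last
    rw [show d - 2 = j + 1 by omega] at this
    exact this h0
  have hthree : ∀ j, j + 3 ≤ d → windowDet g (j + 1) = 0 → windowDot g n₁ n₂ n₃ (j + 1) = 0 ∧
      windowDot g n₁ n₂ n₃ (j + 2) = 0 ∧ windowDot g n₁ n₂ n₃ (j + 3) = 0 := by
    intro j hj h0
    have hj' := hlt j hj h0
    have a : windowDot g n₁ n₂ n₃ (j + 1) = 0 :=
      hn _ (by omega) (Or.inl (h.windowDet_succ_ne_zero hr hφ (by omega) h0))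
    by_cases hD3 : windowDet g (j + 3) = 0 ∧ j + 5 ≤ d
    · have hj5 := hlt (j + 2) (by omega) hD3.1
      have c : windowDot g n₁ n₂ n₃ (j + 3) = 0 :=
        hn _ (by omega) (Or.inl (h.windowDet_succ_ne_zero hr hφ (by omega) hD3.1))
      exact ⟨a, h.windowDot_add_one hr hφ (by omega) h0 a c, c⟩
    · have b : windowDot g n₁ n₂ n₃ (j + 2) = 0 := by
        refine hn _ (by omega) ?_
        by_cases h5 : j + 5 ≤ d
        · exact Or.inl fun h' => hD3 ⟨h', h5⟩
        · exact Or.inr (by omega)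
      exact ⟨a, b, h.windowDot_add_two hr hφ (by omega) h0 a b⟩
  have htwo : (∃ j k, j < k ∧ k + 3 ≤ d ∧ windowDet g (j + 1) = 0 ∧ windowDet g (k + 1) = 0) →
      n₁ = 0 ∧ n₂ = 0 ∧ n₃ = 0 := by
    rintro ⟨j, k, hjk, hk, hj0, hk0⟩
    have hjk' : j + 2 ≤ k := by
      by_contra hc
      obtain rfl : k = j + 1 := by omega
      exact h.windowDet_succ_ne_zero hr hφ (by omega) hj0 hk0
    obtain ⟨a, b, c⟩ := hthree j (by omega) hj0
    obtain ⟨a', b', -⟩ := hthree k hk hk0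
    exact h.eq_zero_of_three_pairs hr hφ (i := j + 1) (j := j + 2) (k := k + 1) (by omega)
      (by omega) (by omega) a b b c a' b'
  by_cases hex : ∃ j k, j < k ∧ k + 3 ≤ d ∧ windowDet g (j + 1) = 0 ∧ windowDet g (k + 1) = 0
  · exact htwo hex
  have hi4 := hlt i hi hD
  have hother : ∀ j, j + 2 ≤ d → j ≠ i → windowDot g n₁ n₂ n₃ j = 0 := by
    intro j hj hji
    refine hn j hj ?_
    by_cases hj3 : j + 3 ≤ d
    · refine Or.inl fun h0 => hex ?_
      rcases lt_or_gt_of_ne hji with hlt | hlt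
      · exact ⟨j, i, hlt, hi, h0, hD⟩
      · exact ⟨i, j, hlt, hj3, hD, h0⟩
    · exact Or.inr (by omega)
  obtain ⟨a, b, c⟩ := hthree i hi hD
  match i with
  | 0 =>
    have hd6 : 6 ≤ d := by
      by_contra hc
      exact hlow (by omega) hD
    exact h.eq_zero_of_three_pairs hr hφ (i := 1) (j := 2) (k := 3) (by omega) (by omega)
      (by omega) a b b c c (hother 4 (by omega) (by omega))
  | 1 =>
    have e := hother 0 (by omega) (by omega)
    unfold windowDot at a b c e
    simp only [Nat.reduceAdd, zero_add, h.g_zero, h.g_one, h.g_two, h.g_three] at a b c e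
    have h1 : n₁ = 0 := by linear_combination e
    subst h1
    have h3 : n₃ = -n₂ := by linear_combination a
    subst h3
    by_cases h2 : n₂ = 0
    · simp [h2]
    have g4 : g 4 = 1 := mul_left_cancel₀ h2 (by linear_combination b)
    have g5 : g 5 = 1 := mul_left_cancel₀ h2 (by linear_combination c + n₂ * g4)
    have r2 := h.rec_zero (n := 2) (by omega)
    have r3 := h.rec_zero (n := 3) (by omega)
    simp only [Nat.reduceAdd, g4, g5, h.g_two, h.g_three] at r2 r3
    exact absurd (by linear_combination r2 - r3)
      (h.phi_ne_of_lt hr hφ (show 2 < 3 by omega) (by omega))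
  | i + 2 =>
    exact h.eq_zero_of_three_pairs hr hφ (i := 0) (j := i + 3) (k := i + 4) (by omega) (by omega)
      (by omega) (hother 0 (by omega) (by omega)) (hother 1 (by omega) (by omega)) a b b c

end ToeplitzData

theorem fifth_root_inconsistent {F : Type*} [Field F] {r τ x y z : F} (hr : r ≠ 0)
    (h5 : 1 + r + r ^ 2 + r ^ 3 + r ^ 4 = 0) (h2 : (1 + r) * x = 1 + τ)
    (h3 : (1 + r + r ^ 2) * y = x + τ) (h4 : (1 + r + r ^ 2 + r ^ 3) * z = y + τ * x)
    (hz : z + τ * y = 0) : 1 - 2 * x + y ≠ 0 := by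
  intro hD
  have hτ : τ * (1 + 2 * r) = r ^ 2 := by
    refine mul_left_cancel₀ hr ?_
    linear_combination (-(1 + r) * (1 + r + r ^ 2)) * hD + (1 + r) * h3
      - (2 * (1 + r + r ^ 2) - 1) * h2
  have hend : (1 + τ + τ * (1 + r)) * (1 + (1 + r + r ^ 2 + r ^ 3) * τ)
      + (1 + r + r ^ 2) * τ * (1 + τ) = 0 := by
    linear_combination (1 + r) * (1 + r + r ^ 2) * (1 + r + r ^ 2 + r ^ 3) * hz
      - (1 + r) * (1 + r + r ^ 2) * h4 - (1 + r) * (1 + (1 + r + r ^ 2 + r ^ 3) * τ) * h3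
      - (1 + (1 + r + r ^ 2 + r ^ 3) * τ + (1 + r + r ^ 2) * τ) * h2
  have hclear : ∀ T, T = τ * (1 + 2 * r) →
      (1 + 2 * r + T * (2 + r)) * (1 + 2 * r + (1 + r + r ^ 2 + r ^ 3) * T)
      + (1 + r + r ^ 2) * T * (1 + 2 * r + T) = 0 := by
    rintro _ rfl
    linear_combination (1 + 2 * r) ^ 2 * hend
  have hpoly : r * (2 + 3 * r + 2 * r ^ 2) * (1 + r ^ 2) = 0 := by
    linear_combination hclear (r ^ 2) hτ.symm - (1 + r + 3 * r ^ 2 + 2 * r ^ 3 + r ^ 4) * h5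
  have hr3 : r ^ 3 = 0 := by
    linear_combination (-(-2 + r - 2 * r ^ 2) * (-r - r ^ 2)) * hpoly
      + r * (r ^ 2 - 4 + 4 * (1 + r + r ^ 2 + r ^ 3 + r ^ 4)) * h5
  exact hr (pow_eq_zero_iff three_ne_zero |>.mp hr3)

theorem sixth_root_inconsistent {F : Type*} [Field F] {r τ x y z u : F} (hr : r ≠ 0)
    (hr2 : 1 + r ≠ 0) (hr3 : 1 + r + r ^ 2 ≠ 0) (hr4 : 1 + r + r ^ 2 + r ^ 3 ≠ 0)
    (h6 : 1 + r + r ^ 2 + r ^ 3 + r ^ 4 + r ^ 5 = 0) (h2 : (1 + r) * x = 1 + τ)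
    (h3 : (1 + r + r ^ 2) * y = x + τ) (h4 : (1 + r + r ^ 2 + r ^ 3) * z = y + τ * x)
    (h5 : (1 + r + r ^ 2 + r ^ 3 + r ^ 4) * u = z + τ * y)
    (hu : u + τ * z = 0) : 1 - 2 * x + y ≠ 0 := by
  intro hD
  have hτ : τ * (1 + 2 * r) = r ^ 2 := by
    refine mul_left_cancel₀ hr ?_
    linear_combination (-(1 + r) * (1 + r + r ^ 2)) * hD + (1 + r) * h3
      - (2 * (1 + r + r ^ 2) - 1) * h2
  have hq : r ^ 2 = r - 1 := by
    have := mul_ne_zero hr2 hr3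
    refine mul_left_cancel₀ this ?_
    linear_combination h6
  obtain ⟨a, ha⟩ : ∃ a, a = 1 + r + r ^ 2 + r ^ 3 := ⟨_, rfl⟩
  obtain ⟨b, hb⟩ : ∃ b, b = 1 + r + r ^ 2 + r ^ 3 + r ^ 4 := ⟨_, rfl⟩
  have hend : (1 + τ + τ * (1 + r)) * (1 + b * τ + a * τ)
      + (1 + r + r ^ 2) * τ * (1 + τ) * (1 + b * τ) = 0 := by
    rw [← ha] at h4
    rw [← hb] at h5
    linear_combination (1 + r) * (1 + r + r ^ 2) * a * b * hu
      - (1 + r) * (1 + r + r ^ 2) * a * h5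
      - (1 + r) * (1 + r + r ^ 2) * (1 + b * τ) * h4
      - (1 + r) * (1 + b * τ + a * τ) * h3
      - (1 + b * τ + a * τ + (1 + r + r ^ 2) * τ * (1 + b * τ)) * h2
  have hclear : ∀ T, T = τ * (1 + 2 * r) →
      (1 + 2 * r + T * (2 + r)) * (1 + 2 * r + T * (b + a)) * (1 + 2 * r)
      + (1 + r + r ^ 2) * T * (1 + 2 * r + T) * (1 + 2 * r + T * b) = 0 := by
    rintro _ rfl
    linear_combination (1 + 2 * r) ^ 3 * hend
  have ha' : a = 2 * r - 1 := by
    rw [ha]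
    linear_combination (r + 2) * hq
  have hb' : b = r - 1 := by
    rw [hb]
    linear_combination (r ^ 2 + 2 * r + 2) * hq
  have hpoly := hclear (r ^ 2) hτ.symm
  rw [ha', hb', hq] at hpoly
  have h2' : (2 : F) ≠ 0 := by
    intro h0
    apply hr3
    linear_combination hq + r * h0
  have h1 : 2 * r - 1 ≠ 0 := ha' ▸ ha ▸ hr4
  have h3' : (3 : F) ≠ 0 := by
    intro h0
    refine h1 (pow_eq_zero_iff two_ne_zero |>.mp ?_)
    linear_combination 4 * hq - h0
  refine mul_ne_zero (mul_ne_zero h2' h3') h1 ?_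
  linear_combination (6 * (r ^ 3 + r - 1)
    + 3 * (1 + 2 * r + (r - 1) * (2 + r)) * (1 + 2 * r)) * hq - hpoly

namespace ToeplitzData

variable {F : Type*} [Field F] {d : ℕ} {g φ ε : ℕ → F}

theorem windowDet_one_ne_zero (h : ToeplitzData d g φ ε) {r : F} (hr : r ≠ 0)
    (hφ : ∀ n ≤ d, φ (n + 1) = φ 1 + r * φ n) (hd : d = 4 ∨ d = 5) : windowDet g 1 ≠ 0 := by
  have hs := h.phi_one_ne
  obtain ⟨τ, hτ⟩ : ∃ τ, ε 0 = φ 1 * τ := ⟨ε 0 / φ 1, by field_simp⟩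
  have p2 : φ 2 = φ 1 * (1 + r) := by rw [hφ 1 (by omega)]; ring
  have p3 : φ 3 = φ 1 * (1 + r + r ^ 2) := by rw [hφ 2 (by omega), p2]; ring
  have p4 : φ 4 = φ 1 * (1 + r + r ^ 2 + r ^ 3) := by rw [hφ 3 (by omega), p3]; ring
  have p5 : φ 5 = φ 1 * (1 + r + r ^ 2 + r ^ 3 + r ^ 4) := by rw [hφ 4 (by omega), p4]; ring
  have e2 := h.rec_zero (n := 2) (by omega)
  have e3 := h.rec_zero (n := 3) (by omega)
  have e4 := h.rec_zero (n := 4) (by omega)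
  have e5 := h.rec_zero (n := 5) (by omega)
  simp only [Nat.reduceAdd, h.g_two, h.g_three, hτ] at e2 e3 e4 e5
  have hdet : windowDet g 1 = 1 - 2 * g 4 + g 5 := by
    simp only [windowDet, Nat.reduceAdd, h.g_one, h.g_two, h.g_three]
    ring
  rw [hdet]
  have f2 : (1 + r) * g 4 = 1 + τ :=
    mul_left_cancel₀ hs (by linear_combination e2 - p2 * g 4)
  have f3 : (1 + r + r ^ 2) * g 5 = g 4 + τ :=
    mul_left_cancel₀ hs (by linear_combination e3 - p3 * g 5)
  have f4 : (1 + r + r ^ 2 + r ^ 3) * g 6 = g 5 + τ * g 4 :=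
    mul_left_cancel₀ hs (by linear_combination e4 - p4 * g 6)
  rcases hd with rfl | rfl
  · have h0 : φ 5 = 0 := h.phi_last
    refine fifth_root_inconsistent hr ?_ f2 f3 f4 ?_
    · exact (mul_eq_zero.mp (p5.symm.trans h0)).resolve_left hs
    · refine (mul_eq_zero.mp ?_).resolve_left hs
      rw [h0] at e5
      linear_combination -e5
  · have h0 : φ 6 = 0 := h.phi_last
    have p6 : φ 6 = φ 1 * (1 + r + r ^ 2 + r ^ 3 + r ^ 4 + r ^ 5) := by
      rw [hφ 5 (by omega), p5]; ring
    have e6 := h.rec_zero (n := 6) (by omega)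
    simp only [Nat.reduceAdd, hτ, h0] at e6
    have n2 := h.phi_ne 2 (by omega) (by omega)
    have n3 := h.phi_ne 3 (by omega) (by omega)
    have n4 := h.phi_ne 4 (by omega) (by omega)
    rw [p2] at n2
    rw [p3] at n3
    rw [p4] at n4
    refine sixth_root_inconsistent hr (right_ne_zero_of_mul n2) (right_ne_zero_of_mul n3)
      (right_ne_zero_of_mul n4) ?_ f2 f3 f4 (u := g 7) ?_ ?_
    · exact (mul_eq_zero.mp (p6.symm.trans h0)).resolve_left hs
    · exact mul_left_cancel₀ hs (by linear_combination e5 - p5 * g 7)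
    · refine (mul_eq_zero.mp ?_).resolve_left hs
      linear_combination -e6

/-- The entries of a map that is tridiagonal in both bases of the Toeplitz system vanish as soon
as seven of them do. -/
theorem entries_eq_zero (h : ToeplitzData d g φ ε) {a b c p q r : ℕ → F}
    (hE : ∀ k j, k ≤ d → k + j ≤ d + 1 → (a (k + j) - p k) * g (j + 2)
      + (b (k + j - 1) - q k) * g (j + 1) + (c (k + j - 2) - r k) * g j = 0)
    (ha : a (d + 1) = 0) (hp : p 0 = 0) (hb : b d = 0) (hc : c (d - 1) = 0) (hr0 : r 0 = 0)
    (hq1 : q 1 = 0) (hr1 : r 1 = 0) (hq2 : q 2 = 0) (hr2 : r 2 = 0) :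
    (∀ k, 1 ≤ k → k ≤ d → a k = 0) ∧ (∀ k ≤ d, b k = 0) ∧ ∀ k < d, c k = 0 := by
  have hd := h.two_le
  have hq0 : q 0 = 0 := by
    have := hE 0 (d + 1) (by omega) (by omega)
    rw [zero_add, ha, hp, show d + 1 - 1 = d by omega, hb, show d + 1 - 2 = d - 1 by omega, hc,
      hr0] at this
    exact (mul_eq_zero.mp (by linear_combination -this)).resolve_right h.g_last
  have hp1 : p 1 = 0 := by
    have := hE 1 d (by omega) (by omega)
    rw [show 1 + d = d + 1 by omega, ha, show d + 1 - 1 = d by omega, hb,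
      show d + 1 - 2 = d - 1 by omega, hc, hq1, hr1] at this
    exact (mul_eq_zero.mp (by linear_combination -this)).resolve_right h.g_last
  have hp2 : p 2 = 0 := by
    have := hE 2 (d - 1) (by omega) (by omega)
    rw [show 2 + (d - 1) = d + 1 by omega, ha, show d + 1 - 1 = d by omega, hb,
      show d + 1 - 2 = d - 1 by omega, hc, hq2, hr2, show d - 1 + 2 = d + 1 by omega] at this
    exact (mul_eq_zero.mp (by linear_combination -this)).resolve_right h.g_pred_last_ne
  have hdot : ∀ M, 2 ≤ M → M ≤ d → windowDot g (a M) (b (M - 1)) (c (M - 2)) M = 0 ∧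
      windowDot g (a M) (b (M - 1)) (c (M - 2)) (M - 1) = 0 ∧
      windowDot g (a M) (b (M - 1)) (c (M - 2)) (M - 2) = 0 := by
    intro M hM hMd
    have x0 := hE 0 M (by omega) (by omega)
    have x1 := hE 1 (M - 1) (by omega) (by omega)
    have x2 := hE 2 (M - 2) (by omega) (by omega)
    rw [show 1 + (M - 1) = M by omega] at x1
    rw [show 2 + (M - 2) = M by omega] at x2
    simp only [zero_add, hp, hq0, hr0, hp1, hq1, hr1, hp2, hq2, hr2, sub_zero] at x0 x1 x2
    exact ⟨x0, x1, x2⟩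
  have hzero : ∀ M, 2 ≤ M → M ≤ d → windowDet g (M - 2) ≠ 0 →
      a M = 0 ∧ b (M - 1) = 0 ∧ c (M - 2) = 0 := by
    intro M hM hMd hD
    obtain ⟨x0, x1, x2⟩ := hdot M hM hMd
    refine windowDot_eq_zero_of_windowDet_ne_zero hD x2 ?_ ?_
    · rwa [show M - 2 + 1 = M - 1 by omega]
    · rwa [show M - 2 + 2 = M by omega]
  have hdet0 : windowDet g 0 ≠ 0 := by
    simp [windowDet, h.g_zero, h.g_one, h.g_two]
  have hall : ∀ M, 2 ≤ M → M ≤ d → a M = 0 ∧ b (M - 1) = 0 ∧ c (M - 2) = 0 := by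
    by_cases hD : ∀ i ≤ d - 2, windowDet g i ≠ 0
    · exact fun M hM hMd => hzero M hM hMd (hD _ (by omega))
    push Not at hD
    obtain ⟨i, hi, hDi⟩ := hD
    have hi0 : i ≠ 0 := by rintro rfl; exact hdet0 hDi
    have hid : i ≠ d - 2 := by rintro rfl; exact h.det_last hDi
    have hd4 : 4 ≤ d := by omega
    have hH : stepDet φ 0 = 0 := by
      by_contra hH
      exact h.windowDet_ne_zero_of_stepDet hd4 hH hi hDi
    obtain ⟨ρ, hρ, hφ⟩ := h.exists_ratio hd4 hH
    have hz : p 3 = 0 ∧ q 3 = 0 ∧ r 3 = 0 := by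
      refine h.eq_zero_of_windowDot hρ hφ (i := i - 1) ?_ (h.windowDet_one_ne_zero hρ hφ)
        (by omega) (by rwa [show i - 1 + 1 = i by omega])
      intro j hj hj'
      have hx := hE 3 j (by omega) (by omega)
      have hy : a (3 + j) = 0 ∧ b (3 + j - 1) = 0 ∧ c (3 + j - 2) = 0 := by
        by_cases hjd : j + 2 = d
        · rw [show 3 + j = d + 1 by omega]
          exact ⟨ha, hb, hc⟩
        · refine hzero (3 + j) (by omega) (by omega) ?_
          rw [show 3 + j - 2 = j + 1 by omega]
          exact hj'.resolve_right hjd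
      rw [hy.1, hy.2.1, hy.2.2] at hx
      unfold windowDot
      linear_combination -hx
    intro M hM hMd
    rcases hM.eq_or_lt with rfl | hM3
    · exact hzero 2 le_rfl hMd hdet0
    obtain ⟨x0, x1, x2⟩ := hdot M hM hMd
    have x3 := hE 3 (M - 3) (by omega) (by omega)
    rw [show 3 + (M - 3) = M by omega, hz.1, hz.2.1, hz.2.2] at x3
    simp only [sub_zero] at x3
    refine h.eq_zero_of_three_pairs hρ hφ (i := M - 3) (j := M - 2) (k := M - 1) (by omega)
      (by omega) (by omega) x3 ?_ x2 ?_ x1 ?_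
    · rwa [show M - 3 + 1 = M - 2 by omega]
    · rwa [show M - 2 + 1 = M - 1 by omega]
    · rwa [show M - 1 + 1 = M by omega]
  have ha1 : a 1 = 0 := by
    have := hE 1 0 (by omega) (by omega)
    simpa [h.g_two, h.g_one, h.g_zero, hp1] using this
  have hb0 : b 0 = 0 := by
    have := hE 0 1 (by omega) (by omega)
    simpa [h.g_two, h.g_one, h.g_three, ha1, hp, hq0] using this
  refine ⟨fun k hk hkd => ?_, fun k hkd => ?_, fun k hkd => ?_⟩
  · rcases hk.eq_or_lt with rfl | hk
    · exact ha1
    · exact (hall k hk hkd).1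
  · rcases Nat.eq_zero_or_pos k with rfl | hk
    · exact hb0
    rcases hkd.eq_or_lt with rfl | hkd
    · exact hb
    · simpa using (hall (k + 1) (by omega) (by omega)).2.1
  · rcases Nat.lt_or_ge (k + 1) d with hk | hk
    · simpa using (hall (k + 2) (by omega) (by omega)).2.2
    · rw [show k = d - 1 by omega]
      exact hc

end ToeplitzData

/-- The decomposition with its components in the reverse order. -/
def LRDecomp.rev {d : ℕ} (D : LRDecomp F V d) : LRDecomp F V d where
  sub i := if i ≤ d then D.sub (d - i) else ⊥
  finrank_eq_one i hi := by
    rw [if_pos hi]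
    exact D.finrank_eq_one _ (Nat.sub_le d i)
  eq_bot_of_gt i hi := by simp [Nat.not_le.mpr hi]
  isInternal := by
    have h := (DirectSum.isInternal_submodule_iff_iSupIndep_and_iSup_eq_top _).mp D.isInternal
    have he : (fun i : Fin (d + 1) => if i.val ≤ d then D.sub (d - i.val) else ⊥) =
        (fun i : Fin (d + 1) => D.sub i.val) ∘ Fin.revPerm := by
      funext i
      have hi : i.val ≤ d := by omega
      simp [hi, Fin.val_rev]
    rw [he, DirectSum.isInternal_submodule_iff_iSupIndep_and_iSup_eq_top]
    refine ⟨h.1.comp Fin.revPerm.injective, ?_⟩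
    rw [← h.2]
    exact Fin.revPerm.iSup_comp (g := fun i : Fin (d + 1) => D.sub i.val)

theorem LRDecomp.rev_sub {d : ℕ} (D : LRDecomp F V d) {i : ℕ} (hi : i ≤ d) :
    D.rev.sub i = D.sub (d - i) := if_pos hi

theorem IsLRPairWith.rev {d : ℕ} {A B : Module.End F V} {D : LRDecomp F V d}
    (h : IsLRPairWith A B D) : IsLRPairWith B A D.rev := by
  obtain ⟨⟨h0, hl⟩, hr⟩ := h
  refine ⟨⟨?_, fun i hi => ?_⟩, fun i hi => ?_⟩
  · rw [D.rev_sub (Nat.zero_le d), Nat.sub_zero, hr d le_rfl, D.eq_bot_of_gt _ (Nat.lt_succ_self d)]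
  · rw [D.rev_sub hi.le, D.rev_sub hi, hr _ (by omega), show d - (i + 1) + 1 = d - i by omega]
  · rcases hi.eq_or_lt with rfl | hi'
    · rw [D.rev_sub le_rfl, Nat.sub_self, h0, D.rev.eq_bot_of_gt _ (Nat.lt_succ_self i)]
    · rw [D.rev_sub hi, D.rev_sub hi', ← hl _ (show d - (i + 1) < d by omega),
        show d - (i + 1) + 1 = d - i by omega]

theorem IsLRBasisRev.isLRBasisFor {d : ℕ} {A : Module.End F V} {D : LRDecomp F V d} {v : ℕ → V}
    (h : IsLRBasisRev A D v) : IsLRBasisFor A D.rev v :=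
  ⟨fun i hi => by rw [D.rev_sub hi]; exact h.1 i hi, h.2⟩

theorem IsTridiagonal.rev {d : ℕ} {X : Module.End F V} {D : LRDecomp F V d}
    (h : IsTridiagonal X D) : IsTridiagonal X D.rev := by
  intro i v hv
  rcases Nat.lt_or_ge d i with hi | hi
  · rw [D.rev.eq_bot_of_gt i hi, Submodule.mem_bot] at hv
    simp [hv]
  have hmid : D.sub (d - i) ≤ D.rev.sub (i - 1) ⊔ D.rev.sub i ⊔ D.rev.sub (i + 1) := by
    rw [← D.rev_sub hi]
    exact le_sup_of_le_left le_sup_right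
  rw [D.rev_sub hi] at hv
  refine sup_le (sup_le ?_ hmid) ?_ (h _ v hv)
  · rcases hi.eq_or_lt with rfl | hi'
    · simpa using hmid
    · rw [show d - i - 1 = d - (i + 1) by omega, ← D.rev_sub hi']
      exact le_sup_right
  · rcases Nat.eq_zero_or_pos i with rfl | hi0
    · rw [D.eq_bot_of_gt _ (by omega)]
      exact bot_le
    · rw [show d - i + 1 = d - (i - 1) by omega, ← D.rev_sub (show i - 1 ≤ d by omega)]
      exact le_sup_of_le_left le_sup_left

/-- Coordinate functionals for a basis `v` adapted to a decomposition lowered by `P` and raised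
by `Q`, with `P (v i) = v (i - 1)` and `Q (v i) = γ i • v (i + 1)`; they vanish beyond `d`. -/
structure ShiftCoords {d : ℕ} (D : LRDecomp F V d) (P Q : Module.End F V) (v : ℕ → V)
    (x : ℕ → V →ₗ[F] F) (γ : ℕ → F) : Prop where
  apply : ∀ i j, j ≤ d → x i (v j) = if i = j then 1 else 0
  eq_zero_of_gt : ∀ i, d < i → x i = 0
  sum_smul : ∀ y, ∑ i ∈ Finset.range (d + 1), x i y • v i = y
  lower : ∀ i y, x i (P y) = x (i + 1) y
  raise : ∀ i y, x (i + 1) (Q y) = γ i * x i y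
  raise_zero : ∀ y, x 0 (Q y) = 0
  ne_zero : ∀ i < d, γ i ≠ 0
  tridiagonal : ∀ X, IsTridiagonal X D → ∀ i j, j ≤ d → j + 1 < i ∨ i + 1 < j → x i (X (v j)) = 0

theorem exists_shiftCoords [FiniteDimensional F V] {d : ℕ} (hdim : Module.finrank F V = d + 1)
    {D : LRDecomp F V d} {P Q : Module.End F V} (hPQ : IsLRPairWith P Q D) {v : ℕ → V}
    (hv : IsLRBasisFor P D v) : ∃ x γ, ShiftCoords D P Q v x γ := by
  obtain ⟨⟨h0, hl⟩, hr⟩ := hPQ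
  have hli : LinearIndependent F (fun i : Fin (d + 1) => v i.val) :=
    iSupIndep.linearIndependent (fun i : Fin (d + 1) => D.sub i.val)
      D.isInternal.submodule_iSupIndep (fun i => (hv.1 i.val (by omega)).1)
      (fun i => (hv.1 i.val (by omega)).2)
  let b := basisOfLinearIndependentOfCardEqFinrank hli (by simp [hdim])
  have hb : ∀ i : Fin (d + 1), b i = v i.val := fun i => by
    simp [b]
  let x : ℕ → V →ₗ[F] F := fun i => if h : i < d + 1 then b.coord ⟨i, h⟩ else 0
  have happly : ∀ i j, j ≤ d → x i (v j) = if i = j then 1 else 0 := by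
    intro i j hj
    have hj' := hb ⟨j, by omega⟩
    simp only at hj'
    by_cases hi : i < d + 1
    · simp only [x, hi, dif_pos, ← hj', Module.Basis.coord_apply, Module.Basis.repr_self,
        Finsupp.single_apply, Fin.mk.injEq, eq_comm]
    · simp only [x, hi, dif_neg, not_false_eq_true, LinearMap.zero_apply]
      rw [if_neg (by omega)]
  have hgt : ∀ i, d < i → x i = 0 := fun i hi => dif_neg (by omega)
  have hsum : ∀ y, ∑ i ∈ Finset.range (d + 1), x i y • v i = y := by
    intro y
    rw [Finset.sum_range]
    conv_rhs => rw [← b.sum_repr y]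
    refine Finset.sum_congr rfl fun i _ => ?_
    have hi : i.val < d + 1 := i.isLt
    simp only [x, hi, dif_pos, hb, Module.Basis.coord_apply]
  have hspan : ∀ j ≤ d, ∀ y ∈ D.sub j, ∃ c : F, y = c • v j := by
    intro j hj y hy
    obtain ⟨hm, hne⟩ := hv.1 j hj
    obtain ⟨c, hc⟩ := (finrank_eq_one_iff_of_nonzero' (⟨v j, hm⟩ : D.sub j)
      (by simpa using hne)).mp (D.finrank_eq_one j hj) ⟨y, hy⟩
    exact ⟨c, by simpa using (congrArg Subtype.val hc).symm⟩
  have hmem : ∀ i j, i ≠ j → ∀ y ∈ D.sub j, x i y = 0 := by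
    intro i j hij y hy
    rcases Nat.lt_or_ge d j with hj | hj
    · rw [D.eq_bot_of_gt j hj, Submodule.mem_bot] at hy
      simp [hy]
    · obtain ⟨c, rfl⟩ := hspan j hj y hy
      simp [happly i j hj, hij]
  have hext : ∀ f f' : V →ₗ[F] F, (∀ j ≤ d, f (v j) = f' (v j)) → f = f' := by
    intro f f' h
    refine b.ext fun i => ?_
    rw [hb]
    exact h _ (by omega)
  have hQmem : ∀ j ≤ d, Q (v j) ∈ D.sub (j + 1) := fun j hj => by
    rw [← hr j hj]
    exact Submodule.mem_map_of_mem (hv.1 j hj).1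
  refine ⟨x, fun i => x (i + 1) (Q (v i)), happly, hgt, hsum, ?_, ?_, ?_, ?_, ?_⟩
  · intro i
    refine DFunLike.congr_fun (f := x i ∘ₗ P) (g := x (i + 1)) (hext _ _ fun j hj => ?_)
    rw [LinearMap.comp_apply, happly _ _ hj]
    rcases Nat.eq_zero_or_pos j with rfl | hj0
    · have : P (v 0) ∈ Submodule.map P (D.sub 0) := Submodule.mem_map_of_mem (hv.1 0 hj).1
      rw [h0, Submodule.mem_bot] at this
      simp [this]
    · rw [hv.2 j hj0 hj, happly _ _ (by omega)]
      congr 1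
      simp only [eq_iff_iff]
      omega
  · intro i
    refine DFunLike.congr_fun (f := x (i + 1) ∘ₗ Q) (g := x (i + 1) (Q (v i)) • x i)
      (hext _ _ fun j hj => ?_)
    rw [LinearMap.comp_apply, LinearMap.smul_apply, happly _ _ hj]
    by_cases hij : i = j
    · simp [hij]
    · simp [hij, hmem (i + 1) (j + 1) (by omega) _ (hQmem j hj)]
  · refine DFunLike.congr_fun (f := x 0 ∘ₗ Q) (g := 0) (hext _ _ fun j hj => ?_)
    exact hmem 0 (j + 1) (by omega) _ (hQmem j hj)
  · intro i hi h
    have hz : Q (v i) = 0 := by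
      obtain ⟨c, hc⟩ := hspan (i + 1) hi _ (hQmem i hi.le)
      rw [hc, map_smul, happly _ _ hi] at h
      rw [hc, show c = 0 by simpa using h, zero_smul]
    have hbot : D.sub (i + 1) = ⊥ := by
      rw [← hr i hi.le, eq_bot_iff]
      rintro _ ⟨y, hy, rfl⟩
      obtain ⟨c, rfl⟩ := hspan i hi.le y hy
      simp [hz]
    have := D.finrank_eq_one (i + 1) hi
    rw [hbot, finrank_bot] at this
    exact zero_ne_one this
  · intro X hX i j hj hij
    obtain ⟨y, hy, z, hz, hyz⟩ := Submodule.mem_sup.mp (hX j (v j) (hv.1 j hj).1)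
    obtain ⟨y₁, hy₁, y₂, hy₂, rfl⟩ := Submodule.mem_sup.mp hy
    rw [← hyz, map_add, map_add, hmem i _ (by omega) _ hy₁, hmem i _ (by omega) _ hy₂,
      hmem i _ (by omega) _ hz]
    simp

namespace ShiftCoords

variable {d : ℕ} {D : LRDecomp F V d} {P Q : Module.End F V} {v : ℕ → V} {x : ℕ → V →ₗ[F] F}
  {γ : ℕ → F}

theorem eq_zero (h : ShiftCoords D P Q v x γ) {y : V} (hy : ∀ i ≤ d, x i y = 0) : y = 0 := by
  rw [← h.sum_smul y]
  refine Finset.sum_eq_zero fun i hi => ?_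
  rw [hy i (by simpa [Nat.lt_succ_iff] using hi), zero_smul]

theorem lower_pow (h : ShiftCoords D P Q v x γ) (m i : ℕ) (y : V) :
    x i ((P ^ m) y) = x (i + m) y := by
  induction m generalizing y with
  | zero => simp
  | succ m ih => rw [pow_succ, Module.End.mul_apply, ih, h.lower, add_assoc]

theorem lower_pow_eq_zero_iff (h : ShiftCoords D P Q v x γ) {m : ℕ} {y : V} :
    (P ^ m) y = 0 ↔ ∀ i, m ≤ i → x i y = 0 := by
  constructor
  · intro hy i hi
    have := h.lower_pow m (i - m) y
    rw [hy, map_zero, Nat.sub_add_cancel hi] at this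
    exact this.symm
  · intro hy
    refine h.eq_zero fun i _ => ?_
    rw [h.lower_pow, hy _ (Nat.le_add_left m i)]

theorem raise_pow_eq_zero_iff (h : ShiftCoords D P Q v x γ) {m : ℕ} {y : V} :
    (Q ^ m) y = 0 ↔ ∀ i, i + m ≤ d → x i y = 0 := by
  induction m generalizing y with
  | zero =>
    refine ⟨fun hy i _ => by simp [show y = 0 by simpa using hy], fun hy => ?_⟩
    simpa using h.eq_zero (y := y) hy
  | succ m ih =>
    rw [pow_succ, Module.End.mul_apply, ih]
    constructor
    · intro hy i hi
      have := hy (i + 1) (by omega)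
      rw [h.raise] at this
      exact (mul_eq_zero.mp this).resolve_left (h.ne_zero i (by omega))
    · intro hy i hi
      rcases i with _ | i
      · exact h.raise_zero y
      · rw [h.raise, hy i (by omega), mul_zero]

end ShiftCoords

/-- A basis `e 0, …, e d` with its coordinate functionals, both extended by zero. -/
structure DualFamily (d : ℕ) (e : ℕ → V) (x : ℕ → V →ₗ[F] F) : Prop where
  vec_eq_zero : ∀ i, d < i → e i = 0
  coord_eq_zero : ∀ i, d < i → x i = 0
  sum_smul : ∀ y, ∑ i ∈ Finset.range (d + 1), x i y • e i = y

/-- The values of `f` on `0, …, d` in the reverse order, extended by zero. -/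
def revSeq {M : Type*} [Zero M] (d : ℕ) (f : ℕ → M) (k : ℕ) : M :=
  if k ≤ d then f (d - k) else 0

theorem revSeq_of_le {M : Type*} [Zero M] {d k : ℕ} (f : ℕ → M) (hk : k ≤ d) :
    revSeq d f k = f (d - k) := if_pos hk

theorem revSeq_of_gt {M : Type*} [Zero M] {d k : ℕ} (f : ℕ → M) (hk : d < k) :
    revSeq d f k = 0 := if_neg (by omega)

theorem ShiftCoords.dualFamily {d : ℕ} {D : LRDecomp F V d} {P Q : Module.End F V} {v : ℕ → V}
    {x : ℕ → V →ₗ[F] F} {γ : ℕ → F} (h : ShiftCoords D P Q v x γ) :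
    DualFamily d (revSeq d v) (revSeq d x) where
  vec_eq_zero _ hi := revSeq_of_gt v hi
  coord_eq_zero _ hi := revSeq_of_gt x hi
  sum_smul y := by
    conv_rhs => rw [← h.sum_smul y, ← Finset.sum_range_reflect]
    refine Finset.sum_congr rfl fun i hi => ?_
    have hi : i ≤ d := by simpa [Nat.lt_succ_iff] using hi
    rw [revSeq_of_le _ hi, revSeq_of_le _ hi, Nat.add_sub_cancel]

/-- `X` is tridiagonal in the given basis. -/
def IsBandMap (d : ℕ) (e : ℕ → V) (x : ℕ → V →ₗ[F] F) (X : Module.End F V) : Prop :=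
  ∀ i j, i ≤ d → j ≤ d → j + 1 < i ∨ i + 1 < j → x i (X (e j)) = 0

theorem isBandMap_revSeq {d : ℕ} {v : ℕ → V} {x : ℕ → V →ₗ[F] F} {X : Module.End F V}
    (h : IsBandMap d v x X) : IsBandMap d (revSeq d v) (revSeq d x) X := by
  intro i j hi hj hij
  rw [revSeq_of_le _ hi, revSeq_of_le _ hj]
  exact h _ _ (by omega) (by omega) (by omega)

theorem sum_range_eq_of_band {d k : ℕ} (hk : k ≤ d) {G : ℕ → F}
    (hG : ∀ l ≤ d, k + 1 < l ∨ l + 1 < k → G l = 0) (hlast : G (d + 1) = 0) :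
    ∑ l ∈ Finset.range (d + 1), G l = (if k = 0 then 0 else G (k - 1)) + G k + G (k + 1) := by
  have hsum : ∑ l ∈ Finset.range (d + 1), G l = ∑ l ∈ Finset.range (d + 2), G l := by
    rw [Finset.sum_range_succ _ (d + 1), hlast, add_zero]
  have hz : ∀ l, l < d + 2 → k + 1 < l ∨ l + 1 < k → G l = 0 := by
    intro l hl hlk
    rcases Nat.lt_or_ge d l with h | h
    · rwa [show l = d + 1 by omega]
    · exact hG l h hlk
  rw [hsum]
  rcases k with _ | k
  · rw [← Finset.sum_subset (s₁ := Finset.range 2) (by simp)]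
    · simp [Finset.sum_range_succ]
    · intro l hl hl'
      simp only [Finset.mem_range] at hl hl'
      exact hz l hl (by omega)
  · rw [← Finset.sum_subset (s₁ := Finset.Ico k (k + 3))]
    · simp [Finset.sum_Ico_succ_top]
    · intro l hl
      simp only [Finset.mem_Ico, Finset.mem_range] at hl ⊢
      omega
    · intro l hl hl'
      simp only [Finset.mem_range, Finset.mem_Ico, not_and, not_lt] at hl hl'
      exact hz l hl (by omega)

/-- The superdiagonal entries of a map in a basis. -/
def superEntry (e : ℕ → V) (x : ℕ → V →ₗ[F] F) (X : Module.End F V) (k : ℕ) : F :=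
  if k = 0 then 0 else x (k - 1) (X (e k))

theorem toeplitz_entries {d : ℕ} {e f : ℕ → V} {x y : ℕ → V →ₗ[F] F} {g : ℕ → F}
    (hx : DualFamily d e x) (hy : DualFamily d f y) (hg0 : g 0 = 0) (hg1 : g 1 = 0)
    (hxf : ∀ m k, m ≤ d → k ≤ d → x m (f k) = g (m + 2 - k)) {X : Module.End F V}
    (hXe : IsBandMap d e x X) (hXf : IsBandMap d f y X) {k j : ℕ} (hk : k ≤ d)
    (hkj : k + j ≤ d + 1) :
    (superEntry e x X (k + j) - superEntry f y X k) * g (j + 2)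
      + (x (k + j - 1) (X (e (k + j - 1))) - y k (X (f k))) * g (j + 1)
      + (x (k + j - 2 + 1) (X (e (k + j - 2))) - y (k + 1) (X (f k))) * g j = 0 := by
  rcases Nat.eq_zero_or_pos (k + j) with h0 | h0
  · obtain ⟨rfl, rfl⟩ : k = 0 ∧ j = 0 := by omega
    simp [superEntry, hg0, hg1]
  obtain ⟨m, hm⟩ : ∃ m, k + j = m + 1 := ⟨k + j - 1, by omega⟩
  have hmd : m ≤ d := by omega
  have e1 : x m (X (f k)) = ∑ l ∈ Finset.range (d + 1), g (l + 2 - k) * x m (X (e l)) := by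
    conv_lhs => rw [← hx.sum_smul (f k), map_sum, map_sum]
    refine Finset.sum_congr rfl fun l hl => ?_
    rw [map_smul, map_smul, smul_eq_mul, hxf l k (by simpa [Nat.lt_succ_iff] using hl) hk]
  have e2 : x m (X (f k)) = ∑ l ∈ Finset.range (d + 1), y l (X (f k)) * g (m + 2 - l) := by
    conv_lhs => rw [← hy.sum_smul (X (f k)), map_sum]
    refine Finset.sum_congr rfl fun l hl => ?_
    rw [map_smul, smul_eq_mul, hxf m l hmd (by simpa [Nat.lt_succ_iff] using hl)]
  rw [sum_range_eq_of_band hmd] at e1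
  rotate_left
  · intro l hl hlm
    rw [hXe m l hmd hl (by omega), mul_zero]
  · simp [hx.vec_eq_zero (d + 1) (by omega)]
  rw [sum_range_eq_of_band hk] at e2
  rotate_left
  · intro l hl hlk
    rw [hXf l k hl hk (by omega), zero_mul]
  · simp [hy.coord_eq_zero (d + 1) (by omega)]
  have e3 := e1.symm.trans e2
  rw [hm]
  rw [show m + 1 + 2 - k = j + 2 by omega, show m + 2 - k = j + 1 by omega,
    show m + 2 - (k + 1) = j by omega] at e3
  have hc : (if m = 0 then 0 else g (m - 1 + 2 - k) * x m (X (e (m - 1)))) =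
      x (m - 1 + 1) (X (e (m - 1))) * g j := by
    rcases Nat.eq_zero_or_pos m with rfl | hm0
    · have : g j = 0 := by
        have : j = 0 ∨ j = 1 := by omega
        rcases this with rfl | rfl <;> assumption
      simp [this]
    · rw [if_neg hm0.ne', show m - 1 + 2 - k = j by omega, Nat.sub_add_cancel hm0, mul_comm]
  have hp : (if k = 0 then 0 else y (k - 1) (X (f k)) * g (m + 2 - (k - 1))) =
      superEntry f y X k * g (j + 2) := by
    unfold superEntry
    split_ifs with hk0
    · simp
    · rw [show m + 2 - (k - 1) = j + 2 by omega]
  rw [hc, hp] at e3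
  simp only [show m + 1 - 1 = m by omega, show m + 1 - 2 = m - 1 by omega]
  rw [show superEntry e x X (m + 1) = x m (X (e (m + 1))) by simp [superEntry]]
  linear_combination e3

section Triple

variable {d : ℕ} {A B C : Module.End F V} {D₁ D₂ D₃ : LRDecomp F V d} {u v w : ℕ → V}
  {xu xv xw : ℕ → V →ₗ[F] F} {γu γv γw : ℕ → F}

theorem ShiftCoords.isBandMap_raise (hu : ShiftCoords D₁ A C u xu γu) : IsBandMap d u xu C := by
  intro i j _ hj hij
  rcases i with _ | i
  · exact hu.raise_zero _
  · rw [hu.raise, hu.apply _ _ hj, if_neg (by omega), mul_zero]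

theorem isBandMap_third (hu : ShiftCoords D₁ A C u xu γu) (hw : ShiftCoords D₂ A B w xw γw)
    (hv : ShiftCoords D₃ B C v xv γv) : IsBandMap d w xw C := by
  intro i j hi hj hij
  rcases hij with hij | hij
  · have h1 : (A ^ (j + 1)) (w j) = 0 := hw.lower_pow_eq_zero_iff.mpr fun l hl => by
      rw [hw.apply _ _ hj, if_neg (by omega)]
    have h2 : (A ^ (j + 2)) (C (w j)) = 0 := hu.lower_pow_eq_zero_iff.mpr fun l hl => by
      obtain ⟨l, rfl⟩ : ∃ m, l = m + 1 := ⟨l - 1, by omega⟩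
      rw [hu.raise, hu.lower_pow_eq_zero_iff.mp h1 l (by omega), mul_zero]
    exact hw.lower_pow_eq_zero_iff.mp h2 i (by omega)
  · have h1 : (B ^ (d - j + 1)) (w j) = 0 := hw.raise_pow_eq_zero_iff.mpr fun l hl => by
      rw [hw.apply _ _ hj, if_neg (by omega)]
    have h2 : (B ^ (d - j + 2)) (C (w j)) = 0 := hv.lower_pow_eq_zero_iff.mpr fun l hl => by
      obtain ⟨l, rfl⟩ : ∃ m, l = m + 1 := ⟨l - 1, by omega⟩
      rw [hv.raise, hv.lower_pow_eq_zero_iff.mp h1 l (by omega), mul_zero]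
    exact hw.raise_pow_eq_zero_iff.mp h2 i (by omega)

theorem eq_zero_of_coords_eq_zero (hu : ShiftCoords D₁ A C u xu γu)
    (hw : ShiftCoords D₂ A B w xw γw) (hv : ShiftCoords D₃ B C v xv γv) {y : V} {m : ℕ}
    (hyw : ∀ i, i + m ≤ d → xw i y = 0) (hyu : ∀ i < m, xu i y = 0) : y = 0 := by
  refine hv.eq_zero fun i hi => ?_
  rcases Nat.lt_or_ge i m with him | him
  · exact hv.raise_pow_eq_zero_iff.mp
      (hu.raise_pow_eq_zero_iff (m := d + 1 - m).mpr fun l hl => hyu l (by omega)) i (by omega)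
  · exact hv.lower_pow_eq_zero_iff.mp (hw.raise_pow_eq_zero_iff.mpr hyw) i him

theorem toeplitzData_of_shiftCoords (hd : 2 ≤ d) (hu : ShiftCoords D₁ A C u xu γu)
    (hw : ShiftCoords D₂ A B w xw γw) (hv : ShiftCoords D₃ B C v xv γv) {g : ℕ → F}
    (hg0 : g 0 = 0) (hg1 : g 1 = 0) (hg2 : g 2 = 1) (hg3 : g 3 = 1)
    (hxf : ∀ m k, m ≤ d → k ≤ d → revSeq d xu m (revSeq d w k) = g (m + 2 - k)) :
    ToeplitzData d g (superEntry (revSeq d u) (revSeq d xu) C)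
      (fun k => revSeq d xw (k + 1) (C (revSeq d w k))) := by
  have hCe : ∀ i j, i ≤ d → j ≤ d → i + 1 ≠ j → revSeq d xu i (C (revSeq d u j)) = 0 := by
    intro i j hi hj hij
    rw [revSeq_of_le _ hi, revSeq_of_le _ hj]
    rcases h : d - i with _ | l
    · exact hu.raise_zero _
    · rw [hu.raise, hu.apply _ _ (by omega), if_neg (by omega), mul_zero]
  have hent : ∀ k j, k ≤ d → k + j ≤ d + 1 → _ := fun k j hk hkj =>
    toeplitz_entries hu.dualFamily hw.dualFamily hg0 hg1 hxf
      (isBandMap_revSeq hu.isBandMap_raise) (isBandMap_revSeq (isBandMap_third hu hw hv)) hk hkj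
  have hb : ∀ k, revSeq d xu k (C (revSeq d u k)) = 0 := by
    intro k
    rcases Nat.lt_or_ge d k with hk | hk
    · simp [revSeq_of_gt u hk]
    · exact hCe k k hk hk (by omega)
  have hc : ∀ k, revSeq d xu (k + 1) (C (revSeq d u k)) = 0 := by
    intro k
    rcases Nat.lt_or_ge d (k + 1) with hk | hk
    · simp [revSeq_of_gt xu hk]
    · exact hCe _ _ hk (by omega) (by omega)
  have hp : ∀ k ≤ d, superEntry (revSeq d w) (revSeq d xw) C k =
      superEntry (revSeq d u) (revSeq d xu) C k := by
    intro k hk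
    have := hent k 0 hk (by omega)
    simp only [add_zero, zero_add, hb, hg0, hg1, hg2] at this
    linear_combination -this
  have hq : ∀ k ≤ d, revSeq d xw k (C (revSeq d w k)) =
      superEntry (revSeq d u) (revSeq d xu) C (k + 1) -
        superEntry (revSeq d u) (revSeq d xu) C k := by
    intro k hk
    have := hent k 1 hk (by omega)
    simp only [Nat.reduceAdd, hb, hg1, hg2, hg3, hp k hk] at this
    linear_combination -this
  refine ⟨hd, hg0, hg1, hg2, hg3, rfl, ?_, ?_, ?_, ?_, ?_⟩
  · simp [superEntry, revSeq_of_gt u (Nat.lt_succ_self d)]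
  · intro k hk1 hk
    rw [superEntry, if_neg (by omega), revSeq_of_le _ hk, revSeq_of_le _ (by omega),
      show d - (k - 1) = d - k + 1 by omega, hu.raise, hu.apply _ _ (by omega), if_pos rfl, mul_one]
    exact hu.ne_zero _ (by omega)
  · intro k j hk hkj
    have := hent k j hk hkj
    rw [hb, hc, hp k hk, hq k hk] at this
    linear_combination this
  · intro h
    have h0 : w d = 0 := by
      refine eq_zero_of_coords_eq_zero hu hw hv (m := 1) (fun i hi => ?_) (fun i hi => ?_)
      · rw [hw.apply _ _ le_rfl, if_neg (by omega)]
      · have := hxf d 0 le_rfl (Nat.zero_le d)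
        rw [revSeq_of_le _ le_rfl, revSeq_of_le _ (Nat.zero_le d), Nat.sub_self, Nat.sub_zero,
          Nat.sub_zero, h] at this
        rwa [show i = 0 by omega]
    have := hw.apply d d le_rfl
    simp [h0] at this
  · refine windowDet_ne_zero_of_forall fun n₁ n₂ n₃ h0 h1 h2 => ?_
    set z := n₁ • revSeq d w 0 + n₂ • revSeq d w 1 + n₃ • revSeq d w 2 with hz
    have hxz : ∀ m ≤ d, revSeq d xu m z = windowDot g n₁ n₂ n₃ m := by
      intro m hm
      simp only [hz, map_add, map_smul, smul_eq_mul, hxf m _ hm (Nat.zero_le d),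
        hxf m _ hm (show 1 ≤ d by omega), hxf m _ hm hd, windowDot]
      rfl
    have hwz : ∀ i, xw i z = n₁ * (if i = d then 1 else 0) + n₂ * (if i = d - 1 then 1 else 0) +
        n₃ * (if i = d - 2 then 1 else 0) := by
      intro i
      simp only [hz, map_add, map_smul, smul_eq_mul, revSeq_of_le w (Nat.zero_le d),
        revSeq_of_le w (show 1 ≤ d by omega), revSeq_of_le w hd, Nat.sub_zero,
        hw.apply i _ (Nat.sub_le d _), hw.apply i _ le_rfl]
    have hz0 : z = 0 := by
      refine eq_zero_of_coords_eq_zero hu hw hv (m := 3) (fun i hi => ?_) (fun i hi => ?_)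
      · rw [hwz, if_neg (by omega), if_neg (by omega), if_neg (by omega)]
        simp
      · have hi' := hxz (d - i) (Nat.sub_le d i)
        rw [revSeq_of_le _ (Nat.sub_le d i), show d - (d - i) = i by omega] at hi'
        rw [hi']
        obtain rfl | rfl | rfl : i = 0 ∨ i = 1 ∨ i = 2 := by omega
        · rwa [show d - 0 = d - 2 + 2 by omega]
        · rwa [show d - 1 = d - 2 + 1 by omega]
        · exact h0
    simp only [hz0, map_zero] at hwz
    refine ⟨?_, ?_, ?_⟩
    · have := hwz d
      rw [if_pos rfl, if_neg (by omega), if_neg (by omega)] at this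
      simpa using this.symm
    · have := hwz (d - 1)
      rw [if_pos rfl, if_neg (by omega), if_neg (by omega)] at this
      simpa using this.symm
    · have := hwz (d - 2)
      rw [if_pos rfl, if_neg (by omega), if_neg (by omega)] at this
      simpa using this.symm

end Triple

theorem IsToeplitzTransition.coord_apply {d : ℕ} {D : LRDecomp F V d} {P Q : Module.End F V}
    {u w : ℕ → V} {x : ℕ → V →ₗ[F] F} {γ α : ℕ → F} (hα : IsToeplitzTransition d u w α)
    (hu : ShiftCoords D P Q u x γ) {i j : ℕ} (hj : j ≤ d) :
    x i (w j) = if i ≤ j then α (j - i) else 0 := by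
  rw [hα j hj, map_sum]
  have : ∀ l ∈ Finset.range (j + 1), x i (α (j - l) • u l) = if i = l then α (j - l) else 0 := by
    intro l hl
    rw [Finset.mem_range] at hl
    rw [map_smul, hu.apply _ _ (by omega), smul_eq_mul, mul_ite, mul_one, mul_zero]
  rw [Finset.sum_congr rfl this, Finset.sum_ite_eq]
  simp

/-- A map that is tridiagonal in both bases is zero as soon as seven of its entries vanish. -/
theorem ToeplitzData.eq_zero_of_isBandMap {d : ℕ} {e f : ℕ → V} {x y : ℕ → V →ₗ[F] F}
    {g φ ε : ℕ → F} (h : ToeplitzData d g φ ε) (hx : DualFamily d e x) (hy : DualFamily d f y)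
    (hxf : ∀ m k, m ≤ d → k ≤ d → x m (f k) = g (m + 2 - k)) {X : Module.End F V}
    (hXe : IsBandMap d e x X) (hXf : IsBandMap d f y X) (h1 : x d (X (e d)) = 0)
    (h2 : x d (X (e (d - 1))) = 0) (h3 : y 1 (X (f 0)) = 0) (h4 : y 1 (X (f 1)) = 0)
    (h5 : y 2 (X (f 1)) = 0) (h6 : y 2 (X (f 2)) = 0) (h7 : y 3 (X (f 2)) = 0) : X = 0 := by
  have hd := h.two_le
  obtain ⟨ha, hb, hc⟩ := h.entries_eq_zero
    (a := superEntry e x X) (b := fun k => x k (X (e k))) (c := fun k => x (k + 1) (X (e k)))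
    (p := superEntry f y X) (q := fun k => y k (X (f k))) (r := fun k => y (k + 1) (X (f k)))
    (fun k j hk hkj => toeplitz_entries hx hy h.g_zero h.g_one hxf hXe hXf hk hkj)
    (by simp [superEntry, hx.vec_eq_zero (d + 1) (by omega)]) rfl h1
    (by simpa only [show d - 1 + 1 = d by omega] using h2) h3 h4 h5 h6 h7
  have hent : ∀ i j, i ≤ d → j ≤ d → x i (X (e j)) = 0 := by
    intro i j hi hj
    by_cases hij : j + 1 < i ∨ i + 1 < j
    · exact hXe i j hi hj hij
    obtain rfl | rfl | rfl : j = i + 1 ∨ i = j ∨ i = j + 1 := by omega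
    · simpa [superEntry] using ha (i + 1) (by omega) hj
    · exact hb i hi
    · exact hc j (by omega)
  have hXej : ∀ j ≤ d, X (e j) = 0 := by
    intro j hj
    rw [← hx.sum_smul (X (e j))]
    refine Finset.sum_eq_zero fun i hi => ?_
    rw [hent i j (by simpa [Nat.lt_succ_iff] using hi) hj, zero_smul]
  ext z
  rw [← hx.sum_smul z, map_sum, LinearMap.zero_apply]
  refine Finset.sum_eq_zero fun i hi => ?_
  rw [map_smul, hXej i (by simpa [Nat.lt_succ_iff] using hi), smul_zero]

/-- A space of endomorphisms separated by `n` matrix coefficients has dimension at most `n`. -/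
theorem finrank_le_of_forall_coeff_eq_zero {n : ℕ} (S : Submodule F (Module.End F V))
    (f : Fin n → V →ₗ[F] F) (z : Fin n → V)
    (h : ∀ X ∈ S, (∀ i, f i (X (z i)) = 0) → X = 0) : Module.finrank F S ≤ n := by
  let L : S →ₗ[F] (Fin n → F) :=
    (LinearMap.pi fun i => f i ∘ₗ LinearMap.applyₗ (z i)) ∘ₗ S.subtype
  have hL : Function.Injective L := by
    rw [injective_iff_map_eq_zero]
    intro X hX
    exact Subtype.ext (h X X.2 fun i => congrFun hX i)
  simpa using LinearMap.finrank_le_finrank_of_injective hL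

theorem stmt10
    {F : Type*} [Field F] {V : Type*} [AddCommGroup V] [Module F V]
    [FiniteDimensional F V] {d : ℕ} (hdim : Module.finrank F V = d + 1)
    (A B C : Module.End F V) (DAB DBC DCA : LRDecomp F V d)
    (hAB : IsLRPairWith A B DAB) (hBC : IsLRPairWith B C DBC) (hCA : IsLRPairWith C A DCA)
    (hd : 2 ≤ d)
    (E E' E'' : ℕ → Module.End F V)
    (hE : IsIdemSeq DAB E) (hE' : IsIdemSeq DBC E') (hE'' : IsIdemSeq DCA E'')
    (hnonbip : ¬ IsBipartite d A B C E E' E'')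
    (u₁ w₁ u₂ w₂ u₃ w₃ : ℕ → V) (α α' α'' : ℕ → F)
    (hu₁ : IsLRBasisRev C DBC u₁) (hw₁ : IsLRBasisFor C DCA w₁) (hc₁ : u₁ 0 = w₁ 0)
    (hα : IsToeplitzTransition d u₁ w₁ α)
    (hu₂ : IsLRBasisRev A DCA u₂) (hw₂ : IsLRBasisFor A DAB w₂) (hc₂ : u₂ 0 = w₂ 0)
    (hα' : IsToeplitzTransition d u₂ w₂ α')
    (hu₃ : IsLRBasisRev B DAB u₃) (hw₃ : IsLRBasisFor B DBC w₃) (hc₃ : u₃ 0 = w₃ 0)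
    (hα'' : IsToeplitzTransition d u₃ w₃ α'')
    (hnorm : α 1 = 1 ∧ α' 1 = 1 ∧ α'' 1 = 1)
    (hqw : ¬ ∃ q : F, IsQWeylTriple q A B C) :
    Module.finrank F (tridiagSpace DAB DBC DCA) ≤ 7 := by
  obtain ⟨xu, γu, hu⟩ := exists_shiftCoords hdim hCA.rev hu₂.isLRBasisFor
  obtain ⟨xw, γw, hw⟩ := exists_shiftCoords hdim hAB hw₂
  obtain ⟨xv, γv, hv⟩ := exists_shiftCoords hdim hBC hw₃
  have hα0 : α' 0 = 1 := by
    have h0 := hα'.coord_apply hu (i := 0) (Nat.zero_le d)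
    rw [← hc₂, hu.apply _ _ (Nat.zero_le d)] at h0
    simpa using h0.symm
  let g : ℕ → F := fun n => if n < 2 then 0 else α' (n - 2)
  have hxf : ∀ m k, m ≤ d → k ≤ d → revSeq d xu m (revSeq d w₂ k) = g (m + 2 - k) := by
    intro m k hm hk
    rw [revSeq_of_le _ hm, revSeq_of_le _ hk, hα'.coord_apply hu (Nat.sub_le d k)]
    simp only [g]
    by_cases hmk : k ≤ m
    · rw [if_pos (by omega), if_neg (by omega)]
      congr 1
      omega
    · rw [if_neg (by omega), if_pos (by omega)]
  have hT := toeplitzData_of_shiftCoords hd hu hw hv (g := g) rfl rfl hα0 hnorm.2.1 hxf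
  refine finrank_le_of_forall_coeff_eq_zero _
    ![revSeq d xu d, revSeq d xu d, revSeq d xw 1, revSeq d xw 1, revSeq d xw 2, revSeq d xw 2,
      revSeq d xw 3]
    ![revSeq d u₂ d, revSeq d u₂ (d - 1), revSeq d w₂ 0, revSeq d w₂ 1, revSeq d w₂ 1,
      revSeq d w₂ 2, revSeq d w₂ 2] fun X hX h => ?_
  refine hT.eq_zero_of_isBandMap hu.dualFamily hw.dualFamily hxf
    (isBandMap_revSeq fun i j _ hj hij => hu.tridiagonal X hX.2.2.rev i j hj hij)
    (isBandMap_revSeq fun i j _ hj hij => hw.tridiagonal X hX.1 i j hj hij)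
    (h 0) (h 1) (h 2) (h 3) (h 4) (h 5) (h 6)
end

section
/- Let (A,B,C) be a bipartite LR triple on V with J as defined, and let α, β, γ be nonzero scalars in F. Set A' = αAJ + A(I−J), B' = βBJ + B(I−J), C' = γCJ + C(I−J). Then (A',B',C') is a bipartite LR triple on V, and its tridiagonal space equals the tridiagonal space of (A,B,C). -/
variable {F : Type*} [Field F] {V : Type*} [AddCommGroup V] [Module F V]

theorem LRDecomp.ext_sub {d : ℕ} {D D' : LRDecomp F V d} (h : ∀ i, D.sub i = D'.sub i) :
    D = D' := by
  cases D
  cases D'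
  congr
  exact funext h

theorem LRDecomp.iSup_sub_eq_top {d : ℕ} (D : LRDecomp F V d) :
    ⨆ i : Fin (d + 1), D.sub i.val = ⊤ :=
  D.isInternal.submodule_iSup_eq_top

/-- Two linear maps agreeing on every component of a decomposition are equal. -/
theorem LRDecomp.hom_ext {d : ℕ} (D : LRDecomp F V d) {f g : Module.End F V}
    (h : ∀ i, ∀ v ∈ D.sub i, f v = g v) : f = g := by
  have hle : (⊤ : Submodule F V) ≤ LinearMap.eqLocus f g := by
    rw [← D.iSup_sub_eq_top]
    exact iSup_le fun i v hv => h i v hv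
  exact LinearMap.ext fun v => hle (Submodule.mem_top (x := v))

theorem LRDecomp.exists_isIdemSeq {d : ℕ} (D : LRDecomp F V d) :
    ∃ E : ℕ → Module.End F V, IsIdemSeq D E := by
  classical
  let := D.isInternal.chooseDecomposition
  refine ⟨fun i => if hi : i < d + 1 then
    (D.sub i).subtype ∘ₗ DirectSum.component F (Fin (d + 1)) (fun j => D.sub j.val) ⟨i, hi⟩ ∘ₗ
      (DirectSum.decomposeLinearEquiv fun j : Fin (d + 1) => D.sub j.val).toLinearMap else 0, ?_⟩
  intro i
  refine ⟨fun v hv => ?_, fun j hj v hv => ?_⟩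
  · by_cases hi : i < d + 1
    · simp only [hi, dite_true, LinearMap.comp_apply]
      exact DirectSum.decompose_of_mem_same (fun j : Fin (d + 1) => D.sub j.val)
        (i := ⟨i, hi⟩) hv
    · rw [D.eq_bot_of_gt i (by omega), Submodule.mem_bot] at hv
      simp [hv]
  · by_cases hi : i < d + 1
    · by_cases hjd : j < d + 1
      · simp only [hi, dite_true, LinearMap.comp_apply]
        exact DirectSum.decompose_of_mem_ne (fun j : Fin (d + 1) => D.sub j.val)
          (i := ⟨j, hjd⟩) (j := ⟨i, hi⟩) hv (by simpa using hj)
      · rw [D.eq_bot_of_gt j (by omega), Submodule.mem_bot] at hv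
        simp [hv]
    · simp [hi]

namespace IsIdemSeq

variable {d : ℕ} {D : LRDecomp F V d} {E : ℕ → Module.End F V}

theorem unique {E' : ℕ → Module.End F V} (hE : IsIdemSeq D E) (hE' : IsIdemSeq D E') :
    E = E' := by
  funext i
  refine D.hom_ext fun j v hv => ?_
  by_cases hj : j = i
  · subst hj
    rw [(hE j).1 v hv, (hE' j).1 v hv]
  · rw [(hE i).2 j hj v hv, (hE' i).2 j hj v hv]

theorem apply_mem (hE : IsIdemSeq D E) (i : ℕ) (x : V) : E i x ∈ D.sub i := by
  have hle : (⊤ : Submodule F V) ≤ (D.sub i).comap (E i) := by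
    rw [← D.iSup_sub_eq_top]
    refine iSup_le fun j v hv => ?_
    rw [Submodule.mem_comap]
    by_cases hj : j.val = i
    · rw [hj] at hv
      rwa [(hE i).1 v hv]
    · rw [(hE i).2 j hj v hv]
      exact zero_mem _
  exact hle Submodule.mem_top

theorem apply_of_gt (hE : IsIdemSeq D E) {i : ℕ} (hi : d < i) (x : V) : E i x = 0 := by
  simpa [D.eq_bot_of_gt i hi] using hE.apply_mem i x

theorem sum_eq_one (hE : IsIdemSeq D E) : ∑ i ∈ Finset.range (d + 1), E i = 1 := by
  refine D.hom_ext fun j v hv => ?_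
  by_cases hj : j < d + 1
  · rw [LinearMap.sum_apply, Finset.sum_eq_single j, (hE j).1 v hv, Module.End.one_apply]
    · exact fun i _ hi => (hE i).2 j hi.symm v hv
    · exact fun h => absurd (Finset.mem_range.2 hj) h
  · rw [D.eq_bot_of_gt j (by omega), Submodule.mem_bot] at hv
    simp [hv]

theorem eq_zero (hE : IsIdemSeq D E) {x : V} (h : ∀ i, E i x = 0) : x = 0 := by
  have hx := LinearMap.congr_fun hE.sum_eq_one x
  rw [LinearMap.sum_apply, Module.End.one_apply] at hx
  rw [← hx]
  exact Finset.sum_eq_zero fun i _ => h i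

theorem ext (hE : IsIdemSeq D E) {x y : V} (h : ∀ i, E i x = E i y) : x = y :=
  sub_eq_zero.1 (hE.eq_zero fun i => by rw [map_sub, h, sub_self])

theorem mem_of_apply_eq_zero (hE : IsIdemSeq D E) {i : ℕ} {x : V}
    (h : ∀ j, j ≠ i → E j x = 0) : x ∈ D.sub i := by
  have hx : x = E i x := hE.ext fun j => by
    by_cases hj : j = i
    · subst hj
      exact ((hE j).1 _ (hE.apply_mem j x)).symm
    · rw [h j hj, (hE j).2 i (Ne.symm hj) _ (hE.apply_mem i x)]
  rw [hx]
  exact hE.apply_mem i x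

theorem apply_lowers (hE : IsIdemSeq D E) {A : Module.End F V} (hA : Lowers A D) (i : ℕ)
    (x : V) : E i (A x) = A (E (i + 1) x) := by
  suffices h : E i * A = A * E (i + 1) from LinearMap.congr_fun h x
  refine D.hom_ext fun j v hv => ?_
  simp only [Module.End.mul_apply]
  rcases j with _ | j
  · have h0 : A v = 0 := by
      have := Submodule.mem_map_of_mem (f := A) hv
      rwa [hA.1, Submodule.mem_bot] at this
    rw [h0, map_zero, (hE (i + 1)).2 0 (by omega) v hv, map_zero]
  · by_cases hj : j < d
    · have hAv : A v ∈ D.sub j := hA.2 j hj ▸ Submodule.mem_map_of_mem hv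
      by_cases hij : j = i
      · subst hij
        rw [(hE j).1 _ hAv, (hE (j + 1)).1 v hv]
      · rw [(hE i).2 j hij _ hAv, (hE (i + 1)).2 (j + 1) (by omega) v hv, map_zero]
    · rw [D.eq_bot_of_gt (j + 1) (by omega), Submodule.mem_bot] at hv
      simp [hv]

theorem apply_raises (hE : IsIdemSeq D E) {B : Module.End F V} (hB : Raises B D) (i : ℕ)
    (x : V) : E (i + 1) (B x) = B (E i x) := by
  suffices h : E (i + 1) * B = B * E i from LinearMap.congr_fun h x
  refine D.hom_ext fun j v hv => ?_
  simp only [Module.End.mul_apply]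
  by_cases hj : j ≤ d
  · have hBv : B v ∈ D.sub (j + 1) := hB j hj ▸ Submodule.mem_map_of_mem hv
    by_cases hij : j = i
    · subst hij
      rw [(hE (j + 1)).1 _ hBv, (hE j).1 v hv]
    · rw [(hE (i + 1)).2 (j + 1) (by omega) _ hBv, (hE i).2 j hij v hv, map_zero]
  · rw [D.eq_bot_of_gt j (by omega), Submodule.mem_bot] at hv
    simp [hv]

theorem apply_zero_raises (hE : IsIdemSeq D E) {B : Module.End F V} (hB : Raises B D)
    (x : V) : E 0 (B x) = 0 := by
  suffices h : E 0 * B = 0 from LinearMap.congr_fun h x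
  refine D.hom_ext fun j v hv => ?_
  by_cases hj : j ≤ d
  · have hBv : B v ∈ D.sub (j + 1) := hB j hj ▸ Submodule.mem_map_of_mem hv
    exact (hE 0).2 (j + 1) (by omega) _ hBv
  · rw [D.eq_bot_of_gt j (by omega), Submodule.mem_bot] at hv
    simp [hv]

end IsIdemSeq

/-- A linear map carrying a line onto a line is injective on it. -/
theorem eq_zero_of_map_line {f : Module.End F V} {p q : Submodule F V}
    (hp : Module.finrank F p = 1) (hq : Module.finrank F q = 1) (h : p.map f = q)
    {v : V} (hv : v ∈ p) (hfv : f v = 0) : v = 0 := by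
  by_contra hne
  have hbot : q = ⊥ := by
    rw [← h, eq_bot_iff]
    rintro _ ⟨w, hw, rfl⟩
    obtain ⟨c, hc⟩ := (finrank_eq_one_iff_of_nonzero' (⟨v, hv⟩ : p) (by simpa using hne)).1 hp
      ⟨w, hw⟩
    have hcw : c • v = w := congrArg Subtype.val hc
    rw [Submodule.mem_bot, ← hcw, map_smul, hfv, smul_zero]
  rw [hbot, finrank_bot] at hq
  exact zero_ne_one hq

theorem Lowers.eq_zero {d : ℕ} {D : LRDecomp F V d} {A : Module.End F V} (hA : Lowers A D)
    {i : ℕ} {v : V} (hv : v ∈ D.sub (i + 1)) (h : A v = 0) : v = 0 := by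
  by_cases hi : i < d
  · exact eq_zero_of_map_line (D.finrank_eq_one _ hi) (D.finrank_eq_one _ hi.le) (hA.2 i hi) hv h
  · rwa [D.eq_bot_of_gt (i + 1) (by omega), Submodule.mem_bot] at hv

theorem Raises.eq_zero {d : ℕ} {D : LRDecomp F V d} {B : Module.End F V} (hB : Raises B D)
    {i : ℕ} (hi : i < d) {v : V} (hv : v ∈ D.sub i) (h : B v = 0) : v = 0 :=
  eq_zero_of_map_line (D.finrank_eq_one _ hi.le) (D.finrank_eq_one _ hi) (hB i hi.le) hv h

theorem Lowers.pow_apply_eq_zero_iff {d : ℕ} {D : LRDecomp F V d} {E : ℕ → Module.End F V}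
    (hE : IsIdemSeq D E) {A : Module.End F V} (hA : Lowers A D) (k : ℕ) (x : V) :
    (A ^ k) x = 0 ↔ ∀ i, k ≤ i → E i x = 0 := by
  induction k generalizing x with
  | zero =>
    refine ⟨fun h i _ => ?_, fun h => ?_⟩
    · rw [pow_zero, Module.End.one_apply] at h
      rw [h, map_zero]
    · exact hE.eq_zero fun i => h i (Nat.zero_le i)
  | succ k ih =>
    rw [pow_succ, Module.End.mul_apply, ih]
    refine ⟨fun h i hi => ?_, fun h i hi => ?_⟩
    · obtain ⟨j, rfl⟩ : ∃ j, i = j + 1 := ⟨i - 1, by omega⟩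
      have := h j (by omega)
      rw [hE.apply_lowers hA] at this
      exact hA.eq_zero (hE.apply_mem _ x) this
    · rw [hE.apply_lowers hA, h (i + 1) (by omega), map_zero]

theorem Raises.pow_apply_eq_zero_iff {d : ℕ} {D : LRDecomp F V d} {E : ℕ → Module.End F V}
    (hE : IsIdemSeq D E) {B : Module.End F V} (hB : Raises B D) (k : ℕ) (x : V) :
    (B ^ k) x = 0 ↔ ∀ i, i + k ≤ d → E i x = 0 := by
  induction k generalizing x with
  | zero =>
    refine ⟨fun h i _ => ?_, fun h => hE.eq_zero fun i => ?_⟩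
    · rw [pow_zero, Module.End.one_apply] at h
      rw [h, map_zero]
    · by_cases hi : i ≤ d
      · exact h i hi
      · exact hE.apply_of_gt (by omega) _
  | succ k ih =>
    rw [pow_succ, Module.End.mul_apply, ih]
    refine ⟨fun h i hi => ?_, fun h i hi => ?_⟩
    · have := h (i + 1) (by omega)
      rw [hE.apply_raises hB] at this
      exact hB.eq_zero (by omega) (hE.apply_mem _ x) this
    · rcases i with _ | i
      · exact hE.apply_zero_raises hB x
      · rw [hE.apply_raises hB, h i (by omega), map_zero]

theorem IsLRPairWith.mem_sub_iff {d : ℕ} {D : LRDecomp F V d} {A B : Module.End F V}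
    (h : IsLRPairWith A B D) {i : ℕ} (hi : i ≤ d) (x : V) :
    x ∈ D.sub i ↔ (A ^ (i + 1)) x = 0 ∧ (B ^ (d - i + 1)) x = 0 := by
  obtain ⟨E, hE⟩ := D.exists_isIdemSeq
  rw [h.1.pow_apply_eq_zero_iff hE, h.2.pow_apply_eq_zero_iff hE]
  refine ⟨fun hx => ⟨fun j hj => (hE j).2 i (by omega) x hx,
    fun j hj => (hE j).2 i (by omega) x hx⟩, fun hx => hE.mem_of_apply_eq_zero fun j hj => ?_⟩
  rcases lt_or_gt_of_ne hj with hlt | hgt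
  · exact hx.2 j (by omega)
  · exact hx.1 j (by omega)

theorem IsLRPairWith.unique {d : ℕ} {D D' : LRDecomp F V d} {A B : Module.End F V}
    (h : IsLRPairWith A B D) (h' : IsLRPairWith A B D') : D = D' := by
  refine LRDecomp.ext_sub fun i => ?_
  by_cases hi : i ≤ d
  · ext x
    rw [h.mem_sub_iff hi, h'.mem_sub_iff hi]
  · rw [D.eq_bot_of_gt i (by omega), D'.eq_bot_of_gt i (by omega)]

/-- The last component of the `(A,B)`-decomposition is the first component of the
`(B,C)`-decomposition: both are the kernel of `B`. -/
theorem IsLRPairWith.sub_last_eq {d : ℕ} {D D' : LRDecomp F V d} {A B C : Module.End F V}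
    (h : IsLRPairWith A B D) (h' : IsLRPairWith B C D') : D.sub d = D'.sub 0 := by
  obtain ⟨E, hE⟩ := D.exists_isIdemSeq
  obtain ⟨E', hE'⟩ := D'.exists_isIdemSeq
  ext x
  have hA : (A ^ (d + 1)) x = 0 :=
    (h.1.pow_apply_eq_zero_iff hE _ x).2 fun i hi => hE.apply_of_gt hi x
  have hC : (C ^ (d + 1)) x = 0 :=
    (h'.2.pow_apply_eq_zero_iff hE' _ x).2 fun i hi => by omega
  rw [h.mem_sub_iff le_rfl, h'.mem_sub_iff (Nat.zero_le d)]
  simp [hA, hC]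

/-- `J` acts as the identity on the components of `D` whose index has the parity of `p`,
and as zero on the others. -/
def IsParityProj {d : ℕ} (J : Module.End F V) (D : LRDecomp F V d) (p : ℕ) : Prop :=
  ∀ i, ∀ v ∈ D.sub i, J v = if Even (p + i) then v else 0

theorem IsIdemSeq.isParityProj {d : ℕ} {D : LRDecomp F V d} {E : ℕ → Module.End F V}
    (hE : IsIdemSeq D E) :
    IsParityProj (∑ j ∈ Finset.range (d / 2 + 1), E (2 * j)) D 0 := by
  intro i v hv
  rw [zero_add, LinearMap.sum_apply]
  split_ifs with hi
  · obtain ⟨k, rfl⟩ := hi.two_dvd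
    by_cases hk : 2 * k ≤ d
    · rw [Finset.sum_eq_single k, (hE _).1 v hv]
      · exact fun j _ hj => (hE _).2 _ (by omega) v hv
      · exact fun h => absurd (Finset.mem_range.2 (by omega)) h
    · rw [D.eq_bot_of_gt _ (by omega), Submodule.mem_bot] at hv
      simp [hv]
  · refine Finset.sum_eq_zero fun j _ => (hE _).2 _ ?_ v hv
    rintro rfl
    exact hi (even_two_mul j)

theorem IsParityProj.idem_apply {d : ℕ} {D : LRDecomp F V d} {E : ℕ → Module.End F V}
    (hE : IsIdemSeq D E) {J : Module.End F V} {p : ℕ} (hJ : IsParityProj J D p) (i : ℕ) (x : V) :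
    E i (J x) = if Even (p + i) then E i x else 0 := by
  suffices h : E i * J = if Even (p + i) then E i else 0 by
    have := LinearMap.congr_fun h x
    split_ifs at this ⊢ <;> exact this
  refine D.hom_ext fun j v hv => ?_
  rw [Module.End.mul_apply, hJ j v hv]
  by_cases hj : j = i
  · subst hj
    split_ifs <;> simp
  · split_ifs <;> simp [(hE i).2 j hj v hv]

/-- A map lowering a decomposition exchanges its even and odd parts. -/
theorem IsParityProj.apply_lowers {d : ℕ} {D : LRDecomp F V d} {A J : Module.End F V} {p : ℕ}
    (hJ : IsParityProj J D p) (hA : Lowers A D) (x : V) : J (A x) = A (x - J x) := by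
  obtain ⟨E, hE⟩ := D.exists_isIdemSeq
  refine hE.ext fun i => ?_
  rw [hJ.idem_apply hE, hE.apply_lowers hA, hE.apply_lowers hA, map_sub, hJ.idem_apply hE,
    ← add_assoc]
  simp only [Nat.even_add_one]
  split_ifs <;> simp_all

/-- If `J` exchanges parts under a raising map, then the parity of the first component
determines the parity of all of them. -/
theorem IsParityProj.of_raises {d : ℕ} {D : LRDecomp F V d} {B J : Module.End F V} {p : ℕ}
    (hB : Raises B D) (hJB : ∀ x, J (B x) = B (x - J x))
    (h0 : ∀ v ∈ D.sub 0, J v = if Even p then v else 0) : IsParityProj J D p := by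
  intro i
  induction i with
  | zero => exact h0
  | succ i ih =>
    intro v hv
    by_cases hi : i ≤ d
    · rw [← hB i hi] at hv
      obtain ⟨w, hw, rfl⟩ := hv
      rw [hJB, ih w hw, ← add_assoc]
      simp only [Nat.even_add_one]
      split_ifs <;> simp_all
    · rw [D.eq_bot_of_gt _ (by omega), Submodule.mem_bot] at hv
      simp [hv]

theorem Raises.pow_succ_apply_eq_zero {d : ℕ} {D : LRDecomp F V d} {A C : Module.End F V}
    (h : IsLRPairWith C A D) {k : ℕ} {x : V} (hx : (A ^ k) x = 0) : (A ^ (k + 1)) (C x) = 0 := by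
  obtain ⟨E, hE⟩ := D.exists_isIdemSeq
  rw [h.2.pow_apply_eq_zero_iff hE] at hx ⊢
  intro i hi
  rw [hE.apply_lowers h.1, hx (i + 1) (by omega), map_zero]

theorem Lowers.pow_succ_apply_eq_zero {d : ℕ} {D : LRDecomp F V d} {B C : Module.End F V}
    (h : IsLRPairWith B C D) {k : ℕ} {x : V} (hx : (B ^ k) x = 0) : (B ^ (k + 1)) (C x) = 0 := by
  obtain ⟨E, hE⟩ := D.exists_isIdemSeq
  rw [h.1.pow_apply_eq_zero_iff hE] at hx ⊢
  intro i hi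
  obtain ⟨j, rfl⟩ : ∃ j, i = j + 1 := ⟨i - 1, by omega⟩
  rw [hE.apply_raises h.2, hx j (by omega), map_zero]

/-- The trace of `X E_i` is the diagonal entry of `X` at the component `i`. -/
theorem IsIdemSeq.apply_eq_trace_smul [FiniteDimensional F V] {d : ℕ} {D : LRDecomp F V d}
    {E : ℕ → Module.End F V} (hE : IsIdemSeq D E) {i : ℕ} (hi : i ≤ d) (X : Module.End F V)
    {v : V} (hv : v ∈ D.sub i) : E i (X v) = LinearMap.trace F V (X * E i) • v := by
  have htr : LinearMap.trace F V (E i) = 1 := by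
    have hproj : LinearMap.IsProj (D.sub i) (E i) := ⟨hE.apply_mem i, (hE i).1⟩
    rw [hproj.trace, D.finrank_eq_one i hi, Nat.cast_one]
  obtain ⟨w, hw0, hw⟩ := finrank_eq_one_iff'.1 (D.finrank_eq_one i hi)
  obtain ⟨r, hr⟩ := hw ⟨E i (X w), hE.apply_mem i _⟩
  have hr' : E i (X w) = r • (w : V) := (congrArg Subtype.val hr).symm
  have hsmul : ∀ u ∈ D.sub i, E i (X u) = r • u := by
    intro u hu
    obtain ⟨s, hs⟩ := hw ⟨u, hu⟩
    have hs' : s • (w : V) = u := congrArg Subtype.val hs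
    rw [← hs', map_smul, map_smul, hr', smul_comm]
  have hEX : E i * (X * E i) = r • E i :=
    LinearMap.ext fun x => hsmul _ (hE.apply_mem i x)
  have hEE : E i * E i = E i := LinearMap.ext fun x => (hE i).1 _ (hE.apply_mem i x)
  have : LinearMap.trace F V (X * E i) = r := by
    rw [← hEE, ← mul_assoc, LinearMap.trace_mul_comm, hEX, map_smul, htr, smul_eq_mul, mul_one]
  rw [this, hsmul v hv]

/-- In an LR triple `(A,B,C)` whose `(A,B)`-diagonal entries of `C` vanish, `C` exchanges the
even and odd parts of the `(A,B)`-decomposition. -/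
theorem IsParityProj.apply_third [FiniteDimensional F V] {d : ℕ} {A B C J : Module.End F V}
    {DAB DBC DCA : LRDecomp F V d} (hAB : IsLRPairWith A B DAB) (hBC : IsLRPairWith B C DBC)
    (hCA : IsLRPairWith C A DCA) {E : ℕ → Module.End F V} (hE : IsIdemSeq DAB E)
    (htr : ∀ i ≤ d, LinearMap.trace F V (C * E i) = 0) {p : ℕ} (hJ : IsParityProj J DAB p)
    (x : V) : J (C x) = C (x - J x) := by
  suffices h : J * C = C * (1 - J) from LinearMap.congr_fun h x
  refine DAB.hom_ext fun i v hv => hE.ext fun j => ?_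
  simp only [Module.End.mul_apply, LinearMap.sub_apply, Module.End.one_apply]
  rw [hJ.idem_apply hE, hJ i v hv]
  by_cases hi : i ≤ d
  · by_cases hj : j = i + 1 ∨ i = j + 1
    · have hpar : Even (p + j) ↔ ¬ Even (p + i) := by
        rcases hj with rfl | rfl
        · rw [← add_assoc, Nat.even_add_one]
        · rw [← add_assoc, Nat.even_add_one, not_not]
      simp only [hpar]
      split_ifs <;> simp_all
    · have hzero : E j (C v) = 0 := by
        obtain ⟨hAv, hBv⟩ := (hAB.mem_sub_iff hi v).1 hv
        rcases lt_trichotomy j i with hlt | rfl | hgt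
        · exact (hAB.2.pow_apply_eq_zero_iff hE _ _).1
            (Lowers.pow_succ_apply_eq_zero hBC hBv) j (by omega)
        · rw [hE.apply_eq_trace_smul hi C hv, htr j hi, zero_smul]
        · exact (hAB.1.pow_apply_eq_zero_iff hE _ _).1
            (Raises.pow_succ_apply_eq_zero hCA hAv) j (by omega)
      rw [map_sub, map_sub]
      split_ifs <;> simp [hzero]
  · rw [DAB.eq_bot_of_gt i (by omega), Submodule.mem_bot] at hv
    simp [hv]

theorem map_eq_map_of_smul {f g : Module.End F V} {p : Submodule F V} {r : F} (hr : r ≠ 0)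
    (h : ∀ v ∈ p, g v = r • f v) : p.map g = p.map f := by
  apply le_antisymm
  · rintro _ ⟨v, hv, rfl⟩
    rw [h v hv, ← map_smul]
    exact Submodule.mem_map_of_mem (p.smul_mem r hv)
  · rintro _ ⟨v, hv, rfl⟩
    refine ⟨r⁻¹ • v, p.smul_mem _ hv, ?_⟩
    rw [h _ (p.smul_mem _ hv), map_smul, smul_smul, mul_inv_cancel₀ hr, one_smul]

/-- On each component, `a A J + A (1 - J)` is a nonzero multiple of `A`. -/
theorem IsParityProj.exists_smul {d : ℕ} {D : LRDecomp F V d} {J : Module.End F V} {p : ℕ}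
    (hJ : IsParityProj J D p) (A : Module.End F V) {a : F} (ha : a ≠ 0) (i : ℕ) :
    ∃ r : F, r ≠ 0 ∧ ∀ v ∈ D.sub i, (a • (A * J) + A * (1 - J)) v = r • A v := by
  by_cases h : Even (p + i)
  · exact ⟨a, ha, fun v hv => by simp [hJ i v hv, h]⟩
  · exact ⟨1, one_ne_zero, fun v hv => by simp [hJ i v hv, h]⟩

theorem IsParityProj.map_eq {d : ℕ} {D : LRDecomp F V d} {J : Module.End F V} {p : ℕ}
    (hJ : IsParityProj J D p) (A : Module.End F V) {a : F} (ha : a ≠ 0) (i : ℕ) :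
    (D.sub i).map (a • (A * J) + A * (1 - J)) = (D.sub i).map A := by
  obtain ⟨r, hr, h⟩ := hJ.exists_smul A ha i
  exact map_eq_map_of_smul hr h

theorem IsLRPairWith.rescale {d : ℕ} {D : LRDecomp F V d} {A B J : Module.End F V} {p : ℕ}
    (h : IsLRPairWith A B D) (hJ : IsParityProj J D p) {a b : F} (ha : a ≠ 0) (hb : b ≠ 0) :
    IsLRPairWith (a • (A * J) + A * (1 - J)) (b • (B * J) + B * (1 - J)) D :=
  ⟨⟨(hJ.map_eq A ha 0).trans h.1.1, fun i hi => (hJ.map_eq A ha _).trans (h.1.2 i hi)⟩,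
    fun i hi => (hJ.map_eq B hb i).trans (h.2 i hi)⟩

theorem IsParityProj.trace_eq_zero {d : ℕ} {D : LRDecomp F V d} {J : Module.End F V} {p : ℕ}
    (hJ : IsParityProj J D p) {E : ℕ → Module.End F V} (hE : IsIdemSeq D E)
    {X : Module.End F V} {a : F} (ha : a ≠ 0) {i : ℕ}
    (h : LinearMap.trace F V (X * E i) = 0) :
    LinearMap.trace F V ((a • (X * J) + X * (1 - J)) * E i) = 0 := by
  obtain ⟨r, -, hr⟩ := hJ.exists_smul X ha i
  have hmul : (a • (X * J) + X * (1 - J)) * E i = r • (X * E i) :=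
    LinearMap.ext fun x => hr _ (hE.apply_mem i x)
  rw [hmul, map_smul, h, smul_zero]

theorem stmt15
    {F : Type*} [Field F] {V : Type*} [AddCommGroup V] [Module F V]
    [FiniteDimensional F V] {d : ℕ} (hdim : Module.finrank F V = d + 1)
    (A B C : Module.End F V) (DAB DBC DCA : LRDecomp F V d)
    (hAB : IsLRPairWith A B DAB) (hBC : IsLRPairWith B C DBC) (hCA : IsLRPairWith C A DCA)
    (E E' E'' : ℕ → Module.End F V)
    (hE : IsIdemSeq DAB E) (hE' : IsIdemSeq DBC E') (hE'' : IsIdemSeq DCA E'')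
    (hbip : IsBipartite d A B C E E' E'')
    (J : Module.End F V) (hJ : J = ∑ j ∈ Finset.range (d / 2 + 1), E (2 * j))
    (a b c : F) (ha : a ≠ 0) (hb : b ≠ 0) (hc : c ≠ 0)
    (A' B' C' : Module.End F V)
    (hA' : A' = a • (A * J) + A * (1 - J))
    (hB' : B' = b • (B * J) + B * (1 - J))
    (hC' : C' = c • (C * J) + C * (1 - J)) :
    IsLRTriple d A' B' C' ∧
    (∀ (D₁ D₂ D₃ : LRDecomp F V d) (E₁ E₂ E₃ : ℕ → Module.End F V),
      IsLRPairWith A' B' D₁ → IsLRPairWith B' C' D₂ → IsLRPairWith C' A' D₃ →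
      IsIdemSeq D₁ E₁ → IsIdemSeq D₂ E₂ → IsIdemSeq D₃ E₃ →
      IsBipartite d A' B' C' E₁ E₂ E₃) ∧
    (∀ D₁ D₂ D₃ : LRDecomp F V d,
      IsLRPairWith A' B' D₁ → IsLRPairWith B' C' D₂ → IsLRPairWith C' A' D₃ →
      tridiagSpace D₁ D₂ D₃ = tridiagSpace DAB DBC DCA) := by
  subst hA' hB' hC'
  have hJ₁ : IsParityProj J DAB 0 := hJ ▸ hE.isParityProj
  have hJ₂ : IsParityProj J DBC d := by
    refine .of_raises hBC.2
      (hJ₁.apply_third hAB hBC hCA hE fun i hi => (hbip i hi).1) fun v hv => ?_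
    rw [← hAB.sub_last_eq hBC] at hv
    simpa using hJ₁ d v hv
  have hJ₃ : IsParityProj J DCA 0 := by
    refine .of_raises hCA.2 (hJ₁.apply_lowers hAB.1) fun v hv => ?_
    rw [← hBC.sub_last_eq hCA] at hv
    simpa using hJ₂ d v hv
  have hP₁ := hAB.rescale hJ₁ ha hb
  have hP₂ := hBC.rescale hJ₂ hb hc
  have hP₃ := hCA.rescale hJ₃ hc ha
  refine ⟨⟨⟨_, hP₁⟩, ⟨_, hP₂⟩, ⟨_, hP₃⟩⟩, ?_, ?_⟩
  · intro D₁ D₂ D₃ E₁ E₂ E₃ h₁ h₂ h₃ hE₁ hE₂ hE₃ i hi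
    obtain rfl := hP₁.unique h₁
    obtain rfl := hP₂.unique h₂
    obtain rfl := hP₃.unique h₃
    obtain rfl := hE.unique hE₁
    obtain rfl := hE'.unique hE₂
    obtain rfl := hE''.unique hE₃
    obtain ⟨t₁, t₂, t₃⟩ := hbip i hi
    exact ⟨hJ₁.trace_eq_zero hE hc t₁, hJ₂.trace_eq_zero hE' ha t₂,
      hJ₃.trace_eq_zero hE'' hb t₃⟩
  · intro D₁ D₂ D₃ h₁ h₂ h₃
    rw [hP₁.unique h₁, hP₂.unique h₂, hP₃.unique h₃]
end
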